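/- Let M be a compact boundary irreducible aspherical n-manifold, n ≥ 2, whose boundary ∂M is also aspherical. Then ‖M,∂M‖ ≥ ‖∂M‖. -/

import Mathlib

open scoped BigOperators
set_option maxSynthPendingDepth 3
noncomputable section

/-! ## The standard topological simplex and singular chains -/

/-- The standard topological `n`-simplex. -/
def TSimplex (n : ℕ) : Type :=
  {x : Fin (n + 1) → ℝ // (∀ i, 0 ≤ x i) ∧ ∑ i, x i = 1}

instance (n : ℕ) : TopologicalSpace (TSimplex n) := instTopologicalSpaceSubtype

/-- The affine inclusion of the `i`-th face of the standard `(n+1)`-simplex. -/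
def faceMap {n : ℕ} (i : Fin (n + 2)) : C(TSimplex n, TSimplex (n + 1)) where
  toFun x := ⟨fun j => ∑ k ∈ Finset.univ.filter (fun k => i.succAbove k = j), x.1 k, by
    constructor
    · intro j
      exact Finset.sum_nonneg fun k _ => x.2.1 k
    · rw [Finset.sum_fiberwise_of_maps_to (fun k _ => Finset.mem_univ (i.succAbove k)), x.2.2]⟩
  continuous_toFun := by
    apply Continuous.subtype_mk
    exact continuous_pi fun j => continuous_finset_sum _ fun k _ =>
      (continuous_apply k).comp continuous_subtype_val

/-- The `j`-th vertex of the standard simplex. -/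
def vertexPt {m : ℕ} (j : Fin (m + 1)) : TSimplex m :=
  ⟨fun i => if i = j then 1 else 0, by
    constructor
    · intro i; dsimp only; split <;> norm_num
    · simp⟩

set_option linter.unnecessarySeqFocus false in
/-- The affine map of the standard `1`-simplex onto the edge of the standard `k`-simplex
joining the vertices `a` and `b`. -/
def segMap {k : ℕ} (a b : Fin (k + 1)) : C(TSimplex 1, TSimplex k) where
  toFun x := ⟨fun j => (if j = a then x.1 0 else 0) + (if j = b then x.1 1 else 0), by
    constructor
    · intro j
      have h0 := x.2.1 0
      have h1 := x.2.1 1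
      dsimp only
      split <;> split <;> simp_all <;> positivity
    · have := x.2.2
      rw [Finset.sum_add_distrib]
      simp [Finset.sum_ite_eq', ← this, Fin.sum_univ_two]⟩
  continuous_toFun := by
    apply Continuous.subtype_mk
    apply continuous_pi
    intro j
    apply Continuous.add
    · split
      · exact (continuous_apply (0 : Fin 2)).comp continuous_subtype_val
      · exact continuous_const
    · split
      · exact (continuous_apply (1 : Fin 2)).comp continuous_subtype_val
      · exact continuous_const

/-- A singular `n`-simplex in `X`. -/
abbrev SingSimplex (n : ℕ) (X : Type) [TopologicalSpace X] : Type := C(TSimplex n, X)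

/-- Singular `n`-chains in `X` with coefficients in `R`. -/
abbrev SChain (R : Type) [Zero R] (n : ℕ) (X : Type) [TopologicalSpace X] : Type :=
  SingSimplex n X →₀ R

/-- The singular boundary operator. -/
def sbdry (R : Type) [CommRing R] {n : ℕ} {X : Type} [TopologicalSpace X] :
    SChain R (n + 1) X →ₗ[R] SChain R n X :=
  Finsupp.lsum R fun σ => LinearMap.toSpanSingleton R _
    (∑ i : Fin (n + 2), ((-1 : ℤ) ^ (i : ℕ)) • Finsupp.single (σ.comp (faceMap i)) (1 : R))

/-- The singular boundary operator, from degree `n` to degree `n - 1`. -/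
def sbdryN (R : Type) [CommRing R] (n : ℕ) {X : Type} [TopologicalSpace X] :
    SChain R n X →ₗ[R] SChain R (n - 1) X :=
  match n with
  | 0 => 0
  | (_ + 1) => sbdry R

/-- The `j`-th face of a singular `n`-simplex. -/
def faceOf {X : Type} [TopologicalSpace X] :
    (n : ℕ) → Fin (n + 1) → SingSimplex n X → SingSimplex (n - 1) X
  | 0, _, σ => σ
  | (_ + 1), k, σ => σ.comp (faceMap k)

/-- The edge of a singular `k`-simplex joining its `a`-th and `b`-th vertices. -/
def edgeOf {X : Type} [TopologicalSpace X] {k : ℕ} (a b : Fin (k + 1))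
    (σ : SingSimplex k X) : SingSimplex 1 X :=
  σ.comp (segMap a b)

/-- The submodule of chains supported on a subspace `A`. -/
def suppOn (R : Type) [CommRing R] (n : ℕ) {X : Type} [TopologicalSpace X] (A : Set X) :
    Submodule R (SChain R n X) :=
  Finsupp.supported R R {σ : SingSimplex n X | Set.range ⇑σ ⊆ A}

/-- `z` is a relative cycle of the pair `(X, A)`. -/
def IsRelCycle (R : Type) [CommRing R] (n : ℕ) {X : Type} [TopologicalSpace X] (A : Set X)
    (z : SChain R n X) : Prop :=
  sbdryN R n z ∈ suppOn R (n - 1) A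

/-- Two chains are homologous relative to `A`. -/
def RelHomologous (R : Type) [CommRing R] (n : ℕ) {X : Type} [TopologicalSpace X] (A : Set X)
    (z z' : SChain R n X) : Prop :=
  ∃ w : SChain R (n + 1) X, z - z' - sbdry R w ∈ suppOn R n A

/-- The ℓ¹-norm of a relative chain: the sum of the norms of the coefficients of the
simplices not contained in `A`. -/
def relNorm {R : Type} [NormedCommRing R] {n : ℕ} {X : Type} [TopologicalSpace X]
    (A : Set X) (z : SChain R n X) : ℝ :=
  letI : DecidablePred fun σ : SingSimplex n X => ¬ Set.range ⇑σ ⊆ A :=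
    fun _ => Classical.dec _
  ∑ σ ∈ z.support.filter (fun σ : SingSimplex n X => ¬ Set.range ⇑σ ⊆ A), ‖z σ‖

/-- `c` is an integral fundamental cycle of the pair `(X, A)` in degree `n`: it is a relative
cycle whose class generates `H_n(X, A; ℤ)`.  For a compact connected oriented `n`-manifold
`X` with boundary `A`, this holds exactly for the representatives of `±[X, A]`. -/
def IsFundCycle (n : ℕ) {X : Type} [TopologicalSpace X] (A : Set X) (c : SChain ℤ n X) : Prop :=
  IsRelCycle ℤ n A c ∧
    ∀ z : SChain ℤ n X, IsRelCycle ℤ n A z → ∃ k : ℤ, RelHomologous ℤ n A z (k • c)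

/-- Change of coefficients `ℤ → ℝ` on chains. -/
def intToReal {n : ℕ} {X : Type} [TopologicalSpace X] (c : SChain ℤ n X) : SChain ℝ n X :=
  Finsupp.mapRange (fun k : ℤ => (k : ℝ)) (by norm_num) c

/-- Change of coefficients `ℤ → ℚ` on chains. -/
def intToRat {n : ℕ} {X : Type} [TopologicalSpace X] (c : SChain ℤ n X) : SChain ℚ n X :=
  Finsupp.mapRange (fun k : ℤ => (k : ℚ)) (by norm_num) c

/-- Change of coefficients `ℚ → ℝ` on chains. -/
def ratToReal {n : ℕ} {X : Type} [TopologicalSpace X] (c : SChain ℚ n X) : SChain ℝ n X :=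
  Finsupp.mapRange (fun k : ℚ => (k : ℝ)) (by norm_num) c

/-- The pair `(X, A)` is homologically orientable in degree `n`: the `n`-th relative
integral homology has a generator which is not trivial. -/
def HomOrientable (n : ℕ) (X : Type) [TopologicalSpace X] (A : Set X) : Prop :=
  ∃ c : SChain ℤ n X, IsFundCycle n A c ∧ ¬ RelHomologous ℤ n A c 0

/-- The simplicial volume of a pair `(X, A)`, where `X` is a compact connected oriented
`n`-manifold with boundary `A`: the infimum of the ℓ¹-norms of the real relative cycles
representing (the real image of) an integral fundamental class. -/
def simVolOr (n : ℕ) (X : Type) [TopologicalSpace X] (A : Set X) : ℝ :=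
  sInf {r : ℝ | ∃ z : SChain ℝ n X,
    (∃ c : SChain ℤ n X, IsFundCycle n A c ∧ RelHomologous ℝ n A z (intToReal c)) ∧
    r = relNorm A z}

/-- Rational version of `simVolOr`. -/
def simVolOrQ (n : ℕ) (X : Type) [TopologicalSpace X] (A : Set X) : ℝ :=
  sInf {r : ℝ | ∃ z : SChain ℚ n X,
    (∃ c : SChain ℤ n X, IsFundCycle n A c ∧ RelHomologous ℚ n A z (intToRat c)) ∧
    r = relNorm A z}

/-- `p` is a two-sheeted covering map. -/
def IsDoubleCover {Y X : Type} [TopologicalSpace Y] [TopologicalSpace X] (p : Y → X) : Prop :=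
  IsCoveringMap p ∧ ∀ x : X, Nat.card (p ⁻¹' {x}) = 2

/-- Simplicial volume of a connected pair: the norm of the fundamental class if the pair is
(homologically) orientable, and one half of the simplicial volume of the orientable double
cover otherwise. -/
def simVolConn (n : ℕ) (X : Type) [TopologicalSpace X] (A : Set X) : ℝ :=
  letI := Classical.propDecidable (HomOrientable n X A)
  if HomOrientable n X A then simVolOr n X A
  else (1 / 2) * sInf {r : ℝ | ∃ (Y : TopCat.{0}) (p : ↥Y → X), IsDoubleCover p ∧
    HomOrientable n ↥Y (p ⁻¹' A) ∧ r = simVolOr n ↥Y (p ⁻¹' A)}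

/-- The simplicial volume `‖X, A‖` of a compact manifold `X` with boundary `A`:
the sum over the connected components. -/
def SimVol (n : ℕ) (X : Type) [TopologicalSpace X] (A : Set X) : ℝ :=
  ∑ᶠ c : ConnectedComponents X,
    simVolConn n {x : X // ConnectedComponents.mk x = c} {x | ↑x ∈ A}

/-- Rational simplicial volume (for orientable manifolds). -/
def SimVolQ (n : ℕ) (X : Type) [TopologicalSpace X] (A : Set X) : ℝ :=
  ∑ᶠ c : ConnectedComponents X,
    simVolOrQ n {x : X // ConnectedComponents.mk x = c} {x | ↑x ∈ A}

/-! ## Topological manifolds with boundary -/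

/-- `X` is a topological `n`-manifold, possibly with boundary. -/
def IsManifoldWithBoundary (n : ℕ) (X : Type) [TopologicalSpace X] : Prop :=
  T2Space X ∧ SecondCountableTopology X ∧ ∀ x : X, ∃ U : Set X, x ∈ U ∧ IsOpen U ∧
    (Nonempty (U ≃ₜ EuclideanSpace ℝ (Fin n)) ∨
      Nonempty (U ≃ₜ {y : EuclideanSpace ℝ (Fin n) // 0 ≤ ∑ i, y i}))

/-- The boundary of a topological `n`-manifold: the points having no neighbourhood
homeomorphic to `ℝⁿ`. -/
def intBoundary (n : ℕ) (X : Type) [TopologicalSpace X] : Set X :=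
  {x | ¬ ∃ U : Set X, x ∈ U ∧ IsOpen U ∧ Nonempty (U ≃ₜ EuclideanSpace ℝ (Fin n))}

/-! ## Asphericity and boundary irreducibility -/

/-- A space is aspherical if all its homotopy groups `π_k`, `k ≥ 2`, at all basepoints,
are trivial. -/
def Aspherical (X : Type) [TopologicalSpace X] : Prop :=
  ∀ k : ℕ, 2 ≤ k → ∀ x : X, Subsingleton (HomotopyGroup (Fin k) X x)

/-- An `n`-manifold is boundary irreducible if the inclusion of each connected component of
its boundary is `π₁`-injective:  every loop in a boundary component which is null-homotopic
in `X` is already null-homotopic in the component. -/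
def BoundaryIrreducible (n : ℕ) (X : Type) [TopologicalSpace X] : Prop :=
  ∀ (x : X) (hx : x ∈ intBoundary n X)
    (γ : Path (X := ↥(connectedComponentIn (intBoundary n X) x))
      ⟨x, mem_connectedComponentIn hx⟩ ⟨x, mem_connectedComponentIn hx⟩),
    (γ.map continuous_subtype_val).Homotopic (Path.refl x) →
      γ.Homotopic (Path.refl _)

namespace SV
variable {R : Type} [CommRing R] {X Y Z : Type} [TopologicalSpace X] [TopologicalSpace Y]
  [TopologicalSpace Z]
abbrev I : Type := ↥unitInterval
instance (n : ℕ) : T2Space (TSimplex n) := by unfold TSimplex; infer_instance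
instance (n : ℕ) : CompactSpace (TSimplex n) := by
  exact isCompact_iff_compactSpace.mp (isCompact_stdSimplex ℝ (Fin (n + 1)))
theorem ts_ext {n : ℕ} {x y : TSimplex n} (h : ∀ i, x.1 i = y.1 i) : x = y :=
  Subtype.ext (funext h)
theorem fm_succ {n : ℕ} (i : Fin (n + 2)) (x : TSimplex n) (k : Fin (n + 1)) :
    (faceMap i x).1 (i.succAbove k) = x.1 k := by
  change (∑ k' ∈ Finset.univ.filter (fun k' => i.succAbove k' = i.succAbove k), x.1 k') = _
  simp [Finset.filter_eq']
theorem fm_self {n : ℕ} (i : Fin (n + 2)) (x : TSimplex n) : (faceMap i x).1 i = 0 := by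
  change (∑ k' ∈ Finset.univ.filter (fun k' => i.succAbove k' = i), x.1 k') = _
  simp [Fin.succAbove_ne]
theorem fm_fm {n : ℕ} (i : Fin (n + 3)) (j : Fin (n + 2)) :
    (faceMap i).comp (faceMap j) = (faceMap (i.succAbove j)).comp (faceMap (j.predAbove i)) := by
  ext x : 1
  have key : ∀ k, i.succAbove (j.succAbove k) = (i.succAbove j).succAbove ((j.predAbove i).succAbove k) :=
    fun k => (Fin.succAbove_succAbove_succAbove_predAbove i j k).symm
  apply ts_ext
  intro l
  simp only [ContinuousMap.comp_apply]
  rcases Fin.eq_self_or_eq_succAbove i l with rfl | ⟨m, rfl⟩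
  · rw [fm_self]
    have := fm_succ (l.succAbove j) (faceMap (j.predAbove l) x) (j.predAbove l)
    rw [Fin.succAbove_succAbove_predAbove, fm_self] at this
    exact this.symm
  · rw [fm_succ]
    rcases Fin.eq_self_or_eq_succAbove j m with rfl | ⟨k, rfl⟩
    · rw [fm_self, fm_self]
    · rw [key, fm_succ, fm_succ, fm_succ]
theorem sb_single {n : ℕ} (σ : SingSimplex (n + 1) X) (r : R) :
    sbdry R (Finsupp.single σ r) =
      ∑ i : Fin (n + 2), ((-1 : ℤ) ^ (i : ℕ)) • Finsupp.single (σ.comp (faceMap i)) r := by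
  rw [sbdry, Finsupp.lsum_apply, Finsupp.sum_single_index (by simp),
    LinearMap.toSpanSingleton_apply, Finset.smul_sum]
  refine Finset.sum_congr rfl fun i _ => ?_
  rw [smul_comm, Finsupp.smul_single, smul_eq_mul, mul_one]
theorem sb_sb {n : ℕ} (z : SChain R (n + 2) X) : sbdry R (sbdry R z) = 0 := by
  induction z using Finsupp.induction_linear with
  | zero => simp
  | add f g hf hg => simp [hf, hg]
  | single σ r =>
    rw [sb_single, map_sum]
    simp only [map_zsmul, sb_single, Finset.smul_sum]
    rw [← Finset.sum_product']
    refine Finset.sum_involution (fun p _ => (p.1.succAbove p.2, p.2.predAbove p.1)) ?_ ?_ ?_ ?_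
    · rintro ⟨i, j⟩ -
      simp only [ContinuousMap.comp_assoc, fm_fm i j, smul_smul, ← add_smul, ← pow_add]
      convert zero_smul ℤ _
      rcases lt_or_ge j.castSucc i with h | h
      · rw [Fin.succAbove_of_castSucc_lt _ _ h, Fin.predAbove_of_castSucc_lt _ _ h]
        simp only [Fin.val_castSucc, Fin.val_pred]
        have : (j : ℕ) < i := h
        obtain ⟨m, hm⟩ : ∃ m, (i : ℕ) = m + 1 := ⟨i - 1, by omega⟩
        rw [hm]; simp only [Nat.add_sub_cancel]; ring
      · rw [Fin.succAbove_of_le_castSucc _ _ h, Fin.predAbove_of_le_castSucc _ _ h]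
        simp only [Fin.val_succ, Fin.coe_castPred]; ring
    · rintro ⟨i, j⟩ - _ h
      exact Fin.succAbove_ne i j (congrArg Prod.fst h)
    · simp
    · rintro ⟨i, j⟩ -
      exact Prod.ext (Fin.succAbove_succAbove_predAbove i j) (Fin.predAbove_predAbove_succAbove i j)
def pf {n : ℕ} (f : C(X, Y)) : SChain R n X →ₗ[R] SChain R n Y :=
  Finsupp.lmapDomain R R (fun σ => f.comp σ)
@[simp] theorem pf_single {n : ℕ} (f : C(X, Y)) (σ : SingSimplex n X) (r : R) :
    pf f (Finsupp.single σ r) = Finsupp.single (f.comp σ) r := by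
  simp [pf]
theorem pf_pf {n : ℕ} (g : C(Y, Z)) (f : C(X, Y)) (z : SChain R n X) :
    pf g (pf f z) = pf (g.comp f) z := by
  induction z using Finsupp.induction_linear with
  | zero => simp
  | add f g hf hg => simp [hf, hg]
  | single σ r => simp [ContinuousMap.comp_assoc]
theorem pf_id {n : ℕ} (z : SChain R n X) : pf (.id X) z = z := by
  induction z using Finsupp.induction_linear with
  | zero => simp
  | add f g hf hg => simp [hf, hg]
  | single σ r => simp
theorem sb_pf {n : ℕ} (f : C(X, Y)) (z : SChain R (n + 1) X) :
    sbdry R (pf f z) = pf f (sbdry R z) := by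
  induction z using Finsupp.induction_linear with
  | zero => simp
  | add f g hf hg => simp [hf, hg]
  | single σ r => simp only [pf_single, sb_single, ContinuousMap.comp_assoc, map_sum, map_zsmul]
theorem single_mem {n : ℕ} {A : Set X} {σ : SingSimplex n X} (h : ∀ x, σ x ∈ A) (r : R) :
    Finsupp.single σ r ∈ suppOn R n A :=
  Finsupp.single_mem_supported R r (by rintro _ ⟨x, rfl⟩; exact h x)
theorem mem_supp {n : ℕ} {A : Set X} {z : SChain R n X} :
    z ∈ suppOn R n A ↔ ∀ σ ∈ z.support, ∀ x, σ x ∈ A := by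
  simp only [suppOn, Finsupp.mem_supported, Set.subset_def, Set.mem_ofPred_eq, Finset.mem_coe,
    Set.mem_range, forall_exists_index, forall_apply_eq_imp_iff]
theorem supp_le {n : ℕ} {A : Set X} {p : Submodule R (SChain R n X)}
    (h : ∀ σ : SingSimplex n X, (∀ x, σ x ∈ A) → Finsupp.single σ 1 ∈ p) : suppOn R n A ≤ p := by
  unfold suppOn
  rw [Finsupp.supported_eq_span_single, Submodule.span_le]
  rintro _ ⟨σ, hσ, rfl⟩
  exact h σ fun x => hσ ⟨x, rfl⟩
theorem supp_mono {n : ℕ} {A B : Set X} (h : A ⊆ B) : suppOn R n A ≤ suppOn R n B :=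
  Finsupp.supported_mono fun _ hσ => hσ.trans h
theorem supp_univ {n : ℕ} (z : SChain R n X) : z ∈ suppOn R n (Set.univ : Set X) :=
  mem_supp.2 fun _ _ _ => trivial
theorem supp_inter {n : ℕ} {A B : Set X} {z : SChain R n X} (h : z ∈ suppOn R n A)
    (h' : z ∈ suppOn R n B) : z ∈ suppOn R n (A ∩ B) :=
  mem_supp.2 fun σ hσ x => ⟨mem_supp.1 h σ hσ x, mem_supp.1 h' σ hσ x⟩
theorem supp_pf {n : ℕ} {A : Set X} {B : Set Y} {f : C(X, Y)} (hf : ∀ x ∈ A, f x ∈ B)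
    {z : SChain R n X} (h : z ∈ suppOn R n A) : pf f z ∈ suppOn R n B := by
  suffices suppOn R n A ≤ (suppOn R n B).comap (pf f) from this h
  refine supp_le fun σ hσ => ?_
  rw [Submodule.mem_comap, pf_single]
  exact single_mem (fun x => hf _ (hσ x)) _
theorem supp_sb {n : ℕ} {A : Set X} {z : SChain R (n + 1) X} (h : z ∈ suppOn R (n + 1) A) :
    sbdry R z ∈ suppOn R n A := by
  suffices suppOn R (n + 1) A ≤ (suppOn R n A).comap (sbdry R) from this h
  refine supp_le fun σ hσ => ?_
  rw [Submodule.mem_comap, sb_single]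
  exact Submodule.sum_mem _ fun i _ => zsmul_mem (single_mem (σ := σ.comp (faceMap i)) (fun x => hσ (faceMap i x)) _) _
def Cy (R : Type) [CommRing R] (n : ℕ) (A : Set X) : Submodule R (SChain R (n + 1) X) :=
  (suppOn R n A).comap (sbdry R)
def Bd (R : Type) [CommRing R] (n : ℕ) (A : Set X) : Submodule R (SChain R n X) :=
  LinearMap.range (sbdry R) ⊔ suppOn R n A
theorem mem_Cy {n : ℕ} {A : Set X} {z : SChain R (n + 1) X} :
    z ∈ Cy R n A ↔ sbdry R z ∈ suppOn R n A := Iff.rfl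
theorem mem_Bd {n : ℕ} {A : Set X} {z : SChain R n X} :
    z ∈ Bd R n A ↔ ∃ w, z - sbdry R w ∈ suppOn R n A := by
  simp only [Bd, Submodule.mem_sup, LinearMap.mem_range]
  constructor
  · rintro ⟨_, ⟨w, rfl⟩, a, ha, rfl⟩; exact ⟨w, by simpa⟩
  · rintro ⟨w, h⟩; exact ⟨_, ⟨w, rfl⟩, _, h, by simp⟩
theorem Bd_mono {n : ℕ} {A B : Set X} (h : A ⊆ B) : Bd R n A ≤ Bd R n B :=
  sup_le_sup_left (supp_mono h) _
theorem Cy_mono {n : ℕ} {A B : Set X} (h : A ⊆ B) : Cy R n A ≤ Cy R n B :=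
  Submodule.comap_mono (supp_mono h)
theorem sb_Bd {n : ℕ} {A : Set X} (w : SChain R (n + 1) X) : sbdry R w ∈ Bd R n A :=
  Submodule.mem_sup_left ⟨w, rfl⟩
theorem supp_Bd {n : ℕ} {A : Set X} {a : SChain R n X} (h : a ∈ suppOn R n A) : a ∈ Bd R n A :=
  Submodule.mem_sup_right h
theorem supp_Cy {n : ℕ} {A : Set X} {a : SChain R (n + 1) X} (h : a ∈ suppOn R (n + 1) A) :
    a ∈ Cy R n A := supp_sb h
theorem sb_Cy {n : ℕ} {A : Set X} (w : SChain R (n + 2) X) : sbdry R w ∈ Cy R n A := by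
  rw [mem_Cy, sb_sb]; exact zero_mem _
theorem Bd_le_Cy {n : ℕ} {A : Set X} : Bd R (n + 1) A ≤ Cy R n A := by
  refine sup_le ?_ fun a => supp_Cy
  rintro _ ⟨w, rfl⟩; exact sb_Cy w
theorem pf_Cy {n : ℕ} {A : Set X} {B : Set Y} {f : C(X, Y)} (hf : ∀ x ∈ A, f x ∈ B)
    {z : SChain R (n + 1) X} (h : z ∈ Cy R n A) : pf f z ∈ Cy R n B := by
  rw [mem_Cy, sb_pf]; exact supp_pf hf h
theorem pf_Bd {n : ℕ} {A : Set X} {B : Set Y} {f : C(X, Y)} (hf : ∀ x ∈ A, f x ∈ B)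
    {z : SChain R n X} (h : z ∈ Bd R n A) : pf f z ∈ Bd R n B := by
  obtain ⟨w, hw⟩ := mem_Bd.1 h
  refine mem_Bd.2 ⟨pf f w, ?_⟩
  rw [sb_pf, ← map_sub]; exact supp_pf hf hw
def jn (k : ℕ) : C(TSimplex k × I, TSimplex (k + 1)) where
  toFun p := ⟨Fin.cons (p.2 : ℝ) fun i => (1 - p.2 : ℝ) * p.1.1 i, by
    refine ⟨fun i => ?_, ?_⟩
    · refine Fin.cases ?_ (fun j => ?_) i
      · exact p.2.2.1
      · exact mul_nonneg (sub_nonneg.2 p.2.2.2) (p.1.2.1 j)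
    · rw [Fin.sum_univ_succ]
      simp [← Finset.mul_sum, p.1.2.2]⟩
  continuous_toFun := by
    apply Continuous.subtype_mk
    apply continuous_pi
    intro i
    refine Fin.cases ?_ (fun j => ?_) i
    · exact continuous_subtype_val.comp continuous_snd
    · have : Continuous fun p : TSimplex k × I => p.1.1 j :=
        (continuous_apply j).comp (continuous_subtype_val.comp continuous_fst)
      exact (continuous_const.sub (continuous_subtype_val.comp continuous_snd)).mul this
theorem jn_zero {k : ℕ} (p : TSimplex k × I) : (jn k p).1 0 = p.2 := rfl
theorem jn_succ {k : ℕ} (p : TSimplex k × I) (i : Fin (k + 1)) :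
    (jn k p).1 i.succ = (1 - p.2 : ℝ) * p.1.1 i := rfl
theorem jn_surj (k : ℕ) : Function.Surjective (jn k) := by
  intro x
  have hs : x.1 0 + ∑ i : Fin (k + 1), x.1 i.succ = 1 := by rw [← Fin.sum_univ_succ]; exact x.2.2
  have h0 : x.1 0 ≤ 1 := by
    have := Finset.sum_nonneg (s := Finset.univ) fun i (_ : i ∈ Finset.univ) => x.2.1 (Fin.succ i)
    linarith
  by_cases h : x.1 0 = 1
  · refine ⟨(vertexPt 0, 1), ts_ext fun i => ?_⟩
    refine Fin.cases ?_ (fun j => ?_) i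
    · simp [jn_zero, h]
    · rw [jn_succ]
      have hz : ∑ i : Fin (k + 1), x.1 i.succ = 0 := by linarith
      have := (Finset.sum_eq_zero_iff_of_nonneg fun i _ => x.2.1 (Fin.succ i)).1 hz j (Finset.mem_univ _)
      simp [this]
  · have hp : 0 < 1 - x.1 0 := sub_pos.2 (lt_of_le_of_ne h0 h)
    refine ⟨(⟨fun i => x.1 i.succ / (1 - x.1 0), fun i => div_nonneg (x.2.1 _) hp.le, ?_⟩,
      ⟨x.1 0, x.2.1 0, h0⟩), ts_ext fun i => ?_⟩
    · rw [← Finset.sum_div]; rw [div_eq_one_iff_eq hp.ne']; linarith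
    · refine Fin.cases rfl (fun j => ?_) i
      rw [jn_succ]; field_simp
theorem jn_quot (k : ℕ) : Topology.IsQuotientMap (jn k) :=
  (jn k).continuous.isClosedMap.isQuotientMap (jn k).continuous (jn_surj k)
theorem jn_face0 {k : ℕ} (x : TSimplex k) : faceMap 0 x = jn k (x, 0) := by
  refine ts_ext fun i => ?_
  refine Fin.cases ?_ (fun j => ?_) i
  · rw [fm_self]; rfl
  · rw [← Fin.succAbove_zero, fm_succ, Fin.succAbove_zero, jn_succ]; simp
theorem jn_face {k : ℕ} (i : Fin (k + 2)) (x : TSimplex k) (t : I) :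
    faceMap i.succ (jn k (x, t)) = jn (k + 1) (faceMap i x, t) := by
  refine ts_ext fun l => ?_
  refine Fin.cases ?_ (fun j => ?_) l
  · rw [← Fin.succ_succAbove_zero i, fm_succ]; rfl
  · rw [jn_succ]
    rcases Fin.eq_self_or_eq_succAbove i j with rfl | ⟨m, rfl⟩
    · rw [fm_self, fm_self, mul_zero]
    · rw [← Fin.succ_succAbove_succ, fm_succ, fm_succ, jn_succ]
theorem jn_face1 (x : TSimplex 0) : faceMap 1 x = jn 0 (x, 1) := by
  refine ts_ext fun i => ?_
  have h : x.1 0 = 1 := by simpa using x.2.2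
  fin_cases i
  · exact (fm_succ 1 x 0).trans h
  · exact (fm_self 1 x).trans (by change _ = (1 - ((1 : I) : ℝ)) * _; simp)
structure Contr (X : Type) [TopologicalSpace X] where
  H : C(X × I, X)
  b : X
  h0 : ∀ x, H (x, 0) = x
  h1 : ∀ x, H (x, 1) = b
def coneF (c : Contr X) {k : ℕ} (σ : SingSimplex k X) : C(TSimplex k × I, X) :=
  c.H.comp (σ.prodMap (.id I))
theorem coneF_fac (c : Contr X) {k : ℕ} (σ : SingSimplex k X) :
    Function.FactorsThrough (coneF c σ) (jn k) := by
  rintro ⟨a, s⟩ ⟨b, t⟩ h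
  have h0 : s = t := Subtype.ext (by rw [← jn_zero (a, s), h, jn_zero])
  subst h0
  by_cases h1 : s = 1
  · subst h1; exact (c.h1 _).trans (c.h1 _).symm
  · have : (1 - s : ℝ) ≠ 0 := fun h => h1 (Subtype.ext (sub_eq_zero.1 h).symm)
    have : a = b := ts_ext fun i => by
      have := congrArg (fun x => x.1 i.succ) h
      simp only [jn_succ] at this
      exact mul_left_cancel₀ ‹_› this
    rw [this]
def coneS (c : Contr X) {k : ℕ} (σ : SingSimplex k X) : SingSimplex (k + 1) X :=
  (jn_quot k).lift (f := jn k) (coneF c σ) (coneF_fac c σ)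
theorem coneS_jn (c : Contr X) {k : ℕ} (σ : SingSimplex k X) (x : TSimplex k) (t : I) :
    coneS c σ (jn k (x, t)) = c.H (σ x, t) :=
  DFunLike.congr_fun ((jn_quot k).lift_comp (f := jn k) (coneF c σ) (coneF_fac c σ)) (x, t)
def cone (c : Contr X) {k : ℕ} : SChain R k X →ₗ[R] SChain R (k + 1) X :=
  Finsupp.lmapDomain R R (coneS c)
@[simp] theorem cone_single (c : Contr X) {k : ℕ} (σ : SingSimplex k X) (r : R) :
    cone c (Finsupp.single σ r) = Finsupp.single (coneS c σ) r := by simp [cone]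
theorem sb_cone (c : Contr X) {k : ℕ} (z : SChain R (k + 1) X) :
    sbdry R (cone c z) = z - cone c (sbdry R z) := by
  induction z using Finsupp.induction_linear with
  | zero => simp
  | add f g hf hg => simp only [map_add, hf, hg]; abel
  | single σ r =>
    rw [cone_single, sb_single, sb_single, Fin.sum_univ_succ]
    have h0 : (coneS c σ).comp (faceMap 0) = σ := by
      ext x; simp [jn_face0, coneS_jn, c.h0]
    have h1 : ∀ i : Fin (k + 2), (coneS c σ).comp (faceMap i.succ) = coneS c (σ.comp (faceMap i)) := by
      intro i; ext y
      obtain ⟨⟨x, t⟩, rfl⟩ := jn_surj _ y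
      simp [jn_face, coneS_jn]
    simp only [h0, h1, map_sum, map_zsmul, cone_single, Fin.val_zero, pow_zero, one_smul,
      Fin.val_succ, pow_succ, mul_neg, mul_one, neg_smul, Finset.sum_neg_distrib]
    abel
def aug : SChain R 0 X →ₗ[R] R := Finsupp.lsum R fun _ => LinearMap.id
@[simp] theorem aug_single (σ : SingSimplex 0 X) (r : R) : aug (Finsupp.single σ r) = r := by
  simp [aug]
theorem aug_sb (z : SChain R 1 X) : aug (sbdry R z) = 0 := by
  induction z using Finsupp.induction_linear with
  | zero => simp
  | add f g hf hg => simp [hf, hg]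
  | single σ r =>
    rw [sb_single, map_sum]
    simp only [map_zsmul, aug_single]; simp
theorem sb_cone0 (c : Contr X) (z : SChain R 0 X) :
    sbdry R (cone c z) = z - Finsupp.single (.const _ c.b) (aug z) := by
  induction z using Finsupp.induction_linear with
  | zero => simp
  | add f g hf hg => simp only [map_add, hf, hg, Finsupp.single_add]; abel
  | single σ r =>
    have h0 : (coneS c σ).comp (faceMap 0) = σ := by
      ext x; simp [jn_face0, coneS_jn, c.h0]
    have h1 : (coneS c σ).comp (faceMap 1) = .const _ c.b := by
      ext x; simp [jn_face1, coneS_jn, c.h1]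
    rw [cone_single, sb_single, Fin.sum_univ_two, h0, h1]
    simp [sub_eq_add_neg]
theorem supp_cone (c : Contr X) {k : ℕ} {A : Set X} (hA : ∀ x ∈ A, ∀ t, c.H (x, t) ∈ A)
    {z : SChain R k X} (h : z ∈ suppOn R k A) : cone c z ∈ suppOn R (k + 1) A := by
  suffices suppOn R k A ≤ (suppOn R (k + 1) A).comap (cone c) from this h
  refine supp_le fun σ hσ => ?_
  rw [Submodule.mem_comap, cone_single]
  refine single_mem (fun y => ?_) _
  obtain ⟨⟨x, t⟩, rfl⟩ := jn_surj _ y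
  rw [coneS_jn]; exact hA _ (hσ x) t
def contrS (k : ℕ) (b : TSimplex k) : Contr (TSimplex k) where
  H := ⟨fun p => ⟨fun i => (1 - p.2 : ℝ) * p.1.1 i + (p.2 : ℝ) * b.1 i, by
    refine ⟨fun i => add_nonneg (mul_nonneg (sub_nonneg.2 p.2.2.2) (p.1.2.1 i))
      (mul_nonneg p.2.2.1 (b.2.1 i)), ?_⟩
    rw [Finset.sum_add_distrib, ← Finset.mul_sum, ← Finset.mul_sum, p.1.2.2, b.2.2]; ring⟩, by
    apply Continuous.subtype_mk
    refine continuous_pi fun i => ?_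
    have h1 : Continuous fun p : TSimplex k × I => p.1.1 i :=
      (continuous_apply i).comp (continuous_subtype_val.comp continuous_fst)
    have h2 : Continuous fun p : TSimplex k × I => (p.2 : ℝ) :=
      continuous_subtype_val.comp continuous_snd
    exact ((continuous_const.sub h2).mul h1).add (h2.mul continuous_const)⟩
  b := b
  h0 x := ts_ext fun i => by
    change (1 - ((0 : I) : ℝ)) * x.1 i + ((0 : I) : ℝ) * b.1 i = _; simp
  h1 x := ts_ext fun i => by
    change (1 - ((1 : I) : ℝ)) * x.1 i + ((1 : I) : ℝ) * b.1 i = _; simp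
theorem contrS_apply {k : ℕ} (b x : TSimplex k) (t : I) (i) :
    ((contrS k b).H (x, t)).1 i = (1 - t : ℝ) * x.1 i + (t : ℝ) * b.1 i := rfl
def contrI : Contr I where
  H := ⟨fun p => p.1 * unitInterval.symm p.2, by fun_prop⟩
  b := 0
  h0 x := by simp
  h1 x := by simp
def Contr.prod (c : Contr X) (d : Contr Y) : Contr (X × Y) where
  H := ⟨fun p => (c.H (p.1.1, p.2), d.H (p.1.2, p.2)), by fun_prop⟩
  b := (c.b, d.b)
  h0 x := by simp [c.h0, d.h0]
  h1 x := by simp [c.h1, d.h1]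
def inn (t : I) : C(X, X × I) := ⟨fun x => (x, t), by fun_prop⟩
@[simp] theorem inn_apply (t : I) (x : X) : inn t x = (x, t) := rfl
def contrP (k : ℕ) : Contr (TSimplex k × I) := (contrS k (vertexPt 0)).prod contrI
def PR (R : Type) [CommRing R] : (k : ℕ) → SChain R (k + 1) (TSimplex k × I)
  | 0 => cone (contrP 0) (Finsupp.single (inn 1) 1 - Finsupp.single (inn 0) 1)
  | k + 1 => cone (contrP (k + 1)) (Finsupp.single (inn 1) 1 - Finsupp.single (inn 0) 1 -
      ∑ i : Fin (k + 2), ((-1 : ℤ) ^ (i : ℕ)) • pf ((faceMap i).prodMap (.id I)) (PR R k))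
def ext {n m : ℕ} (R : Type) [CommRing R] (f : SingSimplex n X → SChain R m Y) :
    SChain R n X →ₗ[R] SChain R m Y :=
  Finsupp.lsum R fun σ => LinearMap.toSpanSingleton R _ (f σ)
@[simp] theorem ext_single {n m : ℕ} (f : SingSimplex n X → SChain R m Y) (σ : SingSimplex n X)
    (r : R) : ext R f (Finsupp.single σ r) = r • f σ := by
  rw [ext, Finsupp.lsum_apply, Finsupp.sum_single_index (by simp), LinearMap.toSpanSingleton_apply]
structure Fam (X Y : Type) [TopologicalSpace X] [TopologicalSpace Y] where
  h : ∀ {k : ℕ}, SingSimplex k X → C(TSimplex k × I, Y)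
  c : ∀ {k : ℕ} (σ : SingSimplex (k + 1) X) (i : Fin (k + 2)),
    h (σ.comp (faceMap i)) = (h σ).comp ((faceMap i).prodMap (.id I))
variable (F : Fam X Y)
def Fam.pr {k : ℕ} : SChain R k X →ₗ[R] SChain R (k + 1) Y := ext R fun σ => pf (F.h σ) (PR R k)
def Fam.e (t : I) {k : ℕ} : SChain R k X →ₗ[R] SChain R k Y :=
  Finsupp.lmapDomain R R fun σ => (F.h σ).comp (inn t)
@[simp] theorem Fam.e_single (t : I) {k : ℕ} (σ : SingSimplex k X) (r : R) :
    F.e t (Finsupp.single σ r) = Finsupp.single ((F.h σ).comp (inn t)) r := by simp [Fam.e]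
@[simp] theorem Fam.pr_single {k : ℕ} (σ : SingSimplex k X) (r : R) :
    F.pr (Finsupp.single σ r) = r • pf (F.h σ) (PR R k) := by simp [Fam.pr]
theorem Fam.sb_e (t : I) {k : ℕ} (z : SChain R (k + 1) X) :
    sbdry R (F.e t z) = F.e t (sbdry R z) := by
  induction z using Finsupp.induction_linear with
  | zero => simp
  | add f g hf hg => simp [hf, hg]
  | single σ r =>
    simp only [Fam.e_single, sb_single, map_sum, map_zsmul, F.c]
    rfl
theorem sb_PR0 : sbdry R (PR R 0) = Finsupp.single (inn 1) 1 - Finsupp.single (inn 0) 1 := by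
  rw [PR, sb_cone0]; simp
def famP (X : Type) [TopologicalSpace X] : Fam X (X × I) where
  h σ := σ.prodMap (.id I)
  c _ _ := rfl
theorem PR_succ (k : ℕ) : PR R (k + 1) = cone (contrP (k + 1)) ((famP _).e 1 (Finsupp.single (.id _) 1)
    - (famP _).e 0 (Finsupp.single (.id _) 1) - (famP _).pr (sbdry R (Finsupp.single (.id _) 1))) := by
  rw [PR, sb_single]
  simp only [Fam.e_single, map_sum, map_zsmul, Fam.pr_single, one_smul]
  rfl
theorem sb_pr0 (z : SChain R 0 X) : sbdry R (F.pr z) = F.e 1 z - F.e 0 z := by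
  induction z using Finsupp.induction_linear with
  | zero => simp
  | add f g hf hg => simp only [map_add, hf, hg]; abel
  | single σ r =>
    rw [Fam.pr_single, map_smul, sb_pf, sb_PR0]
    simp [smul_sub]
theorem sb_pr_aux {k : ℕ} (h : sbdry R (PR R (k + 1)) = (famP _).e 1 (Finsupp.single (.id _) 1)
    - (famP _).e 0 (Finsupp.single (.id _) 1) - (famP _).pr (sbdry R (Finsupp.single (.id _) 1)))
    (z : SChain R (k + 1) X) :
    sbdry R (F.pr z) = F.e 1 z - F.e 0 z - F.pr (sbdry R z) := by
  induction z using Finsupp.induction_linear with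
  | zero => simp
  | add f g hf hg => simp only [map_add, hf, hg]; abel
  | single σ r =>
    rw [Fam.pr_single, map_smul, sb_pf, h, sb_single, sb_single]
    simp only [map_sub, map_sum, Fam.e_single, pf_single, Fam.pr_single, F.c, ← pf_pf,
      smul_sub, Finset.smul_sum, Finsupp.smul_single, smul_eq_mul, mul_one]
    congr 1
    refine Finset.sum_congr rfl fun i _ => ?_
    rw [smul_assoc, one_smul, map_zsmul, smul_assoc, smul_comm]
    rfl
theorem sb_PR (k : ℕ) : sbdry R (PR R (k + 1)) = (famP _).e 1 (Finsupp.single (.id _) 1)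
    - (famP _).e 0 (Finsupp.single (.id _) 1) - (famP _).pr (sbdry R (Finsupp.single (.id _) 1)) := by
  rw [PR_succ, sb_cone, sub_eq_self]
  cases k with
  | zero => simp only [map_sub, Fam.sb_e, sb_pr0]; simp
  | succ k => simp only [map_sub, Fam.sb_e, sb_pr_aux _ (sb_PR k), sb_sb]; simp
theorem sb_pr {k : ℕ} (z : SChain R (k + 1) X) :
    sbdry R (F.pr z) = F.e 1 z - F.e 0 z - F.pr (sbdry R z) := sb_pr_aux F (sb_PR k) z
theorem supp_pr {k : ℕ} {A : Set X} {B : Set Y}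
    (hA : ∀ σ : SingSimplex k X, (∀ x, σ x ∈ A) → ∀ p, F.h σ p ∈ B)
    {z : SChain R k X} (h : z ∈ suppOn R k A) : F.pr z ∈ suppOn R (k + 1) B := by
  suffices suppOn R k A ≤ (suppOn R (k + 1) B).comap F.pr from this h
  refine supp_le fun σ hσ => ?_
  rw [Submodule.mem_comap, Fam.pr_single, one_smul]
  exact supp_pf (A := Set.univ) (fun x _ => hA σ hσ x) (supp_univ _)
theorem supp_e (t : I) {k : ℕ} {A : Set X} {B : Set Y}
    (hA : ∀ σ : SingSimplex k X, (∀ x, σ x ∈ A) → ∀ p, F.h σ (p, t) ∈ B)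
    {z : SChain R k X} (h : z ∈ suppOn R k A) : F.e t z ∈ suppOn R k B := by
  suffices suppOn R k A ≤ (suppOn R k B).comap (F.e t) from this h
  refine supp_le fun σ hσ => ?_
  rw [Submodule.mem_comap, Fam.e_single]
  exact single_mem (hA σ hσ) _
theorem e_Bd {k : ℕ} {A : Set X} {B : Set Y}
    (hA : ∀ σ : SingSimplex k X, (∀ x, σ x ∈ A) → ∀ p, F.h σ p ∈ B)
    {z : SChain R (k + 1) X} (h : z ∈ Cy R k A) : F.e 1 z - F.e 0 z ∈ Bd R (k + 1) B := by
  refine mem_Bd.2 ⟨F.pr z, ?_⟩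
  rw [sb_pr]
  simpa using supp_pr F hA h
def famH (H : C(X × I, Y)) : Fam X Y where
  h σ := H.comp (σ.prodMap (.id I))
  c _ _ := rfl
theorem famH_e (H : C(X × I, Y)) (t : I) {k : ℕ} (z : SChain R k X) :
    (famH H).e t z = pf (H.comp (inn t)) z := rfl
theorem hom_Bd (H : C(X × I, Y)) {f g : C(X, Y)} (h0 : ∀ x, H (x, 0) = f x)
    (h1 : ∀ x, H (x, 1) = g x) {k : ℕ} {A : Set X} {B : Set Y} (hA : ∀ x ∈ A, ∀ t, H (x, t) ∈ B)
    {z : SChain R (k + 1) X} (h : z ∈ Cy R k A) : pf g z - pf f z ∈ Bd R (k + 1) B := by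
  have := e_Bd (famH H) (B := B) (fun σ hσ p => hA _ (hσ p.1) p.2) h
  rw [famH_e, famH_e] at this
  rwa [show H.comp (inn 1) = g from ContinuousMap.ext h1,
    show H.comp (inn 0) = f from ContinuousMap.ext h0] at this
end SV
namespace SV
variable {R : Type} [CommRing R] {X Y Z : Type} [TopologicalSpace X] [TopologicalSpace Y]
  [TopologicalSpace Z]
theorem ts_le_one {k : ℕ} (x : TSimplex k) (i) : x.1 i ≤ 1 :=
  (Finset.single_le_sum (f := x.1) (fun i _ => x.2.1 i) (Finset.mem_univ i)).trans x.2.2.le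
def bary (k : ℕ) : TSimplex k := ⟨fun _ => ((k : ℝ) + 1)⁻¹, fun _ => by positivity, by
  simp; field_simp⟩
def nat {k m : ℕ} (d : SChain R m (TSimplex k)) : SChain R k X →ₗ[R] SChain R m X :=
  ext R fun σ => pf σ d
@[simp] theorem nat_single {k m : ℕ} (d : SChain R m (TSimplex k)) (σ : SingSimplex k X) (r : R) :
    nat d (Finsupp.single σ r) = r • pf σ d := ext_single _ _ _
theorem nat_pf {k m : ℕ} (d : SChain R m (TSimplex k)) (f : C(X, Y)) (z : SChain R k X) :
    nat d (pf f z) = pf f (nat d z) := by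
  induction z using Finsupp.induction_linear with
  | zero => simp
  | add f g hf hg => simp [hf, hg]
  | single σ r => simp only [pf_single, nat_single, map_smul, pf_pf]
theorem supp_nat {k m : ℕ} (d : SChain R m (TSimplex k)) {A : Set X} {z : SChain R k X}
    (h : z ∈ suppOn R k A) : nat d z ∈ suppOn R m A := by
  suffices suppOn R k A ≤ (suppOn R m A).comap (nat d) from this h
  refine supp_le fun σ hσ => ?_
  rw [Submodule.mem_comap, nat_single, one_smul]
  exact supp_pf (A := Set.univ) (fun x _ => hσ x) (supp_univ _)
def io (R : Type) [CommRing R] (k : ℕ) : SChain R k (TSimplex k) := Finsupp.single (.id _) 1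
theorem pf_io {k : ℕ} (σ : SingSimplex k X) : pf σ (io R k) = Finsupp.single σ 1 := by
  simp [io]
def dd (R : Type) [CommRing R] : (k : ℕ) → SChain R (k + 1) (TSimplex k)
  | 0 => 0
  | k + 1 => cone (contrS (k + 1) (bary _)) (io R (k + 1) - nat (dd R k) (sbdry R (io R (k + 1))))
def Sd : (k : ℕ) → SChain R k X →ₗ[R] SChain R k X
  | 0 => .id
  | k + 1 => .id - (sbdry R).comp (nat (dd R (k + 1))) - (nat (dd R k)).comp (sbdry R)
theorem Sd_succ {k : ℕ} (z : SChain R (k + 1) X) :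
    Sd (k + 1) z = z - sbdry R (nat (dd R (k + 1)) z) - nat (dd R k) (sbdry R z) := rfl
theorem sb_Sd {k : ℕ} (z : SChain R (k + 1) X) : sbdry R (Sd (k + 1) z) = Sd k (sbdry R z) := by
  cases k with
  | zero =>
    rw [Sd_succ, map_sub, map_sub, sb_sb]
    have : ∀ y : SChain R 0 X, nat (dd R 0) y = 0 := fun y => by
      induction y using Finsupp.induction_linear with
      | zero => simp
      | add f g hf hg => simp [hf, hg]
      | single σ r => simp [dd]
    simp [Sd, this]
  | succ k => rw [Sd_succ, Sd_succ, map_sub, map_sub, sb_sb, sb_sb]; simp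
theorem Sd_pf {k : ℕ} (f : C(X, Y)) (z : SChain R k X) : Sd k (pf f z) = pf f (Sd k z) := by
  cases k with
  | zero => rfl
  | succ k => simp only [Sd_succ, map_sub, nat_pf, sb_pf]
theorem supp_Sd {k : ℕ} {A : Set X} {z : SChain R k X} (h : z ∈ suppOn R k A) :
    Sd k z ∈ suppOn R k A := by
  cases k with
  | zero => exact h
  | succ k => exact sub_mem (sub_mem h (supp_sb (supp_nat _ h))) (supp_nat _ (supp_sb h))
theorem Sd_io {k : ℕ} : Sd (k + 1) (io R (k + 1)) =
    cone (contrS (k + 1) (bary _)) (Sd k (sbdry R (io R (k + 1)))) := by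
  have h1 : nat (dd R (k + 1)) (io R (k + 1)) = dd R (k + 1) := by
    simp [io, pf_id]
  rw [Sd_succ, h1, dd, sb_cone, map_sub]
  cases k with
  | zero =>
    have : ∀ y : SChain R 0 (TSimplex 1), nat (dd R 0) y = 0 := fun y => by
      induction y using Finsupp.induction_linear with
      | zero => simp
      | add f g hf hg => simp [hf, hg]
      | single σ r => simp [dd]
    simp only [this, map_zero]; simp [Sd]
  | succ k => rw [Sd_succ, sb_sb]; simp only [map_sub, map_zero]; abel
def Aff {j N : ℕ} (D : ℝ) (σ : SingSimplex j (TSimplex N)) : Prop :=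
  (∃ L : (Fin (j + 1) → ℝ) →ₗ[ℝ] (Fin (N + 1) → ℝ), ∀ x, (σ x).1 = L x.1) ∧
    ∀ x y, ‖(σ x).1 - (σ y).1‖ ≤ D
def AffC (R : Type) [CommRing R] (j N : ℕ) (D : ℝ) : Submodule R (SChain R j (TSimplex N)) :=
  Finsupp.supported R R {σ | Aff D σ}
theorem Aff.face {j N : ℕ} {D : ℝ} {σ : SingSimplex (j + 1) (TSimplex N)} (h : Aff D σ)
    (i : Fin (j + 2)) : Aff D (σ.comp (faceMap i)) := by
  obtain ⟨⟨L, hL⟩, h2⟩ := h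
  let F : (Fin (j + 1) → ℝ) →ₗ[ℝ] (Fin (j + 2) → ℝ) :=
    ⟨⟨fun x l => ∑ k ∈ Finset.univ.filter (fun k => i.succAbove k = l), x k, ?_⟩, ?_⟩
  · exact ⟨⟨L.comp F, fun x => hL (faceMap i x)⟩, fun x y => h2 _ _⟩
  · intro x y; ext l; simp [Finset.sum_add_distrib]
  · intro c x; ext l; simp [Finset.mul_sum]
theorem Aff.cone {j N : ℕ} {D : ℝ} {σ : SingSimplex (j + 1) (TSimplex N)} (h : Aff D σ)
    {ρ : SingSimplex j (TSimplex (j + 1))}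
    (hρ : Aff (((j : ℝ) + 1) / (j + 2) * D) (σ.comp ρ))
    (hρ' : ∃ L : (Fin (j + 1) → ℝ) →ₗ[ℝ] (Fin (j + 2) → ℝ), ∀ x, (ρ x).1 = L x.1) :
    Aff (((j : ℝ) + 1) / (j + 2) * D) (σ.comp (coneS (contrS (j + 1) (bary _)) ρ)) := by
  obtain ⟨⟨L, hL⟩, h2⟩ := h
  obtain ⟨M, hM⟩ := hρ'
  have hD : 0 ≤ D := (norm_nonneg _).trans (h2 (bary _) (bary _))
  have hc : ∀ x t, (coneS (contrS (j + 1) (bary _)) ρ (jn j (x, t))).1 =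
      (1 - t : ℝ) • (ρ x).1 + (t : ℝ) • (bary (j + 1)).1 := fun x t => by
    rw [coneS_jn]; rfl
  have hb : ∀ x, ‖(σ (bary _)).1 - (σ x).1‖ ≤ ((j : ℝ) + 1) / (j + 2) * D := by
    intro x
    have hx1 : ∀ i, x.1 i ≤ 1 := ts_le_one x
    have h2j : (0:ℝ) < j + 2 := by positivity
    let y : TSimplex (j + 1) := ⟨fun i => (1 - x.1 i) / (j + 1), fun i =>
      div_nonneg (sub_nonneg.2 (hx1 i)) (by positivity), by
        have h1 : (j : ℝ) + 1 ≠ 0 := by positivity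
        rw [← Finset.sum_div, Finset.sum_sub_distrib, x.2.2]; simp; field_simp; exact h1⟩
    have hy : (bary (j + 1)).1 = x.1 + (((j : ℝ) + 1) / (j + 2)) • (y.1 - x.1) := by
      ext i
      change (((j + 1 : ℕ) : ℝ) + 1)⁻¹ = x.1 i + ((j : ℝ) + 1) / (j + 2) * ((1 - x.1 i) / (j + 1) - x.1 i)
      push_cast; field_simp; ring
    rw [hL, hL, hy, map_add, map_smul, map_sub, add_sub_cancel_left, norm_smul, ← hL, ← hL,
      Real.norm_of_nonneg (by positivity)]
    gcongr; exact h2 _ _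
  let F : (Fin (j + 2) → ℝ) →ₗ[ℝ] (Fin (j + 2) → ℝ) :=
    ⟨⟨fun z => z 0 • (bary (j + 1)).1 + M (Fin.tail z), ?_⟩, ?_⟩
  · refine ⟨⟨L.comp F, fun z => ?_⟩, ?_⟩
    · obtain ⟨⟨x, t⟩, rfl⟩ := jn_surj _ z
      rw [ContinuousMap.comp_apply, hL, hc]
      change _ = L ((jn j (x, t)).1 0 • (bary (j + 1)).1 + M (Fin.tail (jn j (x, t)).1))
      rw [show Fin.tail (jn j (x, t)).1 = (1 - t : ℝ) • x.1 from rfl, map_smul, ← hM,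
        show (jn j (x, t)).1 0 = (t : ℝ) from rfl]
      exact congrArg L (add_comm _ _)
    · set D' := ((j : ℝ) + 1) / (j + 2) * D
      have hD' : 0 ≤ D' := by positivity
      have key : ∀ (x) (t : I) (w : Fin (N + 1) → ℝ), ‖(σ (ρ x)).1 - w‖ ≤ D' →
          ‖(σ (bary _)).1 - w‖ ≤ D' → ‖(σ (coneS (contrS (j + 1) (bary _)) ρ (jn j (x, t)))).1 - w‖ ≤ D' := by
        intro x t w h1 h2
        rw [hL, hc, map_add, map_smul, map_smul, ← hL, ← hL]
        have := (convex_closedBall w D') (mem_closedBall_iff_norm.2 h1) (mem_closedBall_iff_norm.2 h2)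
          (sub_nonneg.2 t.2.2) t.2.1 (by ring)
        exact mem_closedBall_iff_norm.1 this
      intro z z'
      obtain ⟨⟨x, t⟩, rfl⟩ := jn_surj _ z
      obtain ⟨⟨x', t'⟩, rfl⟩ := jn_surj _ z'
      refine key _ _ _ ?_ ?_
      · rw [norm_sub_rev]
        refine key _ _ _ (hρ.2 _ _) (hb _)
      · rw [norm_sub_rev]
        refine key _ _ _ ?_ (by simpa using hD')
        rw [norm_sub_rev]; exact hb _
  · intro x y
    change (x 0 + y 0) • (bary (j + 1)).1 + M (Fin.tail x + Fin.tail y) =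
      x 0 • (bary (j + 1)).1 + M (Fin.tail x) + (y 0 • (bary (j + 1)).1 + M (Fin.tail y))
    rw [map_add]; module
  · intro c x
    change (c * x 0) • (bary (j + 1)).1 + M (c • Fin.tail x) =
      c • (x 0 • (bary (j + 1)).1 + M (Fin.tail x))
    rw [map_smul, smul_add, mul_smul]
theorem Aff_id (j : ℕ) : Aff 1 (ContinuousMap.id (TSimplex j)) := by
  refine ⟨⟨.id, fun x => rfl⟩, fun x y => (pi_norm_le_iff_of_nonneg zero_le_one).2 fun i => ?_⟩
  have hx1 : ∀ x : TSimplex j, x.1 i ≤ 1 := fun x => ts_le_one x i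
  have := hx1 x; have := hx1 y; have := x.2.1 i; have := y.2.1 i
  rw [Real.norm_eq_abs]
  exact abs_le.2 ⟨by simp; linarith, by simp; linarith⟩
theorem Sd_aux (j : ℕ) : Sd j (io R j) ∈ Finsupp.supported R R
    {ρ : SingSimplex j (TSimplex j) | (∃ L : (Fin (j + 1) → ℝ) →ₗ[ℝ] (Fin (j + 1) → ℝ), ∀ x, (ρ x).1 = L x.1) ∧
      ∀ (N : ℕ) (D : ℝ) (σ : SingSimplex j (TSimplex N)), Aff D σ →
        Aff ((j : ℝ) / (j + 1) * D) (σ.comp ρ)} := by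
  induction j with
  | zero =>
    refine Finsupp.single_mem_supported R _ ⟨⟨.id, fun x => rfl⟩, fun N D σ h => ⟨h.1, fun x y => ?_⟩⟩
    have : x = y := ts_ext fun i => by
      have h1 : x.1 0 = 1 := by simpa using x.2.2
      have h2 : y.1 0 = 1 := by simpa using y.2.2
      have : i = 0 := Fin.fin_one_eq_zero i
      rw [this, h1, h2]
    simp [this]
  | succ j ih =>
    rw [Sd_io, io, sb_single, map_sum, map_sum]
    refine Submodule.sum_mem _ fun i _ => ?_
    rw [map_zsmul, map_zsmul]
    refine zsmul_mem ?_ _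
    rw [ContinuousMap.id_comp, ← pf_io (faceMap i), Sd_pf]
    generalize Sd j (io R j) = u at ih
    induction u using Finsupp.induction with
    | zero => simp
    | single_add ρ r f hρ hr hf =>
      have h1 := ih (a := ρ) (by simp [hr, Finsupp.notMem_support_iff.1 hρ])
      have h2 : ∀ a ∈ f.support, a ∈ _ := fun a ha => ih (a := a) (by
        have hne : a ≠ ρ := fun h => hρ (h ▸ ha)
        simpa [Finsupp.single_apply, hne.symm] using ha)
      rw [map_add, map_add]
      refine add_mem ?_ (hf h2)
      rw [pf_single, cone_single]
      obtain ⟨⟨L, hL⟩, h3⟩ := h1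
      have hlin := ((Aff_id (j + 1)).face i)
      have hl2 := h3 _ _ _ hlin
      refine Finsupp.single_mem_supported R _ ⟨?_, fun N D σ hσ => ?_⟩
      · refine ((Aff_id (j + 1)).cone (D := 1) (ρ := (faceMap i).comp ρ)
          ⟨hl2.1, fun x y => (hl2.2 x y).trans ?_⟩ hl2.1).1
        rw [mul_one, mul_one, div_le_div_iff₀ (by positivity) (by positivity)]; nlinarith
      · have h4 := h3 _ _ _ (hσ.face i)
        have hD : 0 ≤ D := (norm_nonneg _).trans (hσ.2 (bary _) (bary _))
        have := hσ.cone (ρ := (faceMap i).comp ρ) ⟨h4.1, fun x y => (h4.2 x y).trans ?_⟩ hl2.1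
        · convert this using 2; push_cast; ring
        · refine mul_le_mul_of_nonneg_right ?_ hD
          rw [div_le_div_iff₀ (by positivity) (by positivity)]; nlinarith
theorem Sd_iter (k m : ℕ) : (Sd k)^[m] (io R k) ∈ AffC R k k (((k : ℝ) / (k + 1)) ^ m) := by
  induction m with
  | zero =>
    rw [pow_zero]
    exact Finsupp.single_mem_supported R (1 : R) (Aff_id k)
  | succ m ih =>
    rw [Function.iterate_succ_apply']
    generalize (Sd k)^[m] (io R k) = u at ih
    unfold AffC at ih
    rw [Finsupp.supported_eq_span_single] at ih
    suffices h : Submodule.span R ((fun i => Finsupp.single i (1:R)) ''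
        {σ : SingSimplex k (TSimplex k) | Aff (((k : ℝ) / (k + 1)) ^ m) σ}) ≤
        (AffC R k k (((k : ℝ) / (k + 1)) ^ (m + 1))).comap (Sd k) from h ih
    rw [Submodule.span_le]
    rintro _ ⟨σ, hσ, rfl⟩
    change Sd k (Finsupp.single σ (1 : R)) ∈ AffC R k k _
    rw [← pf_io, Sd_pf, pf, Finsupp.lmapDomain_apply]
    have := Sd_aux (R := R) k
    classical
    intro ρ hρ
    obtain ⟨τ, hτ, rfl⟩ := Finset.mem_image.1 (Finsupp.mapDomain_support hρ)
    rw [pow_succ']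
    exact (this hτ).2 _ _ _ hσ
theorem Sd_small {k : ℕ} {A B : Set X} (hA : IsOpen A) (hB : IsOpen B) {u : SChain R k X}
    (hu : u ∈ suppOn R k (A ∪ B)) : ∃ m, (Sd k)^[m] u ∈ suppOn R k A ⊔ suppOn R k B := by
  have mono : ∀ (u : SChain R k X) m m', m ≤ m' → (Sd k)^[m] u ∈ suppOn R k A ⊔ suppOn R k B →
      (Sd k)^[m'] u ∈ suppOn R k A ⊔ suppOn R k B := by
    intro u m m' hm h
    induction hm with
    | refl => exact h
    | step _ ih =>
      rw [Function.iterate_succ_apply']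
      obtain ⟨a, ha, b, hb, e⟩ := Submodule.mem_sup.1 ih
      rw [← e, map_add]
      exact Submodule.add_mem_sup (supp_Sd ha) (supp_Sd hb)
  let T : Submodule R (SChain R k X) :=
    { carrier := {u | ∃ m, (Sd k)^[m] u ∈ suppOn R k A ⊔ suppOn R k B}
      zero_mem' := ⟨0, zero_mem _⟩
      add_mem' := by
        rintro a b ⟨m, h⟩ ⟨m', h'⟩
        refine ⟨max m m', ?_⟩
        rw [iterate_map_add]
        exact add_mem (mono _ _ _ (le_max_left _ _) h) (mono _ _ _ (le_max_right _ _) h')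
      smul_mem' := by
        rintro c a ⟨m, h⟩
        refine ⟨m, ?_⟩
        rw [show (Sd k)^[m] (c • a) = c • (Sd k)^[m] a from ?_]
        · exact Submodule.smul_mem _ _ h
        · rw [← Module.End.coe_pow, map_smul] }
  refine (supp_le (p := T) fun σ hσ => ?_) hu
  let _ : MetricSpace (TSimplex k) :=
    inferInstanceAs (MetricSpace {x : Fin (k + 1) → ℝ // (∀ i, 0 ≤ x i) ∧ ∑ i, x i = 1})
  obtain ⟨δ, hδ, hL⟩ := lebesgue_number_lemma_of_metric (s := (Set.univ : Set (TSimplex k)))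
    (c := fun b : Bool => σ ⁻¹' (if b then A else B)) isCompact_univ
    (by intro b; cases b <;> simp <;> exact IsOpen.preimage σ.continuous ‹_›)
    (fun x _ => by rcases hσ x with h | h
                   · exact Set.mem_iUnion.2 ⟨true, h⟩
                   · exact Set.mem_iUnion.2 ⟨false, h⟩)
  obtain ⟨m, hm⟩ := exists_pow_lt_of_lt_one hδ
    (show (k : ℝ) / (k + 1) < 1 by rw [div_lt_one (by positivity)]; linarith)
  refine ⟨m, ?_⟩
  have hit : (Sd k)^[m] (Finsupp.single σ (1:R)) = pf σ ((Sd k)^[m] (io R k)) := by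
    rw [← pf_io]
    exact (Function.Semiconj.iterate_right (f := pf σ) (fun z => (Sd_pf σ z).symm) m (io R k)).symm
  rw [hit]
  have h := Sd_iter (R := R) k m
  generalize (Sd k)^[m] (io R k) = u at h
  unfold AffC at h
  rw [Finsupp.supported_eq_span_single] at h
  refine (show Submodule.span R _ ≤ (suppOn R k A ⊔ suppOn R k B).comap (pf σ) from ?_) h
  rw [Submodule.span_le]
  rintro _ ⟨ρ, hρ, rfl⟩
  change pf σ (Finsupp.single ρ (1 : R)) ∈ suppOn R k A ⊔ suppOn R k B
  rw [pf_single]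
  obtain ⟨b, hb⟩ := hL (ρ (bary k)) trivial
  have : ∀ x, σ (ρ x) ∈ (if b then A else B) := fun x => hb (by
    rw [Metric.mem_ball]
    exact lt_of_le_of_lt ((dist_eq_norm (ρ x).1 (ρ (bary k)).1).le.trans (hρ.2 x (bary k))) hm)
  cases b
  · exact Submodule.mem_sup_right (single_mem this _)
  · exact Submodule.mem_sup_left (single_mem this _)
theorem small {k : ℕ} {A B : Set X} (hA : IsOpen A) (hB : IsOpen B) {u : SChain R (k + 1) X}
    (hu : u ∈ suppOn R (k + 1) (A ∪ B)) (h : sbdry R u ∈ suppOn R k A ⊔ suppOn R k B) :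
    ∃ w a b, w ∈ suppOn R (k + 2) (A ∪ B) ∧ a ∈ suppOn R (k + 1) A ∧ b ∈ suppOn R (k + 1) B ∧
      u = sbdry R w + a + b := by
  obtain ⟨m, hm⟩ := Sd_small hA hB hu
  induction m generalizing u with
  | zero =>
    obtain ⟨a, ha, b, hb, e⟩ := Submodule.mem_sup.1 hm
    exact ⟨0, a, b, zero_mem _, ha, hb, by simpa using e.symm⟩
  | succ m ih =>
    rw [Function.iterate_succ_apply] at hm
    have pres : ∀ {j l} (d : SChain R l (TSimplex j)) {y : SChain R j X}, y ∈ suppOn R j A ⊔ suppOn R j B →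
        nat d y ∈ suppOn R l A ⊔ suppOn R l B := by
      intro j l d y hy
      obtain ⟨a, ha, b, hb, rfl⟩ := Submodule.mem_sup.1 hy
      rw [map_add]
      exact Submodule.add_mem_sup (supp_nat _ ha) (supp_nat _ hb)
    obtain ⟨w, a, b, hw, ha, hb, e⟩ := ih (supp_Sd hu) (by
      rw [sb_Sd]
      obtain ⟨a, ha, b, hb, e⟩ := Submodule.mem_sup.1 h
      rw [← e, map_add]
      exact Submodule.add_mem_sup (supp_Sd ha) (supp_Sd hb)) hm
    obtain ⟨a', ha', b', hb', e'⟩ := Submodule.mem_sup.1 (pres (dd R k) h)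
    refine ⟨w + nat (dd R (k + 1)) u, a + a', b + b', add_mem hw (supp_nat _ hu), add_mem ha ha',
      add_mem hb hb', ?_⟩
    rw [Sd_succ, ← e', sub_sub, sub_eq_iff_eq_add] at e
    rw [map_add]; nth_rewrite 1 [e]; abel
theorem mv {i : ℕ} {A B : Set X} (hA : IsOpen A) (hB : IsOpen B) {z : SChain R i X}
    (h1 : z ∈ Bd R i A) (h2 : z ∈ Bd R i B) (h : Cy R i (A ∪ B) ≤ Bd R (i + 1) (A ∪ B)) :
    z ∈ Bd R i (A ∩ B) := by
  obtain ⟨w1, h1⟩ := mem_Bd.1 h1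
  obtain ⟨w2, h2⟩ := mem_Bd.1 h2
  have e : sbdry R (w1 - w2) = (z - sbdry R w2) - (z - sbdry R w1) := by rw [map_sub]; abel
  obtain ⟨v, hv⟩ := mem_Bd.1 (h (x := w1 - w2) (by
    rw [mem_Cy, e]
    exact sub_mem (supp_mono Set.subset_union_right h2) (supp_mono Set.subset_union_left h1)))
  obtain ⟨w, a, b, -, ha, hb, e'⟩ := small hA hB hv (by
    rw [map_sub, sb_sb, sub_zero, e]
    exact sub_mem (Submodule.mem_sup_right h2) (Submodule.mem_sup_left h1))
  have e2 : sbdry R w1 - sbdry R w2 = sbdry R a + sbdry R b := by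
    have := congrArg (sbdry R) e'
    simpa [sb_sb] using this
  refine mem_Bd.2 ⟨w1 - a, supp_inter ?_ ?_⟩
  · rw [map_sub, ← sub_add]; exact add_mem h1 (supp_sb ha)
  · rw [map_sub, show z - (sbdry R w1 - sbdry R a) = (z - sbdry R w2) - sbdry R b by
      rw [sub_eq_iff_eq_add.1 e2]; abel]
    exact sub_mem h2 (supp_sb hb)
theorem glue {i : ℕ} {A B : Set X} (hA : IsOpen A) (hB : IsOpen B) {x y : SChain R (i + 1) X}
    (h1 : x ∈ Cy R i A) (h2 : y ∈ Cy R i B) (h : x - y ∈ Bd R (i + 1) (A ∪ B)) :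
    ∃ z ∈ Cy R i (A ∩ B), z - x ∈ Bd R (i + 1) A ∧ z - y ∈ Bd R (i + 1) B := by
  obtain ⟨v, hv⟩ := mem_Bd.1 h
  obtain ⟨w, a, b, -, ha, hb, e⟩ := small hA hB hv (by
    rw [map_sub, sb_sb, sub_zero, map_sub]
    exact sub_mem (Submodule.mem_sup_left h1) (Submodule.mem_sup_right h2))
  have e1 : x - a - y = sbdry R (v + w) + b := by
    rw [sub_eq_iff_eq_add] at e; rw [map_add, sub_right_comm, e]; abel
  refine ⟨x - a, supp_inter ?_ ?_, ?_, ?_⟩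
  · rw [map_sub]; exact sub_mem h1 (supp_sb ha)
  · rw [sub_eq_iff_eq_add.1 e1, map_add, map_add, sb_sb, zero_add]
    exact add_mem (supp_sb hb) h2
  · rw [sub_sub_cancel_left]; exact neg_mem (supp_Bd ha)
  · rw [e1]; exact add_mem (sb_Bd _) (supp_Bd hb)
theorem supp_pf_inv {n : ℕ} {f : C(X, Y)} (hf : Function.Injective f) {B : Set Y}
    {z : SChain R n X} (h : pf f z ∈ suppOn R n B) : z ∈ suppOn R n (f ⁻¹' B) := by
  refine mem_supp.2 fun σ hσ x => mem_supp.1 h (f.comp σ) ?_ x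
  have hi : Function.Injective fun σ : SingSimplex n X => f.comp σ := fun a b h =>
    ContinuousMap.ext fun x => hf (DFunLike.congr_fun h x)
  rw [Finsupp.mem_support_iff, pf, Finsupp.lmapDomain_apply, Finsupp.mapDomain_apply hi]
  exact Finsupp.mem_support_iff.1 hσ
theorem supp_lift {n : ℕ} {f : C(X, Y)} (hf : Topology.IsEmbedding f) {A : Set X}
    {z : SChain R n Y} (h : z ∈ suppOn R n (f '' A)) : ∃ w ∈ suppOn R n A, pf f w = z := by
  suffices suppOn R n (f '' A) ≤ (suppOn R n A).map (pf f) from Submodule.mem_map.1 (this h)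
  refine supp_le fun σ hσ => ?_
  choose g hg hg' using hσ
  have hc : Continuous g := hf.continuous_iff.2 (by convert σ.continuous; ext x; exact hg' x)
  refine ⟨Finsupp.single ⟨g, hc⟩ 1, single_mem hg _, ?_⟩
  rw [pf_single]; congr 1; ext x; exact hg' x
theorem exc_surj {n : ℕ} {e : C(X, Y)} (he : Topology.IsOpenEmbedding e) {A : Set Y} (hA : IsOpen A)
    (hu : ∀ y, y ∉ A → y ∈ Set.range e) {z : SChain R (n + 1) Y} (hz : z ∈ Cy R n A) :
    ∃ h ∈ Cy R n (e ⁻¹' A), z - pf e h ∈ Bd R (n + 1) A := by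
  obtain ⟨w, a, b, -, ha, hb, rfl⟩ := small (u := z) hA he.isOpen_range
    (mem_supp.2 fun σ _ x => by by_cases h : σ x ∈ A; exacts [.inl h, .inr (hu _ h)])
    (Submodule.mem_sup_left hz)
  rw [← Set.image_univ] at hb
  obtain ⟨h, -, rfl⟩ := supp_lift he.isEmbedding hb
  refine ⟨h, ?_, ?_⟩
  · refine supp_pf_inv he.injective ?_
    rw [← sb_pf]
    rw [mem_Cy, map_add, map_add, sb_sb, zero_add] at hz
    simpa using sub_mem hz (supp_sb ha)
  · rw [add_sub_cancel_right]; exact add_mem (sb_Bd _) (supp_Bd ha)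
theorem exc_inj {n : ℕ} {e : C(X, Y)} (he : Topology.IsOpenEmbedding e) {A : Set Y} (hA : IsOpen A)
    (hu : ∀ y, y ∉ A → y ∈ Set.range e) {z : SChain R n X} (hz : pf e z ∈ Bd R n A) :
    z ∈ Bd R n (e ⁻¹' A) := by
  obtain ⟨w, hw⟩ := mem_Bd.1 hz
  obtain ⟨v, a, b, -, ha, hb, rfl⟩ := small (u := w) hA he.isOpen_range
    (mem_supp.2 fun σ _ x => by by_cases h : σ x ∈ A; exacts [.inl h, .inr (hu _ h)]) (by
      rw [← sub_sub_cancel (pf e z) (sbdry R w)]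
      exact sub_mem (Submodule.mem_sup_right (supp_pf (A := Set.univ) (fun x _ => Set.mem_range_self x) (supp_univ _)))
        (Submodule.mem_sup_left hw))
  rw [← Set.image_univ] at hb
  obtain ⟨h, -, rfl⟩ := supp_lift he.isEmbedding hb
  refine mem_Bd.2 ⟨h, supp_pf_inv he.injective ?_⟩
  rw [map_sub, ← sb_pf]
  have := add_mem hw (supp_sb ha)
  rw [map_add, map_add, sb_sb, zero_add] at this
  convert this using 1; abel
end SV
namespace SV
variable {R : Type} [CommRing R] {X Y Z : Type} [TopologicalSpace X] [TopologicalSpace Y]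
  [TopologicalSpace Z]
def Zc (R : Type) [CommRing R] (n : ℕ) (A : Set X) : Submodule R (SChain R n X) :=
  match n with
  | 0 => ⊤
  | n + 1 => Cy R n A
theorem supp_Zc {n : ℕ} {A : Set X} {a : SChain R n X} (h : a ∈ suppOn R n A) : a ∈ Zc R n A := by
  cases n with
  | zero => trivial
  | succ n => exact supp_Cy h
theorem Bd_le_Zc {n : ℕ} {A : Set X} : Bd R n A ≤ Zc R n A := by
  cases n with
  | zero => exact le_top
  | succ n => exact Bd_le_Cy
theorem pf_Zc {n : ℕ} {A : Set X} {B : Set Y} {f : C(X, Y)} (hf : ∀ x ∈ A, f x ∈ B)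
    {z : SChain R n X} (h : z ∈ Zc R n A) : pf f z ∈ Zc R n B := by
  cases n with
  | zero => trivial
  | succ n => exact pf_Cy hf h
theorem Zc_mono {n : ℕ} {A B : Set X} (h : A ⊆ B) : Zc R n A ≤ Zc R n B := by
  cases n with
  | zero => exact le_top
  | succ n => exact Cy_mono h
theorem hom_Zc (H : C(X × I, Y)) {f g : C(X, Y)} (h0 : ∀ x, H (x, 0) = f x)
    (h1 : ∀ x, H (x, 1) = g x) {k : ℕ} {A : Set X} {B : Set Y} (hA : ∀ x ∈ A, ∀ t, H (x, t) ∈ B)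
    {z : SChain R k X} (h : z ∈ Zc R k A) : pf g z - pf f z ∈ Bd R k B := by
  cases k with
  | zero =>
    have := sb_pr0 (famH H) z
    rw [famH_e, famH_e, show H.comp (inn 1) = g from ContinuousMap.ext h1,
      show H.comp (inn 0) = f from ContinuousMap.ext h0] at this
    rw [← this]; exact sb_Bd _
  | succ k => exact hom_Bd H h0 h1 hA h
theorem contr_Bd (c : Contr X) {A : Set X} (hA : ∀ x ∈ A, ∀ t, c.H (x, t) ∈ A) (hb : c.b ∈ A)
    (n : ℕ) : Zc R n A ≤ Bd R n A := by
  intro z hz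
  refine mem_Bd.2 ⟨cone c z, ?_⟩
  cases n with
  | zero => rw [sb_cone0, sub_sub_cancel]; exact single_mem (fun _ => hb) _
  | succ n => rw [sb_cone, sub_sub_cancel]; exact supp_cone c hA hz
structure Gen (n : ℕ) (A : Set X) (g : SChain ℤ n X) : Prop where
  cy : g ∈ Zc ℤ n A
  gen : ∀ z ∈ Zc ℤ n A, ∃ k : ℤ, z - k • g ∈ Bd ℤ n A
  tf : ∀ k : ℤ, k • g ∈ Bd ℤ n A → k = 0
theorem Gen.congr {n : ℕ} {A : Set X} {g g' : SChain ℤ n X} (h : Gen n A g)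
    (e : g - g' ∈ Bd ℤ n A) : Gen n A g' := by
  have e2 : ∀ k : ℤ, k • g - k • g' ∈ Bd ℤ n A := fun k => by
    rw [← smul_sub]; exact Submodule.smul_mem _ _ e
  refine ⟨?_, fun z hz => ?_, fun k hk => ?_⟩
  · rw [← sub_sub_cancel g g']; exact sub_mem h.cy (Bd_le_Zc e)
  · obtain ⟨k, hk⟩ := h.gen z hz
    exact ⟨k, by rw [← sub_add_sub_cancel]; exact add_mem hk (e2 k)⟩
  · exact h.tf k (by simpa using add_mem (e2 k) hk)
theorem Gen.heq {n : ℕ} {A : Set X} {B : Set Y} {g : SChain ℤ n X} (h : Gen n A g) (f : C(X, Y))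
    (f' : C(Y, X)) (hf : ∀ x ∈ A, f x ∈ B) (hf' : ∀ y ∈ B, f' y ∈ A)
    (h1 : ∀ z ∈ Zc ℤ n A, pf (f'.comp f) z - z ∈ Bd ℤ n A)
    (h2 : ∀ z ∈ Zc ℤ n B, pf (f.comp f') z - z ∈ Bd ℤ n B) : Gen n B (pf f g) := by
  refine ⟨pf_Zc hf h.cy, fun z hz => ?_, fun k hk => ?_⟩
  · obtain ⟨k, hk⟩ := h.gen _ (pf_Zc hf' hz)
    refine ⟨k, ?_⟩
    have := pf_Bd hf hk
    rw [map_sub, pf_pf, map_zsmul] at this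
    simpa using sub_mem this (h2 z hz)
  · refine h.tf k ?_
    have := pf_Bd hf' hk
    rw [map_zsmul, pf_pf] at this
    have h3 := sub_mem this (Submodule.smul_mem _ k (h1 g h.cy))
    rwa [smul_sub, sub_sub_cancel] at h3
section step
variable {A B : Set X} (hA : IsOpen A) (hB : IsOpen B) (eA : ∀ n, Zc R n A ≤ Bd R n A)
  (eB : ∀ n, Zc R n B ≤ Bd R n B)
include eA eB in
theorem step1 {d : ℕ} {b : SChain R d X} (hb : b ∈ Zc R d (A ∩ B)) :
    ∃ Z : SChain R (d + 1) X, ∃ a ∈ suppOn R d A, ∃ b' ∈ suppOn R d B,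
      sbdry R Z = a + b' ∧ b - b' ∈ Bd R d (A ∩ B) := by
  obtain ⟨w1, h1⟩ := mem_Bd.1 (eA _ (Zc_mono Set.inter_subset_left hb))
  obtain ⟨w2, h2⟩ := mem_Bd.1 (eB _ (Zc_mono Set.inter_subset_right hb))
  exact ⟨w1 - w2, _, neg_mem h1, _, h2, by rw [map_sub]; abel, by rw [sub_sub_cancel]; exact sb_Bd _⟩
include eA eB in
theorem step2 {d : ℕ} {a b : SChain R d X} (ha : a ∈ suppOn R d A) (hb : b ∈ suppOn R d B)
    {Z : SChain R (d + 1) X} (hZ : sbdry R Z = a + b) (h : b ∈ Bd R d (A ∩ B)) :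
    Z ∈ Bd R (d + 1) (A ∪ B) := by
  obtain ⟨w, hw⟩ := mem_Bd.1 h
  rw [← sub_add_cancel Z w]
  refine add_mem (Bd_mono Set.subset_union_left (eA (d + 1) ?_))
    (Bd_mono Set.subset_union_right (eB (d + 1) ?_))
  · change sbdry R (Z - w) ∈ suppOn R d A
    rw [map_sub, hZ, add_sub_assoc]
    exact add_mem ha (supp_mono Set.inter_subset_left hw)
  · change sbdry R w ∈ suppOn R d B
    rw [← sub_sub_cancel b (sbdry R w)]
    exact sub_mem hb (supp_mono Set.inter_subset_right hw)
include hA hB in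
theorem step3 {d : ℕ} {a b : SChain R d X} (ha : a ∈ suppOn R d A) (hb : b ∈ suppOn R d B)
    {Z : SChain R (d + 1) X} (hZ : sbdry R Z = a + b) (h : Z ∈ Bd R (d + 1) (A ∪ B)) :
    b ∈ Bd R d (A ∩ B) := by
  obtain ⟨v, hv⟩ := mem_Bd.1 h
  have e : sbdry R (Z - sbdry R v) = a + b := by rw [map_sub, sb_sb, sub_zero, hZ]
  obtain ⟨w, a', b', -, ha', hb', e'⟩ := small hA hB hv (by
    rw [e]; exact Submodule.add_mem_sup ha hb)
  rw [e', map_add, map_add, sb_sb, zero_add] at e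
  refine mem_Bd.2 ⟨b', supp_inter ?_ ?_⟩
  · rw [show b - sbdry R b' = sbdry R a' - a by rw [sub_eq_sub_iff_add_eq_add, add_comm b, e]]
    exact sub_mem (supp_sb ha') ha
  · exact sub_mem hb (supp_sb hb')
theorem supp0 {A B : Set X} : suppOn R 0 (A ∪ B) ≤ suppOn R 0 A ⊔ suppOn R 0 B := by
  refine supp_le fun σ h => ?_
  have h1 : ∀ x, x = vertexPt 0 := fun x : TSimplex 0 => ts_ext fun i => by
    have h1 : x.1 0 = 1 := by simpa using x.2.2
    have : i = 0 := Fin.fin_one_eq_zero i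
    rw [this, h1]; simp [vertexPt]
  rcases h (vertexPt 0) with h | h
  · exact Submodule.mem_sup_left (single_mem (fun x => by rwa [h1 x]) _)
  · exact Submodule.mem_sup_right (single_mem (fun x => by rwa [h1 x]) _)
include hA hB in
theorem step4 {d : ℕ} {Z : SChain R (d + 1) X} (hZ : Z ∈ Cy R d (A ∪ B)) :
    ∃ Z' : SChain R (d + 1) X, ∃ a ∈ suppOn R d A, ∃ b ∈ suppOn R d B,
      Z - Z' ∈ Bd R (d + 1) (A ∪ B) ∧ sbdry R Z' = a + b := by
  cases d with
  | zero =>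
    obtain ⟨a, ha, b, hb, e⟩ := Submodule.mem_sup.1 (supp0 hZ)
    exact ⟨Z, a, ha, b, hb, by simp, e.symm⟩
  | succ d =>
    obtain ⟨w, a, b, hw, ha, hb, e⟩ := small hA hB hZ (by rw [sb_sb]; exact zero_mem _)
    exact ⟨Z - w, a, ha, b, hb, by rw [sub_sub_cancel]; exact supp_Bd hw, by
      rw [map_sub, e, add_assoc, add_sub_cancel_left]⟩
theorem cy_of_split {d : ℕ} {a b : SChain R d X} (ha : a ∈ suppOn R d A) (hb : b ∈ suppOn R d B)
    {Z : SChain R (d + 1) X} (hZ : sbdry R Z = a + b) : b ∈ Zc R d (A ∩ B) := by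
  cases d with
  | zero => trivial
  | succ d =>
    have h : sbdry R b = - sbdry R a := by
      rw [eq_neg_iff_add_eq_zero, add_comm, ← map_add, ← hZ, sb_sb]
    exact supp_inter (by rw [h]; exact neg_mem (supp_sb ha)) (supp_sb hb)
end step
theorem stepGen {A B : Set X} (hA : IsOpen A) (hB : IsOpen B) (eA : ∀ n, Zc ℤ n A ≤ Bd ℤ n A)
    (eB : ∀ n, Zc ℤ n B ≤ Bd ℤ n B) {d : ℕ} {g : SChain ℤ d X} (h : Gen d (A ∩ B) g) :
    ∃ G, Gen (d + 1) (A ∪ B) G := by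
  obtain ⟨G, a, ha, b, hb, e, hg⟩ := step1 eA eB h.cy
  have h := h.congr hg
  refine ⟨G, ?_, fun z hz => ?_, fun k hk => ?_⟩
  · change sbdry ℤ G ∈ suppOn ℤ d (A ∪ B)
    rw [e]; exact add_mem (supp_mono Set.subset_union_left ha) (supp_mono Set.subset_union_right hb)
  · obtain ⟨Z, a', ha', b', hb', hZ, e'⟩ := step4 hA hB hz
    obtain ⟨k, hk⟩ := h.gen b' (cy_of_split ha' hb' e')
    refine ⟨k, ?_⟩
    rw [← sub_add_sub_cancel _ Z]
    refine add_mem hZ (step2 eA eB (sub_mem ha' (Submodule.smul_mem _ k ha))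
      (sub_mem hb' (Submodule.smul_mem _ k hb)) ?_ hk)
    rw [map_sub, map_smul, e, e', smul_add]; abel
  · exact h.tf k (step3 hA hB (Submodule.smul_mem _ k ha) (Submodule.smul_mem _ k hb)
      (by rw [map_smul, e, smul_add]) hk)
theorem stepVan {A B : Set X} (hA : IsOpen A) (hB : IsOpen B) (eA : ∀ n, Zc R n A ≤ Bd R n A)
    (eB : ∀ n, Zc R n B ≤ Bd R n B) {d : ℕ} (h : Zc R d (A ∩ B) ≤ Bd R d (A ∩ B)) :
    Zc R (d + 1) (A ∪ B) ≤ Bd R (d + 1) (A ∪ B) := by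
  intro z hz
  obtain ⟨Z, a', ha', b', hb', hZ, e'⟩ := step4 hA hB hz
  rw [← sub_add_cancel z Z]
  exact add_mem hZ (step2 eA eB ha' hb' e' (h (cy_of_split ha' hb' e')))
abbrev E (d : ℕ) : Type := Fin d → ℝ
def contrE {V : Type} [AddCommGroup V] [Module ℝ V] [TopologicalSpace V] [ContinuousAdd V]
    [ContinuousSMul ℝ V] (p : V) : Contr V where
  H := ⟨fun q => (1 - q.2 : ℝ) • q.1 + (q.2 : ℝ) • p, by fun_prop⟩
  b := p
  h0 x := by simp
  h1 x := by simp
theorem contrE_apply {V : Type} [AddCommGroup V] [Module ℝ V] [TopologicalSpace V] [ContinuousAdd V]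
    [ContinuousSMul ℝ V] (p x : V) (t : I) :
    (contrE p).H (x, t) = (1 - t : ℝ) • x + (t : ℝ) • p := rfl
def tailC (d : ℕ) : C(E (d + 1), E d) := ⟨Fin.tail, by unfold Fin.tail; fun_prop⟩
def consC (d : ℕ) : C(E d, E (d + 1)) := ⟨fun v => Fin.cons (α := fun _ => ℝ) 0 v, by
  refine continuous_pi fun i => ?_
  refine Fin.cases ?_ (fun j => ?_) i
  · exact continuous_const
  · exact continuous_apply j⟩
theorem eA_aux (d : ℕ) (s : ℝ) (hs : s ≠ 0) (n : ℕ) :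
    Zc R n {v : E (d + 1) | Fin.tail v ≠ 0 ∨ 0 < s * v 0} ≤
      Bd R n {v : E (d + 1) | Fin.tail v ≠ 0 ∨ 0 < s * v 0} := by
  refine contr_Bd (contrE (Fin.cons s 0)) ?_ (.inr (by simpa [contrE] using mul_self_pos.2 hs)) n
  rintro v hv t
  rw [contrE_apply]
  by_cases ht : (t : ℝ) = 1
  · right; simpa [ht] using mul_self_pos.2 hs
  have ht' : 0 < 1 - (t : ℝ) := sub_pos.2 (lt_of_le_of_ne t.2.2 ht)
  rcases hv with h | h
  · left
    contrapose! h
    ext i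
    have := congrFun h i
    simpa [Fin.tail, ht'.ne'] using this
  · right
    simp only [Pi.add_apply, Pi.smul_apply, smul_eq_mul, Fin.cons_zero]
    have : 0 ≤ (t : ℝ) * (s * s) := mul_nonneg t.2.1 (mul_self_nonneg s)
    nlinarith [mul_pos ht' h]
theorem aux_int (d : ℕ) : {v : E (d + 1) | Fin.tail v ≠ 0 ∨ 0 < 1 * v 0} ∩
    {v : E (d + 1) | Fin.tail v ≠ 0 ∨ 0 < (-1) * v 0} = {v | Fin.tail v ≠ 0} := by
  ext v; simp only [Set.mem_inter_iff, Set.mem_ofPred_eq]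
  constructor
  · rintro ⟨h | h, h' | h'⟩ <;> first | assumption | (exfalso; linarith)
  · exact fun h => ⟨.inl h, .inl h⟩
theorem aux_un (d : ℕ) : {v : E (d + 1) | Fin.tail v ≠ 0 ∨ 0 < 1 * v 0} ∪
    {v : E (d + 1) | Fin.tail v ≠ 0 ∨ 0 < (-1) * v 0} = {0}ᶜ := by
  ext v; simp only [Set.mem_union, Set.mem_ofPred_eq, Set.mem_compl_iff, Set.mem_singleton_iff]
  constructor
  · rintro h rfl
    simp at h
    exact h rfl
  · intro h
    by_contra! h'
    refine h (funext fun i => Fin.cases ?_ (fun j => ?_) i)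
    · exact le_antisymm (by simpa using h'.1.2) (by simpa using h'.2.2)
    · exact congrFun h'.1.1 j
theorem aux_open (d : ℕ) (s : ℝ) : IsOpen {v : E (d + 1) | Fin.tail v ≠ 0 ∨ 0 < s * v 0} :=
  (isOpen_ne_fun (tailC d).continuous continuous_const).union
    (isOpen_lt continuous_const (continuous_const.mul (continuous_apply 0)))
def htail (d : ℕ) : C(E (d + 1) × I, E (d + 1)) :=
  ⟨fun q => Fin.cons (α := fun _ => ℝ) ((1 - q.2 : ℝ) * q.1 0) (Fin.tail q.1), by
    refine continuous_pi fun i => ?_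
    refine Fin.cases ?_ (fun j => ?_) i
    · change Continuous fun q : E (d + 1) × I => (1 - q.2 : ℝ) * q.1 0
      fun_prop
    · change Continuous fun q : E (d + 1) × I => q.1 j.succ
      fun_prop⟩
theorem tail_cons_Bd (d : ℕ) {n : ℕ} {z : SChain R n (E (d + 1))}
    (hz : z ∈ Zc R n {v : E (d + 1) | Fin.tail v ≠ 0}) :
    pf ((consC d).comp (tailC d)) z - z ∈ Bd R n {v : E (d + 1) | Fin.tail v ≠ 0} := by
  have := hom_Zc (htail d) (f := .id _) (g := (consC d).comp (tailC d)) (k := n)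
    (A := {v | Fin.tail v ≠ 0}) (B := {v | Fin.tail v ≠ 0}) (z := z) ?_ ?_ ?_ hz
  · rwa [pf_id] at this
  · intro v; change Fin.cons (α := fun _ => ℝ) ((1 - ((0 : I) : ℝ)) * v 0) (Fin.tail v) = v; simp
  · intro v; change Fin.cons (α := fun _ => ℝ) ((1 - ((1 : I) : ℝ)) * v 0) (Fin.tail v) = Fin.cons (α := fun _ => ℝ) 0 (Fin.tail v); simp
  · intro v hv t; exact hv
theorem locE (d : ℕ) : (∃ g, Gen d ({0}ᶜ : Set (E d)) g) ∧
    ∀ i, d < i → Zc ℤ i ({0}ᶜ : Set (E d)) ≤ Bd ℤ i {0}ᶜ := by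
  induction d with
  | zero =>
    have h0 : ({0}ᶜ : Set (E 0)) = ∅ := by ext v; simp [Subsingleton.elim v 0]
    rw [h0]
    have hs : ∀ z : SChain ℤ 0 (E 0), z ∈ suppOn ℤ 0 (∅ : Set (E 0)) → z = 0 := fun z hz => by
      ext σ; by_contra h
      exact mem_supp.1 hz σ (Finsupp.mem_support_iff.2 h) (vertexPt 0)
    refine ⟨⟨Finsupp.single (.const _ 0) 1, trivial, fun z _ => ⟨aug z, mem_Bd.2 ⟨cone (contrE 0) z, ?_⟩⟩,
      fun k hk => ?_⟩, fun i hi z hz => ?_⟩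
    · rw [sb_cone0, Finsupp.smul_single, smul_eq_mul, mul_one]
      have : ∀ u : SChain ℤ 0 (E 0), u = 0 → u ∈ suppOn ℤ 0 (∅ : Set (E 0)) :=
        fun u h => h ▸ zero_mem _
      refine this _ ?_
      rw [sub_sub, sub_eq_zero]; exact (sub_add_cancel _ _).symm.trans (by rw [add_comm]; rfl)
    · obtain ⟨w, hw⟩ := mem_Bd.1 hk
      have := congrArg aug (hs _ hw)
      rw [map_sub, aug_sb] at this
      simpa using this
    · obtain ⟨i, rfl⟩ : ∃ j, i = j + 1 := ⟨i - 1, by omega⟩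
      refine mem_Bd.2 ⟨cone (contrE 0) z, ?_⟩
      rw [sb_cone, sub_sub_cancel]
      exact supp_cone _ (fun x hx => hx.elim) hz
  | succ d ih =>
    obtain ⟨⟨g, hg⟩, hv⟩ := ih
    have hA := aux_open d 1
    have hB := aux_open d (-1)
    have eA := eA_aux (R := ℤ) d 1 one_ne_zero
    have eB := eA_aux (R := ℤ) d (-1) (by norm_num)
    have t1 : ∀ x : E d, x ∈ ({0}ᶜ : Set (E d)) → consC d x ∈ {v : E (d + 1) | Fin.tail v ≠ 0} :=
      fun x hx => by change Fin.tail (Fin.cons (α := fun _ => ℝ) 0 x) ≠ 0; simpa using hx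
    have t2 : ∀ x ∈ {v : E (d + 1) | Fin.tail v ≠ 0}, tailC d x ∈ ({0}ᶜ : Set (E d)) :=
      fun x hx => hx
    rw [← aux_un]
    refine ⟨stepGen (g := pf (consC d) g) hA hB eA eB ?_, fun i hi => ?_⟩
    · rw [aux_int]
      refine hg.heq _ (tailC d) t1 t2 (fun z hz => ?_) fun z hz => tail_cons_Bd d hz
      rw [show (tailC d).comp (consC d) = .id _ from ?_, pf_id, sub_self]
      · exact zero_mem _
      · ext v : 1; exact Fin.tail_cons (α := fun _ => ℝ) 0 v
    · obtain ⟨i, rfl⟩ : ∃ j, i = j + 1 := ⟨i - 1, by omega⟩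
      refine stepVan hA hB eA eB ?_
      rw [aux_int]
      intro z hz
      have h1 := tail_cons_Bd d hz
      rw [← pf_pf] at h1
      have h2 := pf_Bd t1 (hv i (by omega) (pf_Zc t2 hz))
      simpa using sub_mem h2 h1
theorem supp_nhds [T2Space X] {n : ℕ} {x : X} {a : SChain R n X} (h : a ∈ suppOn R n {x}ᶜ) :
    ∃ N ∈ nhds x, a ∈ suppOn R n Nᶜ := by
  refine ⟨⋂ σ ∈ a.support, (Set.range σ)ᶜ, ?_, ?_⟩
  · refine (Filter.biInter_finset_mem _).2 fun σ hσ => ?_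
    refine (isCompact_range σ.continuous).isClosed.isOpen_compl.mem_nhds ?_
    rintro ⟨y, hy⟩
    exact mem_supp.1 h σ hσ y hy
  · refine mem_supp.2 fun σ hσ y hy => ?_
    exact Set.mem_iInter₂.1 hy σ hσ ⟨y, rfl⟩
theorem compl_sub {N : Set X} {y : X} (h : y ∈ N) : Nᶜ ⊆ {y}ᶜ := fun _ hz e => hz (e ▸ h)
theorem Bd_ev [T2Space X] {n : ℕ} {x : X} {a : SChain R n X} (h : a ∈ Bd R n {x}ᶜ) :
    ∀ᶠ y in nhds x, a ∈ Bd R n {y}ᶜ := by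
  obtain ⟨w, hw⟩ := mem_Bd.1 h
  obtain ⟨N, hN, h⟩ := supp_nhds hw
  filter_upwards [hN] with y hy
  exact mem_Bd.2 ⟨w, supp_mono (compl_sub hy) h⟩
theorem Cy_ev [T2Space X] {n : ℕ} {x : X} {a : SChain R (n + 1) X} (h : a ∈ Cy R n {x}ᶜ) :
    ∀ᶠ y in nhds x, a ∈ Cy R n {y}ᶜ := by
  obtain ⟨N, hN, h⟩ := supp_nhds h
  filter_upwards [hN] with y hy
  exact supp_mono (compl_sub hy) h
def trans {d : ℕ} (y : E d) : C(E d, E d) := ⟨fun v => v + y, by fun_prop⟩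
theorem Gen.exc {n : ℕ} {e : C(X, Y)} (he : Topology.IsOpenEmbedding e) {A : Set Y} (hA : IsOpen A)
    (hu : ∀ y, y ∉ A → y ∈ Set.range e) {g : SChain ℤ (n + 1) X} (h : Gen (n + 1) (e ⁻¹' A) g) :
    Gen (n + 1) A (pf e g) := by
  refine ⟨pf_Zc (fun _ h => h) h.cy, fun z hz => ?_, fun k hk => ?_⟩
  · obtain ⟨w, hw, hw'⟩ := exc_surj he hA hu hz
    obtain ⟨k, hk⟩ := h.gen w hw
    refine ⟨k, ?_⟩
    have := add_mem hw' (pf_Bd (f := e) (B := A) (fun _ h => h) hk)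
    simpa using this
  · rw [← map_zsmul] at hk
    exact h.tf k (exc_inj he hA hu hk)
theorem Gen.exc_inv {n : ℕ} {e : C(X, Y)} (he : Topology.IsOpenEmbedding e) {A : Set Y} (hA : IsOpen A)
    (hu : ∀ y, y ∉ A → y ∈ Set.range e) {g : SChain ℤ (n + 1) X}
    (hg : g ∈ Cy ℤ n (e ⁻¹' A)) (h : Gen (n + 1) A (pf e g)) :
    Gen (n + 1) (e ⁻¹' A) g := by
  refine ⟨hg, fun z hz => ?_, fun k hk => ?_⟩
  · obtain ⟨k, hk⟩ := h.gen (pf e z) (pf_Zc (fun _ h => h) hz)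
    refine ⟨k, exc_inj he hA hu ?_⟩
    rwa [map_sub, map_zsmul]
  · refine h.tf k ?_
    rw [← map_zsmul]; exact pf_Bd (fun _ h => h) hk
theorem Gen.transl {d : ℕ} {x : E d} {g : SChain ℤ d (E d)} (h : Gen d {x}ᶜ g) (y : E d) :
    Gen d {x + y}ᶜ (pf (trans y) g) := by
  refine h.heq _ (trans (-y)) ?_ ?_ (fun z _ => ?_) fun z _ => ?_
  · intro z hz he; exact hz (add_right_cancel (b := y) he)
  · intro z hz he
    exact hz (by rw [Set.mem_singleton_iff] at he ⊢; rw [← he]; exact (neg_add_cancel_right z y).symm)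
  · rw [show (trans (-y)).comp (trans y) = .id _ from
      ContinuousMap.ext fun v => add_neg_cancel_right v y, pf_id, sub_self]
    exact zero_mem _
  · rw [show (trans y).comp (trans (-y)) = .id _ from
      ContinuousMap.ext fun v => neg_add_cancel_right v y, pf_id, sub_self]
    exact zero_mem _
theorem Gen.evE {n : ℕ} {g : SChain ℤ (n + 1) (E (n + 1))} (h : Gen (n + 1) {0}ᶜ g) :
    ∀ᶠ y in nhds (0 : E (n + 1)), Gen (n + 1) {y}ᶜ g := by
  obtain ⟨N, hN, hg⟩ := supp_nhds h.cy
  obtain ⟨r, hr, hb⟩ := Metric.mem_nhds_iff.1 hN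
  filter_upwards [Metric.ball_mem_nhds 0 hr] with y hy
  have h1 := h.transl y
  rw [zero_add] at h1
  refine h1.congr ?_
  have := hom_Bd (k := n) (A := Nᶜ) (B := {y}ᶜ) (z := g) (f := .id _) (g := trans y)
    ⟨fun q : E (n + 1) × I => q.1 + (q.2 : ℝ) • y, by fun_prop⟩ (fun v => by simp)
    (fun v => by simp [trans]) ?_ hg
  · rwa [pf_id] at this
  · rintro v hv t (he : v + (t : ℝ) • y = y)
    refine hv (hb ?_)
    have : v = (1 - t : ℝ) • y := by rw [sub_smul, one_smul]; exact eq_sub_of_add_eq he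
    rw [this, mem_ball_zero_iff, norm_smul, Real.norm_of_nonneg (sub_nonneg.2 t.2.2)]
    rw [mem_ball_zero_iff] at hy
    nlinarith [norm_nonneg y, t.2.1]
def LE (d : ℕ) (W : Type) [TopologicalSpace W] : Prop :=
  ∀ x : W, ∃ e : C(E d, W), Topology.IsOpenEmbedding e ∧ e 0 = x
theorem cov_sing {e : C(X, Y)} {p : X} : ∀ y, y ∉ ({e p}ᶜ : Set Y) → y ∈ Set.range e := by
  intro y hy; simp at hy; exact ⟨p, hy.symm⟩
theorem pre_sing {e : C(X, Y)} (he : Topology.IsOpenEmbedding e) (p : X) :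
    e ⁻¹' ({e p}ᶜ) = {p}ᶜ := by ext q; simp [he.injective.eq_iff]
theorem LE.gen {n : ℕ} [T2Space X] (h : LE (n + 1) X) (x : X) : ∃ g, Gen (n + 1) {x}ᶜ g := by
  obtain ⟨e, he, rfl⟩ := h x
  obtain ⟨g, hg⟩ := (locE (n + 1)).1
  exact ⟨pf e g, Gen.exc he isOpen_compl_singleton cov_sing (by rw [pre_sing he]; exact hg)⟩
theorem Gen.ev {n : ℕ} [T2Space X] (h : LE (n + 1) X) {x : X} {g : SChain ℤ (n + 1) X}
    (hg : Gen (n + 1) {x}ᶜ g) : ∀ᶠ y in nhds x, Gen (n + 1) {y}ᶜ g := by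
  obtain ⟨e, he, rfl⟩ := h x
  obtain ⟨w, hw, hw'⟩ := exc_surj he isOpen_compl_singleton cov_sing hg.cy
  have h1 := Gen.exc_inv he isOpen_compl_singleton cov_sing hw (hg.congr hw')
  rw [pre_sing he] at h1
  have h2 := h1.evE
  have h3 := (he.isOpenMap.image_mem_nhds h2)
  filter_upwards [h3, Bd_ev hw'] with y hy hy'
  obtain ⟨v, hv, rfl⟩ := hy
  have h4 : Gen (n + 1) {e v}ᶜ (pf e w) := by
    refine Gen.exc he isOpen_compl_singleton cov_sing ?_
    rw [pre_sing he]; exact hv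
  refine h4.congr ?_
  rw [← neg_sub]; exact neg_mem hy'
end SV
namespace SV
variable {X Y : Type} [TopologicalSpace X] [TopologicalSpace Y]
theorem conv_push {d j : ℕ} {C : Set (E d)} (hC : IsCompact C) (hc : Convex ℝ C) {x : E d}
    (hx : x ∈ C) {z : SChain ℤ (j + 1) (E d)} (hz : z ∈ Cy ℤ j Cᶜ)
    (h : z ∈ Bd ℤ (j + 1) {x}ᶜ) : z ∈ Bd ℤ (j + 1) Cᶜ := by
  obtain ⟨w, hw⟩ := mem_Bd.1 h
  obtain ⟨N, hN, hw⟩ := supp_nhds hw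
  obtain ⟨r, hr, hb⟩ := Metric.mem_nhds_iff.1 hN
  obtain ⟨R, hR, hCR⟩ : ∃ R, 0 ≤ R ∧ ∀ v ∈ C, ‖v - x‖ ≤ R := by
    obtain ⟨R, hR⟩ := (hC.isBounded).subset_closedBall x
    refine ⟨max R 0, le_max_right _ _, fun v hv => ?_⟩
    have := hR hv
    rw [mem_closedBall_iff_norm] at this
    exact this.trans (le_max_left _ _)
  set S := R / r + 1
  have hS : 0 ≤ S := by positivity
  let H : C(E d × I, E d) := ⟨fun q => q.1 + ((q.2 : ℝ) * S) • (q.1 - x), by fun_prop⟩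
  let m : C(E d, E d) := ⟨fun v => v + S • (v - x), by fun_prop⟩
  have key := hom_Bd H (f := .id _) (g := m) (fun v => by simp [H]) (fun v => by simp [H, m])
    (A := Cᶜ) (B := Cᶜ) ?_ hz
  · rw [pf_id] at key
    rw [← sub_sub_cancel (pf m z) z]
    refine sub_mem ?_ key
    refine mem_Bd.2 ⟨pf m w, ?_⟩
    rw [sb_pf, ← map_sub]
    refine supp_pf (fun v hv hv' => ?_) hw
    have h1 := hCR _ hv'
    rw [show m v - x = (1 + S) • (v - x) by simp [m]; module, norm_smul,
      Real.norm_of_nonneg (by positivity)] at h1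
    have h2 : r ≤ ‖v - x‖ := by
      by_contra! h3
      exact hv (hb (mem_ball_iff_norm.2 h3))
    have h3 : (1 + S) * r ≤ R := (mul_le_mul_of_nonneg_left h2 (by positivity)).trans h1
    have h4 : R / r * r = R := div_mul_cancel₀ _ hr.ne'
    nlinarith
  · intro v hv t hv'
    refine hv ?_
    set s := (t : ℝ) * S
    have hs : 0 ≤ s := mul_nonneg t.2.1 hS
    have := hc hv' hx (a := 1 / (1 + s)) (b := s / (1 + s)) (by positivity) (by positivity)
      (by field_simp)
    convert this using 1
    change v = (1 / (1 + s)) • (v + s • (v - x)) + _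
    ext i; simp; field_simp; ring
theorem locEx (n : ℕ) (x : E (n + 1)) (j : ℕ) (hj : n < j) :
    Cy ℤ j ({x}ᶜ : Set (E (n + 1))) ≤ Bd ℤ (j + 1) {x}ᶜ := by
  intro z hz
  have h1 := (locE (n + 1)).2 (j + 1) (by omega) (pf_Cy (f := trans (-x)) (B := {0}ᶜ) ?_ hz)
  · have h2 := pf_Bd (f := trans x) (B := {x}ᶜ) ?_ h1
    · rwa [pf_pf, show (trans x).comp (trans (-x)) = .id _ from
        ContinuousMap.ext fun v => neg_add_cancel_right v x, pf_id] at h2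
    · intro v hv he
      exact hv (by simpa [trans] using he)
  · intro v hv he
    refine hv ?_
    have : v + -x = 0 := he
    rw [Set.mem_singleton_iff, ← sub_eq_zero, sub_eq_add_neg]; exact this
def PF (n : ℕ) (K : Set X) : Prop := ∀ j, n ≤ j → ∀ z ∈ Cy ℤ j Kᶜ,
  (∀ x ∈ K, z ∈ Bd ℤ (j + 1) {x}ᶜ) → z ∈ Bd ℤ (j + 1) Kᶜ
theorem LE.van {n : ℕ} [T2Space X] (h : LE (n + 1) X) (x : X) (j : ℕ) (hj : n < j) :
    Cy ℤ j ({x}ᶜ : Set X) ≤ Bd ℤ (j + 1) {x}ᶜ := by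
  intro z hz
  obtain ⟨e, he, rfl⟩ := h x
  obtain ⟨w, hw, hw'⟩ := exc_surj he isOpen_compl_singleton cov_sing hz
  rw [pre_sing he] at hw
  rw [← sub_add_cancel z (pf e w)]
  exact add_mem hw' (pf_Bd (fun v hv => by rw [← pre_sing he] at hv; exact hv) (locEx n 0 j hj hw))
theorem PF.union {n : ℕ} [T2Space X] (h : LE (n + 1) X) {K L : Set X} (hK : IsCompact K)
    (hL : IsCompact L) (p : PF n K) (q : PF n L) (pq : PF n (K ∩ L)) : PF n (K ∪ L) := by
  intro j hj z hz hv
  rw [Set.compl_union] at hz ⊢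
  refine mv hK.isClosed.isOpen_compl hL.isClosed.isOpen_compl
    (p j hj z (Cy_mono Set.inter_subset_left hz) fun x hx => hv x (.inl hx))
    (q j hj z (Cy_mono Set.inter_subset_right hz) fun x hx => hv x (.inr hx)) ?_
  rw [← Set.compl_inter]
  exact fun u hu => pq (j + 1) (by omega) u hu fun x hx =>
    h.van x (j + 1) (by omega) (Cy_mono (compl_sub hx) hu)
theorem PF.empty {n : ℕ} : PF n (∅ : Set X) := fun j hj z hz hv =>
  supp_Bd (by rw [Set.compl_empty]; exact mem_supp.2 fun _ _ _ => trivial)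
theorem LE_E (n : ℕ) : LE n (E n) := fun x => ⟨trans x,
  (Homeomorph.addRight x).isOpenEmbedding, by simp [trans]⟩
theorem PF.conv {n : ℕ} (l : List (Set (E (n + 1)))) (hl : ∀ C ∈ l, IsCompact C ∧ Convex ℝ C) :
    PF n {x | ∃ C ∈ l, x ∈ C} := by
  obtain ⟨m, hm⟩ : ∃ m, l.length = m := ⟨_, rfl⟩
  induction m generalizing l with
  | zero =>
    rw [List.length_eq_zero_iff.1 hm]
    convert PF.empty (n := n) using 1; simp
  | succ m ih =>
    obtain ⟨C, l, rfl⟩ := List.exists_of_length_succ l hm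
    have h1 := hl C (by simp)
    have h2 : ∀ C' ∈ l, IsCompact C' ∧ Convex ℝ C' := fun C' h => hl C' (by simp [h])
    have hm' : l.length = m := by simpa using hm
    have e : {x | ∃ C' ∈ C :: l, x ∈ C'} = C ∪ {x | ∃ C' ∈ l, x ∈ C'} := by ext; simp
    rw [e]
    refine PF.union (LE_E _) h1.1 ?_ ?_ (ih l h2 hm') ?_
    · rw [show {x | ∃ C' ∈ l, x ∈ C'} = ⋃ C' ∈ l.toFinset, C' by ext; simp]
      exact Finset.isCompact_biUnion _ fun C' h => (h2 C' (by simpa using h)).1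
    · intro j hj z hz hv
      by_cases hC : C.Nonempty
      · obtain ⟨x, hx⟩ := hC
        exact conv_push h1.1 h1.2 hx hz (hv x hx)
      · obtain rfl := Set.not_nonempty_iff_eq_empty.1 hC
        exact PF.empty j hj z hz hv
    · have := ih (l.map (C ∩ ·)) (by
        intro C' h
        obtain ⟨D, hD, rfl⟩ := List.mem_map.1 h
        exact ⟨h1.1.inter (h2 D hD).1, h1.2.inter (h2 D hD).2⟩) (by simpa)
      convert this using 1
      ext x; simp; tauto
theorem PF.E {n : ℕ} {K : Set (E (n + 1))} (hK : IsCompact K) : PF n K := by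
  intro j hj z hz hv
  have key : ∃ l : List (Set (SV.E (n + 1))), (∀ C ∈ l, IsCompact C ∧ Convex ℝ C) ∧
      K ⊆ {x | ∃ C ∈ l, x ∈ C} ∧ ∀ C ∈ l, ∀ x ∈ C, z ∈ Bd ℤ (j + 1) {x}ᶜ ∧
        sbdry ℤ z ∈ suppOn ℤ j Cᶜ := by
    refine hK.induction_on (p := fun K => ∃ l : List (Set (SV.E (n + 1))),
      (∀ C ∈ l, IsCompact C ∧ Convex ℝ C) ∧ K ⊆ {x | ∃ C ∈ l, x ∈ C} ∧
      ∀ C ∈ l, ∀ x ∈ C, z ∈ Bd ℤ (j + 1) {x}ᶜ ∧ sbdry ℤ z ∈ suppOn ℤ j Cᶜ) ?_ ?_ ?_ ?_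
    · exact ⟨[], by simp⟩
    · rintro s t hst ⟨l, h1, h2, h3⟩
      exact ⟨l, h1, hst.trans h2, h3⟩
    · rintro s t ⟨l, h1, h2, h3⟩ ⟨l', h1', h2', h3'⟩
      refine ⟨l ++ l', fun C hC => ?_, ?_, fun C hC => ?_⟩
      · rcases List.mem_append.1 hC with h | h
        exacts [h1 C h, h1' C h]
      · rintro x (hx | hx)
        · obtain ⟨C, h, h'⟩ := h2 hx; exact ⟨C, List.mem_append_left _ h, h'⟩
        · obtain ⟨C, h, h'⟩ := h2' hx; exact ⟨C, List.mem_append_right _ h, h'⟩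
      · rcases List.mem_append.1 hC with h | h
        exacts [h3 C h, h3' C h]
    · intro x hx
      have e1 := Bd_ev (hv x hx)
      obtain ⟨N, hN, h2⟩ := supp_nhds (supp_mono (compl_sub hx) hz : sbdry ℤ z ∈ suppOn ℤ j {x}ᶜ)
      obtain ⟨r, hr, hb⟩ := Metric.nhds_basis_closedBall.mem_iff.1 (Filter.inter_mem e1 hN)
      refine ⟨Metric.closedBall x r, mem_nhdsWithin_of_mem_nhds (Metric.closedBall_mem_nhds x hr),
        [Metric.closedBall x r], ?_, ?_, ?_⟩
      · simpa using ⟨isCompact_closedBall x r, convex_closedBall x r⟩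
      · intro y hy; exact ⟨_, by simp, hy⟩
      · intro C hC y hy
        rw [List.mem_singleton] at hC
        subst hC
        exact ⟨(hb hy).1, supp_mono (Set.compl_subset_compl.2 fun v hv => (hb hv).2) h2⟩
  obtain ⟨l, h1, h2, h3⟩ := key
  refine Bd_mono (Set.compl_subset_compl.2 h2) (PF.conv l h1 j hj z ?_ ?_)
  · refine mem_supp.2 fun σ hσ x => ?_
    rintro ⟨C, hC, hx⟩
    exact mem_supp.1 (h3 C hC _ hx).2 σ hσ x hx
  · rintro x ⟨C, hC, hx⟩
    exact (h3 C hC x hx).1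
theorem LE.nhd {n : ℕ} [T2Space X] (h : LE (n + 1) X) (x : X) : ∃ L ∈ nhds x, IsCompact L ∧
    IsClosed L ∧ ∀ K ⊆ L, IsCompact K → PF n K := by
  obtain ⟨e, he, rfl⟩ := h x
  have hc := (isCompact_closedBall (0 : E (n + 1)) 1).image e.continuous
  refine ⟨e '' Metric.closedBall 0 1, he.isOpenMap.image_mem_nhds
    (Metric.closedBall_mem_nhds 0 one_pos), hc, hc.isClosed, fun K hK hKc j hj z hz hv => ?_⟩
  have hu : ∀ y, y ∉ Kᶜ → y ∈ Set.range e := fun y hy => by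
    obtain ⟨v, -, hv⟩ := hK (not_not.1 hy); exact ⟨v, hv⟩
  obtain ⟨w, hw, hw'⟩ := exc_surj he hKc.isClosed.isOpen_compl hu hz
  have h1 : IsCompact (e ⁻¹' K) :=
    he.toIsInducing.isCompact_preimage' hKc fun y hy => hu y (not_not.2 hy)
  have h2 := PF.E h1 j hj w hw fun v hv' => by
    rw [← pre_sing he]
    refine exc_inj he isOpen_compl_singleton cov_sing ?_
    rw [← sub_sub_cancel z (pf e w)]
    exact sub_mem (hv (e v) hv') (Bd_mono (compl_sub (y := e v) hv') hw')
  rw [← sub_add_cancel z (pf e w)]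
  exact add_mem hw' (pf_Bd (fun _ h => h) h2)
theorem compact_ind [T2Space X] {K : Set X} (hK : IsCompact K) (p : Set X → Prop) (h0 : p ∅)
    (h1 : ∀ s t, IsCompact s → IsCompact t → s ⊆ K → t ⊆ K → p s → p t → p (s ∪ t))
    (h2 : ∀ x ∈ K, ∃ L ∈ nhds x, IsClosed L ∧ ∀ s ⊆ L, s ⊆ K → IsCompact s → p s) : p K := by
  have := hK.induction_on (p := fun t => ∀ s ⊆ closure t, s ⊆ K → IsCompact s → p s) ?_ ?_ ?_ ?_
  · exact this K subset_closure le_rfl hK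
  · intro s hs _ _
    rw [closure_empty, Set.subset_empty_iff] at hs
    rwa [hs]
  · exact fun s t hst h u hu => h u (hu.trans (closure_mono hst))
  · intro s t hs ht u hu huK hc
    rw [closure_union] at hu
    have := h1 (u ∩ closure s) (u ∩ closure t) (hc.inter_right isClosed_closure)
      (hc.inter_right isClosed_closure) (Set.inter_subset_left.trans huK)
      (Set.inter_subset_left.trans huK)
      (hs _ Set.inter_subset_right (Set.inter_subset_left.trans huK)
        (hc.inter_right isClosed_closure))
      (ht _ Set.inter_subset_right (Set.inter_subset_left.trans huK)
        (hc.inter_right isClosed_closure))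
    rwa [← Set.inter_union_distrib_left, Set.inter_eq_left.2 hu] at this
  · intro x hx
    obtain ⟨L, hL, hc, h⟩ := h2 x hx
    exact ⟨L, mem_nhdsWithin_of_mem_nhds hL, fun s hs => h s (hs.trans hc.closure_eq.subset)⟩
theorem LE.pf {n : ℕ} [T2Space X] (h : LE (n + 1) X) {K : Set X} (hK : IsCompact K) : PF n K := by
  have := compact_ind hK (fun K => ∀ s ⊆ K, IsCompact s → PF n s) ?_ ?_ ?_
  · exact this K le_rfl hK
  · intro s hs _; rw [Set.subset_empty_iff.1 hs]; exact PF.empty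
  · intro s t hs ht _ _ ps pt u hu hc
    have := PF.union h (hc.inter hs) (hc.inter ht) (ps _ Set.inter_subset_right (hc.inter hs))
      (pt _ Set.inter_subset_right (hc.inter ht))
      (ps _ (Set.inter_subset_left.trans Set.inter_subset_right) ((hc.inter hs).inter (hc.inter ht)))
    rwa [← Set.inter_union_distrib_left, Set.inter_eq_left.2 hu] at this
  · intro x _
    obtain ⟨L, hL, -, hc, hp⟩ := h.nhd x
    exact ⟨L, hL, hc, fun s hs _ _ u hu huc => hp u (hu.trans hs) huc⟩
theorem LE.sec {n : ℕ} [T2Space X] (h : LE (n + 1) X) {K : Set X} (hK : IsCompact K)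
    (s : X → SChain ℤ (n + 1) X) (hs : ∀ x ∈ K, s x ∈ Cy ℤ n {x}ᶜ)
    (hl : ∀ x ∈ K, ∀ᶠ y in nhds x, y ∈ K → s y - s x ∈ Bd ℤ (n + 1) {y}ᶜ) :
    ∃ z ∈ Cy ℤ n Kᶜ, ∀ x ∈ K, z - s x ∈ Bd ℤ (n + 1) {x}ᶜ := by
  refine compact_ind hK (fun K => ∃ z ∈ Cy ℤ n Kᶜ, ∀ x ∈ K, z - s x ∈ Bd ℤ (n + 1) {x}ᶜ) ?_ ?_ ?_
  · exact ⟨0, zero_mem _, by simp⟩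
  · rintro A B hA hB - - ⟨z, hz, h1⟩ ⟨w, hw, h2⟩
    obtain ⟨u, hu, h3, h4⟩ := glue hA.isClosed.isOpen_compl hB.isClosed.isOpen_compl hz hw (by
      rw [← Set.compl_inter]
      refine h.pf (hA.inter hB) n le_rfl _ (sub_mem (Cy_mono ?_ hz) (Cy_mono ?_ hw)) fun x hx => ?_
      · exact Set.compl_subset_compl.2 Set.inter_subset_left
      · exact Set.compl_subset_compl.2 Set.inter_subset_right
      · rw [← sub_sub_sub_cancel_right z w (s x)]; exact sub_mem (h1 x hx.1) (h2 x hx.2))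
    refine ⟨u, by rwa [Set.compl_union], ?_⟩
    rintro x (hx | hx)
    · rw [← sub_add_sub_cancel u z]; exact add_mem (Bd_mono (compl_sub hx) h3) (h1 x hx)
    · rw [← sub_add_sub_cancel u w]; exact add_mem (Bd_mono (compl_sub hx) h4) (h2 x hx)
  · intro x hx
    obtain ⟨L, hL, hc, hcl, -⟩ := h.nhd x
    obtain ⟨N, hN, hN'⟩ := supp_nhds (hs x hx)
    have : LocallyCompactSpace X := by
      refine LocallyCompactSpace.of_hasBasis (p := fun x s => s ∈ nhds x ∧ IsCompact s)
        (s := fun _ s => s) (fun x => ?_) fun x s h => h.2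
      refine Filter.hasBasis_iff.2 fun t => ⟨fun ht => ?_, fun ⟨s, hs, hst⟩ =>
        Filter.mem_of_superset hs.1 hst⟩
      obtain ⟨e, he, rfl⟩ := h x
      obtain ⟨r, hr, hb⟩ := Metric.nhds_basis_closedBall.mem_iff.1
        (e.continuous.continuousAt.preimage_mem_nhds ht)
      exact ⟨e '' Metric.closedBall 0 r, ⟨he.isOpenMap.image_mem_nhds
        (Metric.closedBall_mem_nhds 0 hr), (isCompact_closedBall 0 r).image e.continuous⟩,
        Set.image_subset_iff.2 hb⟩
    obtain ⟨L', hL', hsub, hc'⟩ := LocallyCompactSpace.local_compact_nhds x _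
      (Filter.inter_mem hN (hl x hx))
    refine ⟨L', hL', hc'.isClosed, fun t ht htK _ => ⟨s x, supp_mono (Set.compl_subset_compl.2
      fun y hy => (hsub (ht hy)).1) hN', fun y hy => ?_⟩⟩
    rw [← neg_sub]; exact neg_mem ((hsub (ht hy)).2 (htK hy))
end SV
namespace SV
variable {X Y : Type} [TopologicalSpace X] [TopologicalSpace Y]
def vl (T : Set X) : C(T, X) := ⟨Subtype.val, continuous_subtype_val⟩
theorem vl_inj (T : Set X) : Function.Injective (vl T) := Subtype.val_injective
theorem lift_sub {R : Type} [CommRing R] {n : ℕ} {T : Set X} {z : SChain R n X}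
    (h : z ∈ suppOn R n T) : ∃ w, pf (vl T) w = z := by
  obtain ⟨w, -, h⟩ := supp_lift (f := vl T) (A := Set.univ) (z := z) Topology.IsEmbedding.subtypeVal
    (by rw [Set.image_univ, show Set.range (vl T) = T from Subtype.range_coe]; exact h)
  exact ⟨w, h⟩
abbrev Wt (A : Set X) : Type := {p : X × ℝ // 0 ≤ p.2 ∧ (p.2 = 0 ∨ p.1 ∈ A)}
def wi (A : Set X) : C(X, Wt A) := ⟨fun x => ⟨(x, 0), le_rfl, .inl rfl⟩, by fun_prop⟩
def wr (A : Set X) : C(Wt A, X) := ⟨fun p => p.1.1, by fun_prop⟩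
def K0c (A : Set X) : Set (Wt A) := (Set.range (wi A))ᶜ
theorem mem_K0c {A : Set X} {p : Wt A} : p ∈ K0c A ↔ 0 < p.1.2 := by
  constructor
  · intro h
    refine lt_of_le_of_ne p.2.1 fun h0 => h ⟨p.1.1, Subtype.ext (Prod.ext rfl h0)⟩
  · rintro h ⟨x, rfl⟩; exact lt_irrefl _ h
theorem wr_mem {A : Set X} : ∀ p ∈ K0c A, wr A p ∈ A := fun p hp =>
  p.2.2.resolve_left (mem_K0c.1 hp).ne'
theorem wr_Cy {A : Set X} {n : ℕ} {u : SChain ℤ (n + 1) (Wt A)} (h : u ∈ Cy ℤ n (K0c A)) :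
    pf (wr A) u ∈ Cy ℤ n A := pf_Cy wr_mem h
theorem wr_Bd {A : Set X} {n : ℕ} {u : SChain ℤ n (Wt A)} (h : u ∈ Bd ℤ n (K0c A)) :
    pf (wr A) u ∈ Bd ℤ n A := pf_Bd wr_mem h
theorem push_up {A : Set X} {n : ℕ} {c : SChain ℤ (n + 1) (Wt A)}
    (hc : c ∈ suppOn ℤ (n + 1) {p : Wt A | p.1.1 ∈ A}) (h : c ∈ Cy ℤ n (K0c A)) :
    c ∈ Bd ℤ (n + 1) (K0c A) := by
  let T := {p : Wt A | p.1.1 ∈ A}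
  let v : C(T, Wt A) := vl T
  obtain ⟨w, rfl⟩ := lift_sub (T := T) hc
  let H : C(T × I, Wt A) := ⟨fun q => ⟨(q.1.1.1.1, q.1.1.1.2 + q.2),
    add_nonneg q.1.1.2.1 q.2.2.1, .inr q.1.2⟩, by fun_prop⟩
  let g : C(T, Wt A) := H.comp (inn 1)
  have hw : w ∈ Cy ℤ n (v ⁻¹' K0c A) := by
    refine supp_pf_inv Subtype.val_injective ?_
    rw [← sb_pf]; exact h
  have := hom_Bd H (f := v) (g := g) (B := K0c A) (fun x => Subtype.ext (Prod.ext rfl (add_zero _)))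
    (fun x => rfl) ?_ hw
  · rw [← sub_sub_cancel (pf g w) (pf v w)]
    refine sub_mem (supp_Bd (supp_pf (A := Set.univ) (fun x _ => mem_K0c.2 ?_) (supp_univ _))) this
    exact add_pos_of_nonneg_of_pos x.1.2.1 one_pos
  · intro x hx t
    exact mem_K0c.2 (add_pos_of_pos_of_nonneg (mem_K0c.1 hx) t.2.1)
theorem wr_inj {A : Set X} {n : ℕ} {u : SChain ℤ (n + 1) (Wt A)} (hu : u ∈ Cy ℤ n (K0c A))
    (h : pf (wr A) u ∈ Bd ℤ (n + 1) A) : u ∈ Bd ℤ (n + 1) (K0c A) := by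
  obtain ⟨w, hw⟩ := mem_Bd.1 h
  let H : C(Wt A × I, Wt A) := ⟨fun q => ⟨(q.1.1.1, q.2 * q.1.1.2), mul_nonneg q.2.2.1 q.1.2.1,
    q.1.2.2.imp (fun h => by simp [h]) id⟩, by fun_prop⟩
  have e := sb_pr (famH H) u
  rw [famH_e, famH_e, show H.comp (inn 1) = .id _ from ContinuousMap.ext fun p => Subtype.ext
    (Prod.ext rfl (one_mul _)), show H.comp (inn 0) = (wi A).comp (wr A) from
    ContinuousMap.ext fun p => Subtype.ext (Prod.ext rfl (zero_mul _)), pf_id, ← pf_pf] at e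
  set q := (famH H).pr (sbdry ℤ u)
  have hq : q ∈ suppOn ℤ (n + 1) {p : Wt A | p.1.1 ∈ A} :=
    supp_pr _ (A := K0c A) (fun σ hσ p => wr_mem _ (hσ p.1)) hu
  set a := pf (wr A) u - sbdry ℤ w
  have ha : pf (wi A) a ∈ suppOn ℤ (n + 1) {p : Wt A | p.1.1 ∈ A} :=
    supp_pf (fun x hx => hx) hw
  have e2 : u = (pf (wi A) a + q) + (sbdry ℤ ((famH H).pr u) + sbdry ℤ (pf (wi A) w)) := by
    rw [e, sb_pf, map_sub]; abel
  have h3 : pf (wi A) a + q ∈ Cy ℤ n (K0c A) := by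
    rw [eq_sub_of_add_eq e2.symm]; exact sub_mem hu (add_mem (sb_Cy _) (sb_Cy _))
  rw [e2]
  exact add_mem (push_up (add_mem ha hq) h3) (add_mem (sb_Bd _) (sb_Bd _))
theorem pf_inj {n : ℕ} {f : C(X, Y)} (hf : Function.Injective f) :
    Function.Injective (pf (R := ℤ) (n := n) f) :=
  Finsupp.mapDomain_injective fun a b h => ContinuousMap.ext fun x => hf (DFunLike.congr_fun h x)
theorem hatE {A A1 : Set X} (hA : A1 ⊆ A) {n : ℕ} {z : SChain ℤ (n + 1) X}
    (hz : z ∈ Cy ℤ n A1) : ∃ u ∈ Cy ℤ n (K0c A), pf (wr A) u - z ∈ suppOn ℤ (n + 1) A ∧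
      u ∈ suppOn ℤ (n + 1) {p : Wt A | p.1.2 = 0 ∨ p.1.1 ∈ A1} := by
  let v : C(A1, X) := vl A1
  obtain ⟨b, hb⟩ := lift_sub (mem_Cy.1 hz)
  let F : C(A1 × I, Wt A) := ⟨fun q => ⟨(q.1.1, q.2), q.2.2.1, .inr (hA q.1.2)⟩, by fun_prop⟩
  have e0 : F.comp (inn 0) = (wi A).comp v := rfl
  have key : sbdry ℤ ((famH F).pr b) = pf (F.comp (inn 1)) b - pf (F.comp (inn 0)) b := by
    cases n with
    | zero => exact sb_pr0 _ _
    | succ n =>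
      have : sbdry ℤ b = 0 := by
        refine pf_inj (f := v) Subtype.val_injective ?_
        rw [← sb_pf, hb, sb_sb, map_zero]
      rw [sb_pr, this, map_zero, sub_zero]; rfl
  refine ⟨pf (wi A) z + (famH F).pr b, ?_, ?_, ?_⟩
  · rw [mem_Cy, map_add, key, e0, ← pf_pf (wi A) v, hb, sb_pf, add_sub_cancel]
    exact supp_pf (A := Set.univ) (fun x _ => mem_K0c.2 one_pos) (supp_univ _)
  · rw [map_add, pf_pf (wr A) (wi A), show (wr A).comp (wi A) = .id _ from rfl, pf_id,
      add_sub_cancel_left]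
    refine supp_pf (A := {p : Wt A | p.1.1 ∈ A}) (fun p hp => hp) ?_
    refine supp_pr (famH F) (A := Set.univ) (fun σ _ p => ?_) (supp_univ b)
    exact hA (σ p.1).2
  · refine add_mem (supp_pf (A := Set.univ) (fun x _ => .inl rfl) (supp_univ _)) ?_
    refine supp_pr (famH F) (A := Set.univ) (fun σ _ p => .inr ?_) (supp_univ b)
    exact (σ p.1).2
theorem van_ev {n : ℕ} [T2Space X] (h : LE (n + 1) X) {x : X} {u : SChain ℤ (n + 1) X}
    (hu : u ∈ Cy ℤ n {x}ᶜ) :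
    ∀ᶠ y in nhds x, (u ∈ Bd ℤ (n + 1) {y}ᶜ ↔ u ∈ Bd ℤ (n + 1) {x}ᶜ) := by
  obtain ⟨g, hg⟩ := h.gen x
  obtain ⟨k, hk⟩ := hg.gen u hu
  have key : ∀ y, Gen (n + 1) {y}ᶜ g → u - k • g ∈ Bd ℤ (n + 1) {y}ᶜ →
      (u ∈ Bd ℤ (n + 1) {y}ᶜ ↔ k = 0) := fun y h1 h2 => by
    constructor
    · intro h3; exact h1.tf k (by simpa using sub_mem h3 h2)
    · rintro rfl; simpa using h2
  filter_upwards [hg.ev h, Bd_ev hk] with y h1 h2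
  rw [key y h1 h2, key x hg hk]
structure Pair (n : ℕ) (X : Type) [TopologicalSpace X] (A : Set X) : Prop where
  t2 : T2Space X
  cpt : CompactSpace X
  le : LE (n + 1) (Wt A)
def Vn {A : Set X} {n : ℕ} (u : SChain ℤ (n + 1) (Wt A)) (x : X) : Prop :=
  u ∈ Bd ℤ (n + 1) {wi A x}ᶜ
theorem K0c_sub {A : Set X} (x : X) : K0c A ⊆ {wi A x}ᶜ := compl_sub ⟨x, rfl⟩
theorem Pair.all {A : Set X} {n : ℕ} (h : Pair n X A) {u : SChain ℤ (n + 1) (Wt A)}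
    (hu : u ∈ Cy ℤ n (K0c A)) (hv : ∀ x, Vn u x) : u ∈ Bd ℤ (n + 1) (K0c A) := by
  have := h.t2
  have := h.cpt
  exact h.le.pf (isCompact_range (wi A).continuous) n le_rfl u hu (by rintro _ ⟨x, rfl⟩; exact hv x)
theorem Pair.Vn_ev {A : Set X} {n : ℕ} (h : Pair n X A) {u : SChain ℤ (n + 1) (Wt A)}
    (hu : u ∈ Cy ℤ n (K0c A)) (x : X) : ∀ᶠ y in nhds x, (Vn u y ↔ Vn u x) := by
  have := h.t2
  exact (wi A).continuous.continuousAt.eventually (van_ev h.le (Cy_mono (K0c_sub x) hu))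
theorem Pair.Vn_clopen {A : Set X} {n : ℕ} (h : Pair n X A) {u : SChain ℤ (n + 1) (Wt A)}
    (hu : u ∈ Cy ℤ n (K0c A)) : IsClopen {x | Vn u x} := by
  constructor
  · rw [← isOpen_compl_iff, isOpen_iff_mem_nhds]
    intro x hx
    filter_upwards [h.Vn_ev hu x] with y hy h'
    exact hx (hy.1 h')
  · rw [isOpen_iff_mem_nhds]
    intro x hx
    filter_upwards [h.Vn_ev hu x] with y hy
    exact hy.2 hx
def VP (n : ℕ) (X : Type) [TopologicalSpace X] (A : Set X) : Prop :=
  ∀ u ∈ Cy ℤ n (K0c A), ∀ x, Vn u x → u ∈ Bd ℤ (n + 1) (K0c A)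
theorem Pair.vp {A : Set X} {n : ℕ} (h : Pair n X A) [PreconnectedSpace X] : VP n X A := by
  intro u hu x hx
  refine h.all hu fun y => ?_
  have := (h.Vn_clopen hu).eq_univ ⟨x, hx⟩
  exact this.ge (Set.mem_univ y)
theorem fund {A : Set X} {n : ℕ} (hv : VP n X A) {u : SChain ℤ (n + 1) (Wt A)}
    (hu : u ∈ Cy ℤ n (K0c A)) {x : X} (hg : Gen (n + 1) {wi A x}ᶜ u) :
    IsFundCycle (n + 1) A (pf (wr A) u) ∧ pf (wr A) u ∉ Bd ℤ (n + 1) A := by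
  refine ⟨⟨wr_Cy hu, fun z hz => ?_⟩, fun h => ?_⟩
  · change z ∈ Cy ℤ n A at hz
    obtain ⟨v, hv1, hv2, -⟩ := hatE (A1 := A) le_rfl hz
    obtain ⟨k, hk⟩ := hg.gen v (Cy_mono (K0c_sub x) hv1)
    have h1 := hv (v - k • u) (sub_mem hv1 (Submodule.smul_mem _ k hu)) x hk
    have h2 := wr_Bd h1
    rw [map_sub, map_zsmul] at h2
    obtain ⟨w, hw⟩ := mem_Bd.1 h2
    refine ⟨k, w, ?_⟩
    rw [show z - k • pf (wr A) u - sbdry ℤ w = (pf (wr A) v - k • pf (wr A) u - sbdry ℤ w) -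
      (pf (wr A) v - z) by abel]
    exact sub_mem hw hv2
  · have := Bd_mono (K0c_sub x) (wr_inj hu h)
    exact one_ne_zero (hg.tf 1 (by simpa using this))
theorem HO_of {A : Set X} {n : ℕ} {c : SChain ℤ (n + 1) X} (h : IsFundCycle (n + 1) A c)
    (h' : c ∉ Bd ℤ (n + 1) A) : HomOrientable (n + 1) X A :=
  ⟨c, h, fun ⟨w, hw⟩ => h' (mem_Bd.2 ⟨w, by simpa using hw⟩)⟩
theorem fund_ne {A : Set X} {n : ℕ} {c : SChain ℤ (n + 1) X} (h : HomOrientable (n + 1) X A)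
    (h' : IsFundCycle (n + 1) A c) : c ∉ Bd ℤ (n + 1) A := by
  obtain ⟨c0, h1, h2⟩ := h
  intro hc
  obtain ⟨k, w, hw⟩ := h'.2 c0 h1.1
  obtain ⟨w', hw'⟩ := mem_Bd.1 (add_mem (mem_Bd.2 ⟨w, hw⟩) (Submodule.smul_mem _ k hc))
  exact h2 ⟨w', by rw [sub_zero]; rwa [sub_add_cancel] at hw'⟩
theorem Pair.norm {A : Set X} {n : ℕ} (h : Pair n X A) (hv : VP n X A)
    {u : SChain ℤ (n + 1) (Wt A)} (hu : u ∈ Cy ℤ n (K0c A)) (hn : u ∉ Bd ℤ (n + 1) (K0c A)) :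
    ∃ v ∈ Cy ℤ n (K0c A), ∀ x, Gen (n + 1) {wi A x}ᶜ v := by
  have := h.t2
  have := h.cpt
  have ex : ∀ p : Wt A, ∃ g, ∃ k : ℤ, p ∈ Set.range (wi A) → Gen (n + 1) {p}ᶜ g ∧ 0 < k ∧
      u - k • g ∈ Bd ℤ (n + 1) {p}ᶜ := fun p => by
    by_cases hp : p ∈ Set.range (wi A)
    · obtain ⟨x, rfl⟩ := hp
      obtain ⟨g, hg⟩ := h.le.gen (wi A x)
      obtain ⟨k, hk⟩ := hg.gen u (Cy_mono (K0c_sub x) hu)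
      rcases lt_trichotomy k 0 with h0 | rfl | h0
      · refine ⟨-g, -k, fun _ => ⟨⟨neg_mem hg.cy, fun z hz => ?_, fun j hj => ?_⟩, by omega, by simpa using hk⟩⟩
        · obtain ⟨j, hj⟩ := hg.gen z hz
          exact ⟨-j, by simpa using hj⟩
        · exact hg.tf j (by simpa using neg_mem hj)
      · exact (hn (hv u hu x (by rwa [zero_smul, sub_zero] at hk))).elim
      · exact ⟨g, k, fun _ => ⟨hg, h0, hk⟩⟩
    · exact ⟨0, 0, fun h => (hp h).elim⟩
  choose s k hs using ex
  obtain ⟨z, hz, hz'⟩ := h.le.sec (isCompact_range (wi A).continuous) s (fun p hp => (hs p hp).1.cy)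
    fun p hp => by
      filter_upwards [(hs p hp).1.ev h.le, Bd_ev (hs p hp).2.2] with q h1 h2 hq
      obtain ⟨h3, h4, h5⟩ := hs q hq
      obtain ⟨j, hj⟩ := h1.gen (s q) h3.cy
      obtain ⟨j', hj'⟩ := h3.gen (s p) h1.cy
      have e1 : (1 - j' * j) • s p ∈ Bd ℤ (n + 1) {q}ᶜ := by
        have := add_mem hj' (Submodule.smul_mem _ j' hj)
        rw [sub_smul, one_smul, mul_smul]
        rwa [smul_sub, sub_add_sub_cancel] at this
      have e2 := h1.tf _ e1
      have e3 : (k p - k q * j) • s p ∈ Bd ℤ (n + 1) {q}ᶜ := by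
        have := sub_mem h5 h2
        rw [sub_sub_sub_cancel_left] at this
        have := add_mem this (Submodule.smul_mem _ (k q) hj)
        rw [sub_smul, mul_smul]
        rwa [smul_sub, sub_add_sub_cancel] at this
      have e4 := h1.tf _ e3
      have h6 := (hs p hp).2.1
      have : j = 1 := by
        have h7 : 0 < j := by
          by_contra! h8
          have := mul_nonpos_of_nonneg_of_nonpos h4.le h8
          omega
        exact Int.eq_one_of_mul_eq_one_left h7.le (by linarith : j' * j = 1)
      simpa [this] using hj
  exact ⟨z, hz, fun x => (hs _ ⟨x, rfl⟩).1.congr (by rw [← neg_sub]; exact neg_mem (hz' _ ⟨x, rfl⟩))⟩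
theorem Pair.HO {A : Set X} {n : ℕ} [Nonempty X] (h : Pair n X A) (hv : VP n X A)
    {c : SChain ℤ (n + 1) X} (hc : c ∈ Cy ℤ n A) (hn : c ∉ Bd ℤ (n + 1) A) :
    HomOrientable (n + 1) X A := by
  obtain ⟨u, hu, hu', -⟩ := hatE (A1 := A) le_rfl hc
  obtain ⟨v, hv1, hv2⟩ := h.norm hv hu fun h => hn (by
    rw [← sub_sub_cancel (pf (wr A) u) c]; exact sub_mem (wr_Bd h) (supp_Bd hu'))
  obtain ⟨h1, h2⟩ := fund hv hv1 (hv2 (Classical.arbitrary X))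
  exact HO_of h1 h2
theorem Pair.N {A : Set X} {n : ℕ} [Nonempty X] (h : Pair n X A) (hv : VP n X A)
    (hn : ¬ HomOrientable (n + 1) X A) : Cy ℤ n A ≤ Bd ℤ (n + 1) A := fun _ hc => by
  by_contra h'
  exact hn (h.HO hv hc h')
end SV
namespace SV
variable {X Y : Type} [TopologicalSpace X] [TopologicalSpace Y]
theorem bdry_ne {A : Set X} {n : ℕ} (h : Pair n X A) (hv : VP n X A) {c : SChain ℤ (n + 1) X}
    (hc : c ∈ Cy ℤ n A) (hn : c ∉ Bd ℤ (n + 1) A) {m : ℤ} (hm : m ≠ 0) {w : SChain ℤ (n + 1) X}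
    (hw : w ∈ suppOn ℤ (n + 1) A) {A1 : Set X} (hA : A1 ⊆ A) {b : X} (hb : b ∈ A) (hb1 : b ∉ A1) :
    m • sbdry ℤ c - sbdry ℤ w ∉ suppOn ℤ n A1 := by
  intro hs
  have := h.t2
  have hc' : m • c - w ∈ Cy ℤ n A1 := by rw [mem_Cy, map_sub, map_smul]; exact hs
  obtain ⟨u', hu', h1, h2⟩ := hatE hA hc'
  obtain ⟨u, hu, h3, -⟩ := hatE (A1 := A) le_rfl hc
  have hd : u' - m • u ∈ Bd ℤ (n + 1) (K0c A) := by
    refine wr_inj (sub_mem hu' (Submodule.smul_mem _ m hu)) (supp_Bd ?_)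
    rw [map_sub, map_smul, show pf (wr A) u' - m • pf (wr A) u = (pf (wr A) u' - (m • c - w)) -
      m • (pf (wr A) u - c) - w by rw [smul_sub]; abel]
    exact sub_mem (sub_mem h1 (Submodule.smul_mem _ m h3)) hw
  have key : u' ∈ Bd ℤ (n + 1) {wi A b}ᶜ := by
    have ev := van_ev h.le (Cy_mono (K0c_sub b) hu')
    let γ : ℝ → Wt A := fun t => ⟨(b, max t 0), le_max_right _ _, .inr hb⟩
    have hγ : Continuous γ := by fun_prop
    have e0 : γ 0 = wi A b := Subtype.ext (Prod.ext rfl (max_self _))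
    rw [← e0] at ev ⊢
    have ev2 : ∀ᶠ t in nhdsWithin (0 : ℝ) (Set.Ioi 0), _ :=
      (hγ.continuousAt.eventually ev).filter_mono nhdsWithin_le_nhds
    obtain ⟨t, ht, ht0⟩ := (ev2.and self_mem_nhdsWithin).exists
    refine ht.1 (supp_Bd (supp_mono ?_ h2))
    rintro p hp rfl
    have ht0 : (0 : ℝ) < t := ht0
    rcases hp with hp | hp
    · have : max t 0 = 0 := hp
      rw [max_eq_left ht0.le] at this; exact ht0.ne' this
    · exact hb1 hp
  obtain ⟨g, hg⟩ := h.le.gen (wi A b)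
  obtain ⟨k, hk⟩ := hg.gen u (Cy_mono (K0c_sub b) hu)
  have h4 : (m * k) • g ∈ Bd ℤ (n + 1) {wi A b}ᶜ := by
    have := sub_mem (sub_mem key (Bd_mono (K0c_sub b) hd)) (Submodule.smul_mem _ m hk)
    rw [sub_sub_cancel, smul_sub, sub_sub_cancel, ← mul_smul] at this
    exact this
  have h5 : k = 0 := (mul_eq_zero.1 (hg.tf _ h4)).resolve_left hm
  rw [h5, zero_smul, sub_zero] at hk
  refine hn ?_
  rw [← sub_sub_cancel (pf (wr A) u) c]
  exact sub_mem (wr_Bd (hv u hu b hk)) (supp_Bd h3)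
theorem lh_inj {f : Y → X} (hf : IsLocalHomeomorph f) (y : Y) :
    ∃ O, IsOpen O ∧ y ∈ O ∧ Set.InjOn f O :=
  ⟨_, (hf.localInverseAt y).open_target, hf.self_mem_localInverseAt_target,
    hf.injOn_localInverseAt_target⟩
theorem lh_emb {f : C(Y, X)} (hf : IsLocalHomeomorph f) {O : Set Y} (hO : IsOpen O)
    (hi : Set.InjOn f O) : Topology.IsOpenEmbedding (f.comp (vl O)) :=
  (hf.comp hO.isOpenEmbedding_subtypeVal.isLocalHomeomorph).isOpenEmbedding_of_injective
    (Set.injOn_iff_injective.1 hi)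
theorem lh_of {f : Y → X} (hc : Continuous f) (ho : IsOpenMap f)
    (hi : ∀ y, ∃ O, IsOpen O ∧ y ∈ O ∧ Set.InjOn f O) : IsLocalHomeomorph f := by
  refine isLocalHomeomorph_iff_isOpenEmbedding_restrict.2 fun y => ?_
  obtain ⟨O, h1, h2, h3⟩ := hi y
  exact ⟨O, h1.mem_nhds h2, .of_continuous_injective_isOpenMap (hc.comp continuous_subtype_val)
    (Set.injOn_iff_injective.1 h3) (ho.comp h1.isOpenMap_subtype_val)⟩
theorem LE.pull {d : ℕ} {f : Y → X} (hf : IsLocalHomeomorph f) (h : LE d X) : LE d Y := by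
  intro y
  obtain ⟨e, he, h0⟩ := h (f y)
  let φ := hf.localInverseAt y
  have hs : f y ∈ φ.source := hf.apply_self_mem_localInverseAt_source
  obtain ⟨r, hr, hb⟩ := Metric.mem_nhds_iff.1
    (e.continuous.continuousAt.preimage_mem_nhds (φ.open_source.mem_nhds (by rw [h0]; exact hs)))
  let b := OpenPartialHomeomorph.univBall (0 : E d) r
  have hbm : ∀ v, e (b v) ∈ φ.source := fun v => hb (by
    rw [← OpenPartialHomeomorph.univBall_target (0 : E d) hr]; exact b.map_source (by simp [b]))
  have hbo : Topology.IsOpenEmbedding b := b.isOpenEmbedding (by simp [b])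
  have hc : Continuous fun v => φ (e (b v)) :=
    φ.continuousOn.comp_continuous (e.continuous.comp hbo.continuous) hbm
  refine ⟨⟨_, hc⟩, hf.isOpenEmbedding_of_comp ?_ hc, ?_⟩
  · convert he.comp hbo using 1
    funext v
    exact hf.apply_localInverseAt_of_mem (hbm v)
  · change φ (e (b 0)) = y
    rw [show b 0 = 0 from OpenPartialHomeomorph.univBall_apply_zero _ _, h0]
    exact hf.localInverseAt_apply_self
theorem exc_iff {e : C(Y, X)} [T2Space X] (he : Topology.IsOpenEmbedding e) {q : Y} {n : ℕ}
    {w : SChain ℤ n Y} : pf e w ∈ Bd ℤ n {e q}ᶜ ↔ w ∈ Bd ℤ n {q}ᶜ := by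
  rw [← pre_sing he]
  exact ⟨exc_inj he isOpen_compl_singleton cov_sing, pf_Bd fun _ h => h⟩
theorem exc_sub [T2Space Y] {O : Set Y} (hO : IsOpen O) {y : Y} (hy : y ∈ O) {n : ℕ}
    {u : SChain ℤ (n + 1) Y} (hu : u ∈ Cy ℤ n {y}ᶜ) : ∃ h ∈ suppOn ℤ (n + 1) O,
      h ∈ Cy ℤ n {y}ᶜ ∧ u - h ∈ Bd ℤ (n + 1) {y}ᶜ := by
  have he : Topology.IsOpenEmbedding (vl O) := hO.isOpenEmbedding_subtypeVal
  obtain ⟨w, hw, hw'⟩ := exc_surj he isOpen_compl_singleton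
    (cov_sing (p := (⟨y, hy⟩ : O))) (show u ∈ Cy ℤ n {vl O ⟨y, hy⟩}ᶜ from hu)
  exact ⟨pf (vl O) w, supp_pf (A := Set.univ) (fun x _ => x.2) (supp_univ _),
    pf_Cy (fun _ h => h) hw, hw'⟩
section Lf
variable [T2Space X] [T2Space Y] {f : C(Y, X)} (hf : IsLocalHomeomorph f) {n : ℕ}
include hf
theorem lh_iff {O : Set Y} (hO : IsOpen O) (hi : Set.InjOn f O) {y : Y} (hy : y ∈ O)
    {h : SChain ℤ (n + 1) Y} (hh : h ∈ suppOn ℤ (n + 1) O) :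
    pf f h ∈ Bd ℤ (n + 1) {f y}ᶜ ↔ h ∈ Bd ℤ (n + 1) {y}ᶜ := by
  obtain ⟨w, rfl⟩ := lift_sub hh
  have h1 := exc_iff (q := ⟨y, hy⟩) (w := w) (lh_emb hf hO hi)
  have h2 := exc_iff (e := vl O) (q := ⟨y, hy⟩) (w := w) hO.isOpenEmbedding_subtypeVal
  rw [← pf_pf] at h1
  exact h1.trans h2.symm
omit [T2Space X] [T2Space Y] hf in
def Lf (f : C(Y, X)) (y : Y) (u : SChain ℤ (n + 1) Y) (a : SChain ℤ (n + 1) X) : Prop :=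
  ∃ O, IsOpen O ∧ y ∈ O ∧ Set.InjOn f O ∧ ∃ h ∈ suppOn ℤ (n + 1) O, h ∈ Cy ℤ n {y}ᶜ ∧
    u - h ∈ Bd ℤ (n + 1) {y}ᶜ ∧ a - pf f h ∈ Bd ℤ (n + 1) {f y}ᶜ
theorem Lf.iff {y : Y} {u : SChain ℤ (n + 1) Y} {a : SChain ℤ (n + 1) X} (h : Lf f y u a) :
    a ∈ Bd ℤ (n + 1) {f y}ᶜ ↔ u ∈ Bd ℤ (n + 1) {y}ᶜ := by
  obtain ⟨O, h1, h2, h3, h, h4, -, h5, h6⟩ := h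
  rw [← Submodule.sub_mem_iff_left _ h6, ← Submodule.sub_mem_iff_left (x := u) _ h5,
    sub_sub_cancel, sub_sub_cancel, lh_iff hf h1 h3 h2 h4]
theorem Lf.sub {y : Y} {u u' : SChain ℤ (n + 1) Y} {a a' : SChain ℤ (n + 1) X} (h : Lf f y u a)
    (h' : Lf f y u' a') : Lf f y (u - u') (a - a') := by
  obtain ⟨O, h1, h2, h3, h, h4, h7, h5, h6⟩ := h
  obtain ⟨O', h1', h2', h3', h', h4', h7', h5', h6'⟩ := h'
  obtain ⟨k, k1, k2, k3⟩ := exc_sub (h1.inter h1') ⟨h2, h2'⟩ h7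
  obtain ⟨k', k1', k2', k3'⟩ := exc_sub (h1.inter h1') ⟨h2, h2'⟩ h7'
  refine ⟨O ∩ O', h1.inter h1', ⟨h2, h2'⟩, h3.mono Set.inter_subset_left, k - k', sub_mem k1 k1',
    sub_mem k2 k2', ?_, ?_⟩
  · rw [show u - u' - (k - k') = ((u - h) + (h - k)) - ((u' - h') + (h' - k')) by abel]
    exact sub_mem (add_mem h5 k3) (add_mem h5' k3')
  · have e := (lh_iff hf h1 h3 h2 (sub_mem h4 (supp_mono Set.inter_subset_left k1))).2 k3
    have e' := (lh_iff hf h1' h3' h2' (sub_mem h4' (supp_mono Set.inter_subset_right k1'))).2 k3'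
    rw [map_sub] at e e' ⊢
    rw [show a - a' - (pf f k - pf f k') = ((a - pf f h) + (pf f h - pf f k)) -
      ((a' - pf f h') + (pf f h' - pf f k')) by abel]
    exact sub_mem (add_mem h6 e) (add_mem h6' e')
omit [T2Space X] hf in
theorem Lf.cy {y : Y} {u : SChain ℤ (n + 1) Y} {a : SChain ℤ (n + 1) X}
    (h : Lf f y u a) : a ∈ Cy ℤ n {f y}ᶜ := by
  obtain ⟨O, h1, h2, h3, h, h4, h7, h5, h6⟩ := h
  rw [← sub_add_cancel a (pf f h)]
  refine add_mem (Bd_le_Cy h6) ?_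
  refine supp_mono (A := (f '' (O \ {y})) ) ?_ ?_
  · rintro _ ⟨x, hx, rfl⟩ he
    exact hx.2 (h3 hx.1 h2 he)
  · rw [sb_pf]
    exact supp_pf (f := f) (A := O ∩ {y}ᶜ) (B := f '' (O \ {y})) (fun x hx => ⟨x, hx, rfl⟩)
      (supp_inter (supp_sb h4) h7)
omit [T2Space X] in
theorem Lf.ex {y : Y} {u : SChain ℤ (n + 1) Y} (hu : u ∈ Cy ℤ n {y}ᶜ) : ∃ a, Lf f y u a := by
  obtain ⟨O, h1, h2, h3⟩ := lh_inj hf y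
  obtain ⟨h, h4, h5, h6⟩ := exc_sub h1 h2 hu
  exact ⟨pf f h, O, h1, h2, h3, h, h4, h5, h6, by rw [sub_self]; exact zero_mem _⟩
omit [T2Space Y] in
theorem Lf.ex' {y : Y} {a : SChain ℤ (n + 1) X} (ha : a ∈ Cy ℤ n {f y}ᶜ) :
    ∃ u ∈ Cy ℤ n {y}ᶜ, Lf f y u a := by
  obtain ⟨O, h1, h2, h3⟩ := lh_inj hf y
  have he := lh_emb hf h1 h3
  obtain ⟨w, hw, hw'⟩ := exc_surj he isOpen_compl_singleton
    (cov_sing (p := (⟨y, h2⟩ : O))) (show a ∈ Cy ℤ n {f.comp (vl O) ⟨y, h2⟩}ᶜ from ha)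
  rw [pre_sing he] at hw
  have hc : pf (vl O) w ∈ Cy ℤ n {y}ᶜ := by
    refine pf_Cy (A := {(⟨y, h2⟩ : O)}ᶜ) (B := {y}ᶜ) (f := vl O) (fun x hx e => hx ?_) hw
    exact Subtype.ext (show x.1 = y from e)
  refine ⟨pf (vl O) w, hc, O, h1, h2, h3, pf (vl O) w,
    supp_pf (A := Set.univ) (fun x _ => x.2) (supp_univ _), hc, by rw [sub_self]; exact zero_mem _, ?_⟩
  rw [pf_pf]; exact hw'
omit hf in
theorem Lf.ev {y : Y} {u : SChain ℤ (n + 1) Y} {a : SChain ℤ (n + 1) X} (h : Lf f y u a) :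
    ∀ᶠ y' in nhds y, Lf f y' u a := by
  obtain ⟨O, h1, h2, h3, h, h4, h7, h5, h6⟩ := h
  filter_upwards [h1.mem_nhds h2, Cy_ev h7, Bd_ev h5, f.continuous.continuousAt.eventually (Bd_ev h6)]
    with y' k1 k2 k3 k4
  exact ⟨O, h1, k1, h3, h, h4, k2, k3, k4⟩
omit [T2Space X] [T2Space Y] hf in
theorem Lf.congr {y : Y} {u : SChain ℤ (n + 1) Y} {a a' : SChain ℤ (n + 1) X} (h : Lf f y u a)
    (e : a - a' ∈ Bd ℤ (n + 1) {f y}ᶜ) : Lf f y u a' := by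
  obtain ⟨O, h1, h2, h3, h, h4, h7, h5, h6⟩ := h
  exact ⟨O, h1, h2, h3, h, h4, h7, h5, by
    rw [show a' - pf f h = (a - pf f h) - (a - a') by abel]; exact sub_mem h6 e⟩
theorem Lf.uniq {y : Y} {u : SChain ℤ (n + 1) Y} {a a' : SChain ℤ (n + 1) X} (h : Lf f y u a)
    (h' : Lf f y u a') : a - a' ∈ Bd ℤ (n + 1) {f y}ᶜ :=
  ((h.sub hf h').iff hf).2 (by rw [sub_self]; exact zero_mem _)
end Lf
instance ts_conn (n : ℕ) : PreconnectedSpace (TSimplex n) := by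
  have : IsPreconnected (stdSimplex ℝ (Fin (n + 1))) := (convex_stdSimplex ℝ _).isPreconnected
  exact isPreconnected_iff_preconnectedSpace.1 this
theorem split {R : Type} [CommRing R] {n : ℕ} {U V : Set X} (hU : IsOpen U) (hV : IsOpen V) (hd : Disjoint U V) :
    suppOn R n (U ∪ V) ≤ suppOn R n U ⊔ suppOn R n V := by
  refine supp_le fun σ hσ => ?_
  have h1 : IsPreconnected (Set.range σ) := isPreconnected_range σ.continuous
  rcases h1.subset_or_subset hU hV hd (by rintro _ ⟨x, rfl⟩; exact hσ x) with h | h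
  · exact Submodule.mem_sup_left (single_mem (fun x => h ⟨x, rfl⟩) _)
  · exact Submodule.mem_sup_right (single_mem (fun x => h ⟨x, rfl⟩) _)
structure DC (f : C(Y, X)) : Prop where
  lh : IsLocalHomeomorph f
  two : ∀ x, ∃ y1 y2, y1 ≠ y2 ∧ f y1 = x ∧ f y2 = x ∧ ∀ y, f y = x → y = y1 ∨ y = y2
theorem pushSum [T2Space X] [T2Space Y] {f : C(Y, X)} (hf : IsLocalHomeomorph f) {n : ℕ} {x : X}
    {y1 y2 : Y} (hne : y1 ≠ y2) (e1 : f y1 = x) (e2 : f y2 = x)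
    (hy : ∀ y, f y = x → y = y1 ∨ y = y2) {u : SChain ℤ (n + 1) Y} (hu : u ∈ Cy ℤ n {y1, y2}ᶜ)
    {a1 a2 : SChain ℤ (n + 1) X} (h1 : Lf f y1 u a1) (h2 : Lf f y2 u a2) :
    pf f u - (a1 + a2) ∈ Bd ℤ (n + 1) {x}ᶜ := by
  obtain ⟨P1, P2, hP1, hP2, m1, m2, hP⟩ := t2_separation hne
  obtain ⟨Q1, hQ1, q1, i1⟩ := lh_inj hf y1
  obtain ⟨Q2, hQ2, q2, i2⟩ := lh_inj hf y2
  set O1 := P1 ∩ Q1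
  set O2 := P2 ∩ Q2
  have hO1 : IsOpen O1 := hP1.inter hQ1
  have hO2 : IsOpen O2 := hP2.inter hQ2
  have hd : Disjoint O1 O2 := hP.mono Set.inter_subset_left Set.inter_subset_left
  have k1 : y1 ∈ O1 := ⟨m1, q1⟩
  have k2 : y2 ∈ O2 := ⟨m2, q2⟩
  have n1 : O2 ⊆ {y1}ᶜ := fun z hz e => Set.disjoint_left.1 hd k1 (e ▸ hz)
  have n2 : O1 ⊆ {y2}ᶜ := fun z hz e => Set.disjoint_left.1 hd (e ▸ hz) k2
  have s1 : ({y1, y2}ᶜ : Set Y) ⊆ {y1}ᶜ := compl_sub (by simp)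
  have s2 : ({y1, y2}ᶜ : Set Y) ⊆ {y2}ᶜ := compl_sub (by simp)
  have hE : Topology.IsOpenEmbedding (vl (O1 ∪ O2)) := (hO1.union hO2).isOpenEmbedding_subtypeVal
  obtain ⟨w, hw, hw'⟩ := exc_surj hE (A := {y1, y2}ᶜ) (Set.toFinite _).isClosed.isOpen_compl
    (by
      intro y hy
      rw [Set.notMem_compl_iff] at hy
      rcases hy with rfl | rfl
      · exact ⟨⟨y, .inl k1⟩, rfl⟩
      · exact ⟨⟨_, .inr k2⟩, rfl⟩) hu
  obtain ⟨g1, hg1, g2, hg2, hg⟩ := Submodule.mem_sup.1 (split hO1 hO2 hd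
    (supp_pf (f := vl (O1 ∪ O2)) (A := Set.univ) (fun x _ => x.2) (supp_univ w)))
  have hgc : sbdry ℤ g1 + sbdry ℤ g2 ∈ suppOn ℤ n {y1, y2}ᶜ := by
    rw [← map_add, hg]
    exact pf_Cy (f := vl (O1 ∪ O2)) (fun _ h => h) hw
  rw [← hg] at hw'
  have c1 : g1 ∈ Cy ℤ n {y1}ᶜ := by
    rw [mem_Cy, ← add_sub_cancel_right (sbdry ℤ g1) (sbdry ℤ g2)]
    exact sub_mem (supp_mono s1 hgc) (supp_mono n1 (supp_sb hg2))
  have c2 : g2 ∈ Cy ℤ n {y2}ᶜ := by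
    rw [mem_Cy, ← add_sub_cancel_left (sbdry ℤ g1) (sbdry ℤ g2)]
    exact sub_mem (supp_mono s2 hgc) (supp_mono n2 (supp_sb hg1))
  have l1 : Lf f y1 u (pf f g1) := ⟨O1, hO1, k1, i1.mono Set.inter_subset_right, g1, hg1, c1, by
    rw [show u - g1 = (u - (g1 + g2)) + g2 by abel]
    exact add_mem (Bd_mono s1 hw') (supp_Bd (supp_mono n1 hg2)), by rw [sub_self]; exact zero_mem _⟩
  have l2 : Lf f y2 u (pf f g2) := ⟨O2, hO2, k2, i2.mono Set.inter_subset_right, g2, hg2, c2, by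
    rw [show u - g2 = (u - (g1 + g2)) + g1 by abel]
    exact add_mem (Bd_mono s2 hw') (supp_Bd (supp_mono n2 hg1)), by rw [sub_self]; exact zero_mem _⟩
  have r1 := l1.uniq hf h1
  have r2 := l2.uniq hf h2
  rw [e1] at r1
  rw [e2] at r2
  have r3 := pf_Bd (f := f) (A := {y1, y2}ᶜ) (B := {x}ᶜ) (fun y hy' e => hy' (by
    rcases hy y e with rfl | rfl <;> simp)) hw'
  rw [map_sub, map_add] at r3
  rw [show pf f u - (a1 + a2) = (pf f u - (pf f g1 + pf f g2)) + (pf f g1 - a1) + (pf f g2 - a2)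
    by abel]
  exact add_mem (add_mem r3 r1) r2
end SV
namespace SV
variable {X Y : Type} [TopologicalSpace X] [TopologicalSpace Y]
theorem dc_of {p : Y → X} (h : IsDoubleCover p) : DC ⟨p, h.1.continuous⟩ := by
  refine ⟨h.1.isLocalHomeomorph, fun x => ?_⟩
  obtain ⟨a, b, hab, hu⟩ := Nat.card_eq_two_iff.1 (h.2 x)
  refine ⟨a, b, fun e => hab (Subtype.ext e), a.2, b.2, fun y hy => ?_⟩
  have : (⟨y, hy⟩ : p ⁻¹' {x}) ∈ ({a, b} : Set _) := hu ▸ Set.mem_univ _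
  exact this.imp (congrArg Subtype.val) (congrArg Subtype.val)
theorem dc_t2 [T2Space X] {p : Y → X} (h : IsDoubleCover p) : T2Space Y := by
  refine ⟨fun a b hab => ?_⟩
  by_cases he : p a = p b
  · exact h.1.isSeparatedMap a b he hab
  · obtain ⟨U, V, h1, h2, h3, h4, h5⟩ := t2_separation he
    exact ⟨p ⁻¹' U, p ⁻¹' V, h1.preimage h.1.continuous, h2.preimage h.1.continuous, h3, h4,
      h5.preimage p⟩
theorem DC.cpt [CompactSpace X] [T2Space Y] {f : C(Y, X)} (h : DC f) : CompactSpace Y := by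
  refine ⟨isCompact_iff_ultrafilter_le_nhds.2 fun U _ => ?_⟩
  obtain ⟨x, -, hx⟩ := isCompact_iff_ultrafilter_le_nhds.1 (isCompact_univ (X := X)) (U.map f) (by simp)
  obtain ⟨y1, y2, hne, e1, e2, -⟩ := h.two x
  by_contra! hc
  have h1 := hc y1 trivial
  have h2 := hc y2 trivial
  obtain ⟨P1, P2, hP1, hP2, m1, m2, hP⟩ := t2_separation hne
  have aux : ∀ {y : Y} {P : Set Y}, IsOpen P → y ∈ P → ¬ (U : Filter Y) ≤ nhds y →
      ∃ O ⊆ P, IsOpen O ∧ y ∈ O ∧ O ∉ U := fun {y P} hP m hn => by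
    obtain ⟨s, hs, hs'⟩ := Filter.not_le.1 hn
    obtain ⟨t, ht, h3, h4⟩ := mem_nhds_iff.1 hs
    exact ⟨t ∩ P, Set.inter_subset_right, h3.inter hP, ⟨h4, m⟩, fun h5 =>
      hs' (Filter.mem_of_superset h5 (Set.inter_subset_left.trans ht))⟩
  obtain ⟨O1, s1, o1, k1, n1⟩ := aux hP1 m1 h1
  obtain ⟨O2, s2, o2, k2, n2⟩ := aux hP2 m2 h2
  have hV : f '' O1 ∩ f '' O2 ∈ nhds x := Filter.inter_mem
    ((h.lh.isOpenMap _ o1).mem_nhds ⟨y1, k1, e1⟩) ((h.lh.isOpenMap _ o2).mem_nhds ⟨y2, k2, e2⟩)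
  have hU : f ⁻¹' (f '' O1 ∩ f '' O2) ∈ U := hx hV
  refine (Ultrafilter.union_mem_iff.1 (Filter.mem_of_superset hU ?_)).elim n1 n2
  rintro y ⟨⟨a, ha, ea⟩, b, hb, eb⟩
  obtain ⟨z1, z2, -, -, -, hz⟩ := h.two (f y)
  have hab : a ≠ b := fun e => Set.disjoint_left.1 hP (s1 ha) (s2 (e ▸ hb))
  rcases hz y rfl with r | r <;> rcases hz a ea with r1 | r1 <;> rcases hz b eb with r2 | r2 <;>
    first
    | exact absurd (r1.trans r2.symm) hab
    | exact .inl (by rw [r, ← r1]; exact ha)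
    | exact .inr (by rw [r, ← r2]; exact hb)
def wp (f : C(Y, X)) (A : Set X) : C(Wt (f ⁻¹' A), Wt A) :=
  ⟨fun p => ⟨(f p.1.1, p.1.2), p.2⟩, by fun_prop⟩
theorem wp_lh {f : C(Y, X)} (h : IsLocalHomeomorph f) (A : Set X) : IsLocalHomeomorph (wp f A) := by
  refine lh_of (wp f A).continuous ?_ fun y => ?_
  · have := (h.isOpenMap.prodMap (IsOpenMap.id (X := ℝ))).restrictPreimage
      {p : X × ℝ | 0 ≤ p.2 ∧ (p.2 = 0 ∨ p.1 ∈ A)}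
    exact this
  · obtain ⟨O, h1, h2, h3⟩ := lh_inj h y.1.1
    refine ⟨{p | p.1.1 ∈ O}, h1.preimage (by fun_prop), h2, fun a ha b hb e => ?_⟩
    have e1 : (f a.1.1, a.1.2) = (f b.1.1, b.1.2) := congrArg Subtype.val e
    exact Subtype.ext (Prod.ext (h3 ha hb (congrArg Prod.fst e1)) (Prod.ext_iff.1 e1).2)
theorem DC.dw {f : C(Y, X)} (h : DC f) (A : Set X) : DC (wp f A) := by
  constructor
  · exact wp_lh h.lh A
  · rintro ⟨⟨x, t⟩, ht⟩
    obtain ⟨y1, y2, hne, rfl, e2, hy⟩ := h.two x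
    refine ⟨⟨(y1, t), ht⟩, ⟨(y2, t), ht.1, ?_⟩, fun e => hne ?_, rfl, ?_, fun y h' => ?_⟩
    · exact ht.2.imp id fun (h' : f y1 ∈ A) => show f y2 ∈ A by rwa [e2]
    · exact congrArg (fun q => q.1.1) e
    · exact Subtype.ext (Prod.ext e2 rfl)
    · have e1 := congrArg Subtype.val h'
      have e3 : y.1.2 = t := congrArg Prod.snd e1
      exact (hy y.1.1 (congrArg Prod.fst e1)).imp (fun h => Subtype.ext (Prod.ext h e3))
        (fun h => Subtype.ext (Prod.ext h e3))
theorem Pair.pull {n : ℕ} {A : Set X} (h : Pair n X A) {f : C(Y, X)} (hf : DC f) [T2Space Y] :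
    Pair n Y (f ⁻¹' A) :=
  have := h.cpt
  ⟨inferInstance, hf.cpt, h.le.pull (hf.dw A).lh⟩
theorem wp_K0 {f : C(Y, X)} {A : Set X} {n : ℕ} {u : SChain ℤ (n + 1) (Wt (f ⁻¹' A))}
    (hu : u ∈ Cy ℤ n (K0c (f ⁻¹' A))) : pf (wp f A) u ∈ Cy ℤ n (K0c A) :=
  pf_Cy (f := wp f A) (A := K0c (f ⁻¹' A)) (B := K0c A)
    (fun p hp => mem_K0c.2 (show 0 < p.1.2 from mem_K0c.1 hp)) hu
theorem van_sat [T2Space X] [T2Space Y] {f : C(Y, X)} (hf : DC f) {n : ℕ}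
    {u : SChain ℤ (n + 1) Y} {x : X} (hu : ∀ y, f y = x → u ∈ Cy ℤ n {y}ᶜ)
    (hb : pf f u ∈ Bd ℤ (n + 1) {x}ᶜ) {y y' : Y} (hy : f y = x) (hy' : f y' = x) (hne : y ≠ y') :
    (∃ a, Lf f y u a ∧ Lf f y' u (-a)) := by
  obtain ⟨y1, y2, -, -, -, h⟩ := hf.two x
  have h' : ∀ z, f z = x → z = y ∨ z = y' := fun z hz => by
    rcases h z hz with r | r <;> rcases h y hy with r1 | r1 <;> rcases h y' hy' with r2 | r2 <;> aesop
  obtain ⟨a, ha⟩ := Lf.ex hf.lh (hu y hy)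
  obtain ⟨b, hb'⟩ := Lf.ex hf.lh (hu y' hy')
  have hc : u ∈ Cy ℤ n {y, y'}ᶜ := by
    have : ({y, y'}ᶜ : Set Y) = {y}ᶜ ∩ {y'}ᶜ := by ext; simp
    rw [this]; exact supp_inter (hu y hy) (hu y' hy')
  have hs := pushSum hf.lh hne hy hy' h' hc ha hb'
  have := sub_mem hb hs
  rw [sub_sub_cancel] at this
  refine ⟨a, ha, hb'.congr ?_⟩
  rw [sub_neg_eq_add, add_comm b, hy']; exact this
theorem Pair.vp_cover {n : ℕ} {A : Set X} (h : Pair n X A) [ConnectedSpace X]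
    (hn : ¬ HomOrientable (n + 1) X A) {f : C(Y, X)} (hf : DC f) [T2Space Y] :
    VP n Y (f ⁻¹' A) := by
  intro u hu y hy
  have := h.t2
  have hP := h.pull hf
  have hb : pf (wp f A) u ∈ Bd ℤ (n + 1) (K0c A) :=
    wr_inj (wp_K0 hu) (h.N h.vp hn (wr_Cy (wp_K0 hu)))
  have hs : ∀ y y', f y = f y' → Vn u y → Vn u y' := by
    intro y y' he hv
    by_cases hne : y = y'
    · rwa [← hne]
    obtain ⟨a, h1, h2⟩ := van_sat (hf.dw A) (u := u) (x := wi A (f y)) (y := wi _ y) (y' := wi _ y')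
      (fun z hz => Cy_mono (fun q hq e => by
        rw [e] at hq
        have h1 := mem_K0c.1 hq
        have h2 : z.1.2 = 0 := congrArg (fun q => q.1.2) hz
        exact h1.ne' h2) hu) (Bd_mono (K0c_sub _) hb) rfl
      (by rw [he]; rfl) (fun e => hne (congrArg (fun q => q.1.1) e))
    have h3 := (h1.iff (hf.dw A).lh).2 hv
    refine (h2.iff (hf.dw A).lh).1 (neg_mem ?_)
    have e : wp f A (wi _ y') = wp f A (wi _ y) := congrArg (wi A) he.symm
    rw [e]; exact h3
  have hc := hP.Vn_clopen hu
  have hC : IsClopen (f '' {y | Vn u y}) := by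
    refine ⟨?_, hf.lh.isOpenMap _ hc.2⟩
    have : f '' {y | Vn u y} = (f '' {y | Vn u y}ᶜ)ᶜ := by
      ext x
      constructor
      · rintro ⟨z, hz, rfl⟩ ⟨z', hz', e⟩; exact hz' (hs z z' e.symm hz)
      · intro hx
        obtain ⟨z, -, -, rfl, -⟩ := hf.two x
        by_contra hz
        exact hx ⟨z, fun h => hz ⟨z, h, rfl⟩, rfl⟩
    rw [this]
    exact (hf.lh.isOpenMap _ hc.1.isOpen_compl).isClosed_compl
  have hu' := hC.eq_univ ⟨f y, y, hy, rfl⟩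
  refine hP.all hu fun z => ?_
  obtain ⟨z', h1, h2⟩ := hu'.ge (Set.mem_univ (f z))
  exact hs z' z h2 h1
theorem Gen.unit {n : ℕ} {A : Set X} {g g' : SChain ℤ n X} (h : Gen n A g) (h' : Gen n A g') :
    ∃ ε : ℤˣ, g - (ε : ℤ) • g' ∈ Bd ℤ n A := by
  obtain ⟨k, hk⟩ := h'.gen g h.cy
  obtain ⟨l, hl⟩ := h.gen g' h'.cy
  have h1 : (1 - k * l) • g ∈ Bd ℤ n A := by
    have := add_mem hk (Submodule.smul_mem _ k hl)
    rwa [smul_sub, ← mul_smul, sub_add_sub_cancel, ← one_smul ℤ g, ← mul_smul, ← sub_smul,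
      mul_one] at this
  have h2 : k * l = 1 := by linarith [h.tf _ h1]
  exact ⟨⟨k, l, h2, by rw [mul_comm, h2]⟩, hk⟩
theorem Gen.unit_uniq {n : ℕ} {A : Set X} {g g' : SChain ℤ n X} (h' : Gen n A g') {ε ε' : ℤˣ}
    (h1 : g - (ε : ℤ) • g' ∈ Bd ℤ n A) (h2 : g - (ε' : ℤ) • g' ∈ Bd ℤ n A) : ε = ε' := by
  have := sub_mem h2 h1
  rw [sub_sub_sub_cancel_left, ← sub_smul] at this
  exact Units.ext (sub_eq_zero.1 (h'.tf _ this))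
def sgn {n : ℕ} (A : Set X) (g g' : SChain ℤ n X) : ℤˣ :=
  Classical.epsilon fun ε : ℤˣ => g - (ε : ℤ) • g' ∈ Bd ℤ n A
theorem sgn_spec {n : ℕ} {A : Set X} {g g' : SChain ℤ n X} (h : Gen n A g) (h' : Gen n A g') :
    g - (sgn A g g' : ℤ) • g' ∈ Bd ℤ n A := Classical.epsilon_spec (h.unit h')
theorem sgn_eq {n : ℕ} {A : Set X} {g g' : SChain ℤ n X} (h : Gen n A g) (h' : Gen n A g') {ε : ℤˣ}
    (h1 : g - (ε : ℤ) • g' ∈ Bd ℤ n A) : sgn A g g' = ε := h'.unit_uniq (sgn_spec h h') h1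
def OIdx (n : ℕ) (A : Set X) : Type := {q : SChain ℤ (n + 1) (Wt A) × Set X //
  IsOpen q.2 ∧ ∀ x ∈ q.2, Gen (n + 1) {wi A x}ᶜ q.1}
theorem Pair.oidx {n : ℕ} {A : Set X} (h : Pair n X A) (x : X) : ∃ i : OIdx n A, x ∈ i.1.2 := by
  have := h.t2
  obtain ⟨g, hg⟩ := h.le.gen (wi A x)
  obtain ⟨N, hN, h1, h2⟩ := mem_nhds_iff.1
    ((wi A).continuous.continuousAt.eventually (Gen.ev h.le hg))
  exact ⟨⟨(g, N), h1, fun y hy => hN hy⟩, h2⟩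
def Pair.core {n : ℕ} {A : Set X} (h : Pair n X A) : FiberBundleCore (OIdx n A) X ℤˣ where
  baseSet i := i.1.2
  isOpen_baseSet i := i.2.1
  indexAt x := (h.oidx x).choose
  mem_baseSet_at x := (h.oidx x).choose_spec
  coordChange i j x e := e * sgn {wi A x}ᶜ i.1.1 j.1.1
  coordChange_self i x hx v := by
    rw [sgn_eq (i.2.2 x hx) (i.2.2 x hx) (ε := 1) (by simp), mul_one]
  continuousOn_coordChange i j := by
    have := h.t2
    refine continuousOn_snd.mul fun p hp => ?_
    refine ContinuousAt.continuousWithinAt ?_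
    have h1 := i.2.2 p.1 hp.1.1
    have h2 := j.2.2 p.1 hp.1.2
    have e1 : ∀ᶠ x in nhds p.1, sgn {wi A x}ᶜ i.1.1 j.1.1 = sgn {wi A p.1}ᶜ i.1.1 j.1.1 := by
      filter_upwards [i.2.1.mem_nhds hp.1.1, j.2.1.mem_nhds hp.1.2,
        (wi A).continuous.continuousAt.eventually (Bd_ev (sgn_spec h1 h2))] with x k1 k2 k3
      exact sgn_eq (i.2.2 x k1) (j.2.2 x k2) k3
    exact continuousAt_const.congr (continuous_fst.continuousAt.eventually e1 |>.mono fun _ h => h.symm)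
  coordChange_comp i j k x hx v := by
    have h1 := i.2.2 x hx.1.1
    have h2 := j.2.2 x hx.1.2
    have h3 := k.2.2 x hx.2
    rw [mul_assoc, sgn_eq h1 h3 (ε := sgn {wi A x}ᶜ i.1.1 j.1.1 * sgn {wi A x}ᶜ j.1.1 k.1.1)]
    have := add_mem (sgn_spec h1 h2) (Submodule.smul_mem _ (sgn {wi A x}ᶜ i.1.1 j.1.1 : ℤ) (sgn_spec h2 h3))
    rwa [smul_sub, sub_add_sub_cancel, ← mul_smul, ← Units.val_mul] at this
theorem Pair.ocov {n : ℕ} {A : Set X} (h : Pair n X A) [ConnectedSpace X]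
    (hn : ¬ HomOrientable (n + 1) X A) : ∃ (Y : TopCat.{0}) (p : ↥Y → X), IsDoubleCover p ∧
      HomOrientable (n + 1) ↥Y (p ⁻¹' A) := by
  have t2 := h.t2
  have := h.cpt
  let Z := h.core
  let T := Bundle.TotalSpace ℤˣ Z.Fiber
  have hd : IsDoubleCover (fun y : T => y.1) := by
    refine ⟨FiberBundle.isCoveringMap (F := ℤˣ) (E := Z.Fiber), fun x => ?_⟩
    have e : ((fun y : T => y.1) ⁻¹' {x}) ≃ ℤˣ :=
      ⟨fun y => y.1.2, fun e => ⟨⟨x, e⟩, rfl⟩, by rintro ⟨⟨a, b⟩, rfl⟩; rfl, fun _ => rfl⟩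
    rw [Nat.card_congr e, Nat.card_eq_fintype_card]; rfl
  refine ⟨TopCat.of T, fun y : T => y.1, hd, ?_⟩
  have := dc_t2 hd
  have hf := dc_of hd
  set f : C(T, X) := ⟨fun y : T => y.1, hd.1.continuous⟩
  have hP := h.pull hf
  have hc := hP.cpt
  have hv := h.vp_cover hn hf
  let un : T → ℤˣ := fun y => y.2
  let o : T → SChain ℤ (n + 1) (Wt A) := fun y => (un y : ℤ) • (Z.indexAt y.1).1.1
  have hg : ∀ y : T, Gen (n + 1) {wi A (f y)}ᶜ (Z.indexAt y.1).1.1 := fun y =>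
    (Z.indexAt y.1).2.2 _ (Z.mem_baseSet_at y.1)
  have ho : ∀ y : T, ∃ u ∈ Cy ℤ n {wi (f ⁻¹' A) y}ᶜ, Lf (wp f A) (wi (f ⁻¹' A) y) u (o y) := fun y =>
    Lf.ex' (hf.dw A).lh (Submodule.smul_mem _ _ (hg y).cy)
  choose s hs hs' using ho
  have hlc : ∀ y : T, ∀ᶠ z in nhds y, s z - s y ∈ Bd ℤ (n + 1) {wi (f ⁻¹' A) z}ᶜ := fun y => by
    have e1 : ∀ᶠ z in nhds y, Z.localTriv (Z.indexAt y.1) z ∈ (Set.univ ×ˢ {un y} : Set (X × ℤˣ)) := by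
      refine ContinuousAt.eventually_mem ((Z.localTriv (Z.indexAt y.1)).continuousAt ?_) ?_
      · exact Z.mem_baseSet_at y.1
      · refine (isOpen_univ.prod (isOpen_discrete _)).mem_nhds ⟨trivial, ?_⟩
        exact Z.coordChange_self _ _ (Z.mem_baseSet_at y.1) _
    filter_upwards [e1, f.continuous.continuousAt.eventually
      ((Z.isOpen_baseSet (Z.indexAt y.1)).mem_nhds (Z.mem_baseSet_at y.1)),
      (wi (f ⁻¹' A)).continuous.continuousAt.eventually (hs' y).ev] with z h1 h2 h3
    have h4 : un z * sgn {wi A (f z)}ᶜ (Z.indexAt z.1).1.1 (Z.indexAt y.1).1.1 = un y := h1.2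
    have h5 : o z - o y ∈ Bd ℤ (n + 1) {wi A (f z)}ᶜ := by
      have := Submodule.smul_mem _ (un z : ℤ) (sgn_spec (hg z) ((Z.indexAt y.1).2.2 _ h2))
      rwa [smul_sub, ← mul_smul, ← Units.val_mul, h4] at this
    exact (((hs' z).sub (hf.dw A).lh h3).iff (hf.dw A).lh).1 h5
  obtain ⟨u, hu, hu'⟩ := hP.le.sec (isCompact_range (wi (f ⁻¹' A)).continuous)
    (fun q => s (wr _ q)) (by rintro _ ⟨y, rfl⟩; exact hs y) (by
      rintro _ ⟨y, rfl⟩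
      have := ((wr (f ⁻¹' A)).continuous.continuousAt (x := wi _ y)).eventually (hlc y)
      filter_upwards [this] with q hq
      rintro ⟨z, rfl⟩
      exact hq)
  obtain ⟨y, -⟩ := hf.two (Classical.arbitrary X)
  have : Nonempty T := ⟨y⟩
  refine hP.HO hv (wr_Cy hu) fun hb => ?_
  have h1 := Bd_mono (K0c_sub y) (wr_inj hu hb)
  have h2 := sub_mem h1 (hu' _ ⟨y, rfl⟩)
  rw [sub_sub_cancel] at h2
  exact (un y).ne_zero ((hg y).tf _ (((hs' y).iff (hf.dw A).lh).2 h2))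
end SV
namespace SV
variable {X Y : Type} [TopologicalSpace X] [TopologicalSpace Y]
theorem sign_split [T2Space X] [T2Space Y] {f : C(Y, X)} (hf : DC f) {n : ℕ}
    {v : SChain ℤ (n + 1) X} (hv : ∀ x, Gen (n + 1) {x}ᶜ v) {u : SChain ℤ (n + 1) Y}
    (hu : ∀ y, u ∈ Cy ℤ n {y}ᶜ) (hb : ∀ x, pf f u ∈ Bd ℤ (n + 1) {x}ᶜ)
    (hn : ∀ y, u ∉ Bd ℤ (n + 1) {y}ᶜ) :
    ∃ S : Set Y, IsOpen S ∧ IsOpen Sᶜ ∧ Set.InjOn f S ∧ Set.InjOn f Sᶜ := by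
  have hex : ∀ y, ∃ k : ℤ, Lf f y u (k • v) := fun y => by
    obtain ⟨a, ha⟩ := Lf.ex hf.lh (hu y)
    obtain ⟨k, hk⟩ := (hv (f y)).gen a ha.cy
    exact ⟨k, ha.congr hk⟩
  choose k hk using hex
  have huq : ∀ y (l : ℤ), Lf f y u (l • v) → l = k y := fun y l hl => by
    have := hl.uniq hf.lh (hk y)
    rw [← sub_smul] at this
    exact sub_eq_zero.1 ((hv (f y)).tf _ this)
  have hlc : ∀ y, ∀ᶠ z in nhds y, k z = k y := fun y => by
    filter_upwards [(hk y).ev] with z hz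
    exact (huq z _ hz).symm
  have hne : ∀ y, k y ≠ 0 := fun y h0 => hn y (((hk y).iff hf.lh).1 (by rw [h0, zero_smul]; exact zero_mem _))
  have hop : ∀ T : Set ℤ, IsOpen (k ⁻¹' T) := fun T => isOpen_iff_mem_nhds.2 fun y hy => by
    filter_upwards [hlc y] with z hz
    change k z ∈ T; rwa [hz]
  have hanti : ∀ y y', f y = f y' → y ≠ y' → k y' = - k y := fun y y' he hne => by
    obtain ⟨a, h1, h2⟩ := van_sat hf (fun z _ => hu z) (hb (f y)) rfl he.symm hne
    refine (huq y' _ (h2.congr ?_)).symm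
    rw [show -a - (-k y) • v = k y • v - a by rw [neg_smul]; abel, ← he]
    exact (hk y).uniq hf.lh h1
  refine ⟨k ⁻¹' {m | 0 < m}, hop _, hop {m | 0 < m}ᶜ, fun y hy y' hy' he => ?_, fun y hy y' hy' he => ?_⟩
  all_goals
    by_contra hc
    have h1 := hanti y y' he hc
    have h2 := hne y
    simp only [Set.mem_preimage, Set.mem_ofPred_eq, Set.mem_compl_iff] at hy hy'
    omega
theorem wr_emb : Topology.IsOpenEmbedding (wr (∅ : Set X)) := by
  let e : Wt (∅ : Set X) ≃ₜ X := ⟨⟨wr ∅, wi ∅, fun p => Subtype.ext (Prod.ext rfl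
    (p.2.2.resolve_right id).symm), fun _ => rfl⟩, (wr ∅).continuous, (wi ∅).continuous⟩
  exact e.isOpenEmbedding
theorem Pair.cg {n : ℕ} (h : Pair n X ∅) (hv : VP n X ∅) [Nonempty X] (hO : HomOrientable (n + 1) X ∅) :
    ∃ v : SChain ℤ (n + 1) X, ∀ x, Gen (n + 1) {x}ᶜ v := by
  have := h.t2
  obtain ⟨c, hc, -⟩ := id hO
  obtain ⟨u, hu, hu', -⟩ := hatE (A1 := (∅ : Set X)) le_rfl (show c ∈ Cy ℤ n ∅ from hc.1)
  obtain ⟨v, hv, hg⟩ := h.norm hv hu fun h => fund_ne hO hc (by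
    rw [← sub_sub_cancel (pf (wr ∅) u) c]; exact sub_mem (wr_Bd h) (supp_Bd hu'))
  exact ⟨pf (wr ∅) v, fun x => Gen.exc (A := {wr ∅ (wi ∅ x)}ᶜ) wr_emb isOpen_compl_singleton
    cov_sing (by rw [pre_sing wr_emb]; exact hg x)⟩
theorem Pair.nv {n : ℕ} (h : Pair n X ∅) (hv : VP n X ∅) {c : SChain ℤ (n + 1) X}
    (hc : c ∈ Cy ℤ n ∅) (hn : c ∉ Bd ℤ (n + 1) ∅) (x : X) : c ∉ Bd ℤ (n + 1) {x}ᶜ := by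
  have := h.t2
  intro hb
  refine hn ?_
  have hK : K0c (∅ : Set X) = ∅ := Set.eq_empty_iff_forall_notMem.2 fun p hp => wr_mem p hp
  have e : pf (wr ∅) (pf (wi ∅) c) = c := by rw [pf_pf]; exact pf_id _
  have hc' : pf (wi ∅) c ∈ Cy ℤ n (K0c ∅) := pf_Cy (fun _ h => h.elim) hc
  rw [← e] at hb ⊢
  exact wr_Bd (hv _ hc' x (exc_iff (q := wi ∅ x) wr_emb |>.1 hb))
end SV
namespace SV
variable {X Y : Type} [TopologicalSpace X] [TopologicalSpace Y]
abbrev HS (k : ℕ) : Type := {v : E (k + 1) // 0 ≤ ∑ i, v i}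
instance (k : ℕ) : Zero (HS k) := ⟨⟨0, by simp⟩⟩
theorem sg_cont {P : Type} [TopologicalSpace P] {Z : Set X} (g : C(Z, Y)) {π : P → X} (hπ : Continuous π) :
    Continuous fun u : (π ⁻¹' Z : Set P) => g ⟨π u.1, u.2⟩ :=
  g.continuous.comp ((hπ.comp continuous_subtype_val).subtype_mk _)
theorem oe_of {f : C(Y, X)} {U : Set X} (hU : IsOpen U) (g : C(U, Y)) (h : ∀ y, f y ∈ U)
    (h1 : ∀ y, g ⟨f y, h y⟩ = y) (h2 : ∀ u, f (g u) = u) : Topology.IsOpenEmbedding f := by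
  let e : Y ≃ₜ U := ⟨⟨fun y => ⟨f y, h y⟩, g, h1, fun u => Subtype.ext (h2 u)⟩, by fun_prop, g.continuous⟩
  exact hU.isOpenEmbedding_subtypeVal.comp e.isOpenEmbedding
theorem oe_inv {f : C(Y, X)} (h : Topology.IsOpenEmbedding f) : ∃ g : C(Set.range f, Y),
    (∀ y, g ⟨f y, y, rfl⟩ = y) ∧ ∀ u, f (g u) = u :=
  let e := h.toIsEmbedding.toHomeomorph
  ⟨⟨e.symm, e.symm.continuous⟩, fun y => e.symm_apply_apply y, fun u => by
    conv_rhs => rw [← e.apply_symm_apply u]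
    rfl⟩
theorem trans_oe {d : ℕ} {e : C(E d, X)} (he : Topology.IsOpenEmbedding e) (v : E d) :
    ∃ e' : C(E d, X), Topology.IsOpenEmbedding e' ∧ e' 0 = e v :=
  ⟨e.comp (Homeomorph.addRight v : C(E d, E d)), he.comp (Homeomorph.addRight v).isOpenEmbedding, by simp⟩
theorem hs_int {k : ℕ} (v : HS k) (hv : 0 < ∑ i, v.1 i) :
    ∃ b : C(E (k + 1), HS k), Topology.IsOpenEmbedding b ∧ b 0 = v := by
  have ho : IsOpen {w : E (k + 1) | 0 < ∑ i, w i} := isOpen_lt continuous_const (by fun_prop)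
  obtain ⟨r, hr, hb⟩ := Metric.isOpen_iff.1 ho v.1 hv
  let b := OpenPartialHomeomorph.univBall v.1 r
  have hbo : Topology.IsOpenEmbedding b := b.isOpenEmbedding (by simp [b])
  have hbm : ∀ w, b w ∈ Metric.ball v.1 r := fun w => by
    rw [← OpenPartialHomeomorph.univBall_target v.1 hr]; exact b.map_source (by simp [b])
  let B : C(E (k + 1), HS k) := ⟨fun w => ⟨b w, (hb (hbm w)).le⟩, hbo.continuous.subtype_mk _⟩
  refine ⟨B, ⟨.of_comp B.continuous continuous_subtype_val hbo.toIsEmbedding, ?_⟩,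
    Subtype.ext (OpenPartialHomeomorph.univBall_apply_zero _ _)⟩
  have : Set.range B = Subtype.val ⁻¹' Set.range b := by
    ext w
    exact ⟨fun ⟨a, ha⟩ => ⟨a, congrArg Subtype.val ha⟩, fun ⟨a, ha⟩ => ⟨a, Subtype.ext ha⟩⟩
  rw [this]; exact hbo.isOpen_range.preimage continuous_subtype_val
theorem notB {d : ℕ} {x : X} : x ∉ intBoundary d X ↔
    ∃ e : C(E d, X), Topology.IsOpenEmbedding e ∧ e 0 = x := by
  have q := (EuclideanSpace.equiv (Fin d) ℝ).toHomeomorph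
  constructor
  · intro h
    obtain ⟨U, hx, hU, ⟨φ⟩⟩ := not_not.1 h
    let ψ : E d ≃ₜ U := (φ.trans q).symm
    obtain ⟨e, h1, h2⟩ := trans_oe (e := (vl U).comp (ψ : C(E d, U)))
      (hU.isOpenEmbedding_subtypeVal.comp ψ.isOpenEmbedding) (ψ.symm ⟨x, hx⟩)
    exact ⟨e, h1, h2.trans (by simp [vl])⟩
  · rintro ⟨e, he, rfl⟩ h
    exact h ⟨Set.range e, ⟨0, rfl⟩, he.isOpen_range, ⟨he.toIsEmbedding.toHomeomorph.symm.trans q.symm⟩⟩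
theorem bd_closed (d : ℕ) : IsClosed (intBoundary d X) := by
  rw [← isOpen_compl_iff, isOpen_iff_mem_nhds]
  intro x hx
  obtain ⟨e, he, rfl⟩ := notB.1 hx
  refine Filter.mem_of_superset (he.isOpen_range.mem_nhds ⟨0, rfl⟩) ?_
  rintro _ ⟨v, rfl⟩
  exact notB.2 (trans_oe he v)
theorem hs_bd [T2Space X] {k : ℕ} {e : C(HS k, X)} (he : Topology.IsOpenEmbedding e) (v : HS k) :
    e v ∈ intBoundary (k + 1) X ↔ ∑ i, v.1 i = 0 := by
  constructor
  · intro h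
    by_contra hv
    obtain ⟨b, hb, rfl⟩ := hs_int v (lt_of_le_of_ne v.2 (Ne.symm hv))
    exact notB.2 ⟨e.comp b, he.comp hb, rfl⟩ h
  · intro hv
    by_contra h
    obtain ⟨f, hf, hf0⟩ := notB.1 h
    obtain ⟨g, hg⟩ := (locE (k + 1)).1
    have h1 : Gen (k + 1) {e v}ᶜ (pf f g) := by
      rw [← hf0]
      exact Gen.exc hf isOpen_compl_singleton cov_sing (by rw [pre_sing hf]; exact hg)
    obtain ⟨w, hw, hw'⟩ := exc_surj he isOpen_compl_singleton cov_sing h1.cy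
    have h2 := Gen.exc_inv he isOpen_compl_singleton cov_sing hw (h1.congr hw')
    rw [pre_sing he] at h2
    have hs : ∀ (t : ℝ) (u : E (k + 1)), ∑ i, ((1 - t) • u + t • (v.1 + 1)) i =
        (1 - t) * ∑ i, u i + t * (k + 1) := fun t u => by
      simp [Finset.sum_add_distrib, ← Finset.mul_sum, hv]; ring
    have hk : (0 : ℝ) < k + 1 := by positivity
    let c : Contr (HS k) :=
      { H := ⟨fun q => ⟨(1 - q.2 : ℝ) • q.1.1 + (q.2 : ℝ) • (v.1 + 1), by
          rw [hs]
          exact add_nonneg (mul_nonneg (sub_nonneg.2 q.2.2.2) q.1.2) (mul_nonneg q.2.2.1 hk.le)⟩,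
          by fun_prop⟩
        b := ⟨v.1 + 1, by have := hs 1 0; simp only [sub_self, zero_smul, one_smul, zero_add, zero_mul,
          one_mul] at this; rw [this]; exact hk.le⟩
        h0 := fun x => Subtype.ext (by simp)
        h1 := fun x => Subtype.ext (by simp) }
    have h3 : ∀ x ∈ ({v}ᶜ : Set (HS k)), ∀ t, c.H (x, t) ∈ ({v}ᶜ : Set (HS k)) := fun x hx t e => by
      have e1 : (1 - t : ℝ) • x.1 + (t : ℝ) • (v.1 + 1) = v.1 := congrArg Subtype.val e
      have e2 := hs t x.1
      rw [e1, hv] at e2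
      have e3 : (t : ℝ) * (k + 1) = 0 := by
        have := mul_nonneg (sub_nonneg.2 t.2.2) x.2
        have := mul_nonneg t.2.1 hk.le
        linarith
      rw [(mul_eq_zero.1 e3).resolve_right hk.ne', sub_zero, one_smul, zero_smul, add_zero] at e1
      exact hx (Subtype.ext e1)
    have h4 : c.b ∈ ({v}ᶜ : Set (HS k)) := fun e => by
      have e1 : v.1 + 1 = v.1 := congrArg Subtype.val e
      simpa using congrFun e1 0
    exact one_ne_zero (h2.tf 1 (contr_Bd c h3 h4 (k + 1) (by rw [one_smul]; exact h2.cy)))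
theorem bd_chart {k : ℕ} (hM : IsManifoldWithBoundary (k + 1) X) {x : X}
    (hx : x ∈ intBoundary (k + 1) X) : ∃ e : C(HS k, X), Topology.IsOpenEmbedding e ∧ e 0 = x := by
  have t2 := hM.1
  obtain ⟨U, hxU, hU, h | ⟨⟨φ⟩⟩⟩ := hM.2.2 x
  · exact absurd ⟨U, hxU, hU, h⟩ hx
  let q := (EuclideanSpace.equiv (Fin (k + 1)) ℝ).toHomeomorph
  let ψ : HS k ≃ₜ U := (φ.trans (q.subtype fun y => Iff.rfl)).symm
  let e0 : C(HS k, X) := (vl U).comp (ψ : C(HS k, U))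
  have he0 : Topology.IsOpenEmbedding e0 := hU.isOpenEmbedding_subtypeVal.comp ψ.isOpenEmbedding
  set y := ψ.symm ⟨x, hxU⟩
  have hy : e0 y = x := by simp [e0, y, vl]
  have hs : ∑ i, y.1 i = 0 := (hs_bd he0 y).1 (by rw [hy]; exact hx)
  let τ : HS k ≃ₜ HS k := (Homeomorph.addRight y.1).subtype fun v => by
    simp [Finset.sum_add_distrib, hs]
  refine ⟨e0.comp (τ : C(HS k, HS k)), he0.comp τ.isOpenEmbedding, ?_⟩
  rw [← hy]
  exact congrArg e0 (Subtype.ext (zero_add y.1))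
theorem mf_bd {k : ℕ} (hM : IsManifoldWithBoundary (k + 1) X) : LE k (intBoundary (k + 1) X) := by
  have t2 := hM.1
  rintro ⟨x, hx⟩
  obtain ⟨e, he, rfl⟩ := bd_chart hM hx
  obtain ⟨g, hg1, hg2⟩ := oe_inv he
  have hj : ∀ a : E k, ∑ i, (Fin.cons (α := fun _ => ℝ) (-∑ i, a i) a : E (k + 1)) i = 0 := fun a => by
    simp [Fin.sum_univ_succ]
  have hc : Continuous fun a : E k => (Fin.cons (α := fun _ => ℝ) (-∑ i, a i) a : E (k + 1)) := by
    refine continuous_pi fun i => ?_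
    refine Fin.cases ?_ (fun j => ?_) i
    · simp only [Fin.cons_zero]; fun_prop
    · simp only [Fin.cons_succ]; fun_prop
  let j : C(E k, HS k) := ⟨fun a => ⟨_, (hj a).ge⟩, hc.subtype_mk _⟩
  let f : C(E k, intBoundary (k + 1) X) := ⟨fun a => ⟨e (j a), (hs_bd he _).2 (hj a)⟩, by fun_prop⟩
  let U : Set (intBoundary (k + 1) X) := Subtype.val ⁻¹' Set.range e
  let G : C(U, E k) := ⟨fun u => Fin.tail (g ⟨u.1.1, u.2⟩).1, by
    have := sg_cont g (continuous_subtype_val (p := (· ∈ intBoundary (k + 1) X)))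
    exact continuous_pi fun i => (continuous_apply i.succ).comp (continuous_subtype_val.comp this)⟩
  refine ⟨f, oe_of (U := U) (he.isOpen_range.preimage continuous_subtype_val) G (fun y => ⟨_, rfl⟩)
    (fun y => ?_) fun u => Subtype.ext ?_, Subtype.ext (congrArg e (Subtype.ext ?_))⟩
  · change Fin.tail (g ⟨e (j y), _⟩).1 = y
    rw [hg1]; exact Fin.tail_cons _ _
  · refine Eq.trans (congrArg e (Subtype.ext ?_)) (hg2 ⟨u.1.1, u.2⟩)
    have h1 := (hs_bd he (g ⟨u.1.1, u.2⟩)).1 (by rw [hg2]; exact u.1.2)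
    have : -∑ i, G u i = (g ⟨u.1.1, u.2⟩).1 0 := by
      rw [Fin.sum_univ_succ] at h1; exact (eq_neg_of_add_eq_zero_left h1).symm
    change (Fin.cons (α := fun _ => ℝ) (-∑ i, G u i) (G u) : E (k + 1)) = _
    rw [this]; exact Fin.cons_self_tail _
  · funext i
    change (Fin.cons (α := fun _ => ℝ) (-∑ i, (0 : E k) i) (0 : E k) : E (k + 1)) i = 0
    refine Fin.cases ?_ (fun j => ?_) i <;> simp
theorem mf_le {k : ℕ} (hM : IsManifoldWithBoundary (k + 1) X) :
    LE (k + 1) (Wt (intBoundary (k + 1) X)) := by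
  have t2 := hM.1
  rintro ⟨⟨x, t⟩, ht, hp⟩
  by_cases hx : x ∈ intBoundary (k + 1) X
  · obtain ⟨e, he, rfl⟩ := bd_chart hM hx
    obtain ⟨g, hg1, hg2⟩ := oe_inv he
    let s : E (k + 1) → ℝ := fun v => max (-∑ i, v i) 0
    have hs : Continuous s := by unfold s; fun_prop
    have hsum : ∀ (v : E (k + 1)) (r : ℝ), ∑ i, (v i + r / (k + 1)) = ∑ i, v i + r := fun v r => by
      have : (k + 1 : ℝ) ≠ 0 := by positivity
      simp [Finset.sum_add_distrib]; field_simp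
    let a : C(E (k + 1), HS k) := ⟨fun v => ⟨fun i => v i + s v / (k + 1), by
      rw [hsum]; linarith [le_max_left (-∑ i, v i) 0, show s v = max (-∑ i, v i) 0 from rfl]⟩, by fun_prop⟩
    let f : C(E (k + 1), Wt (intBoundary (k + 1) X)) := ⟨fun v => ⟨(e (a v), s v), le_max_right _ _, by
      rw [hs_bd he]
      change s v = 0 ∨ ∑ i, (v i + s v / (k + 1)) = 0
      rw [hsum]
      rcases le_total (-∑ i, v i) 0 with h | h
      · exact .inl (max_eq_right h)
      · right; rw [show s v = -∑ i, v i from max_eq_left h]; ring⟩, by fun_prop⟩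
    let U : Set (Wt (intBoundary (k + 1) X)) := (fun p => p.1.1) ⁻¹' Set.range e
    let G : C(U, E (k + 1)) := ⟨fun u i => (g ⟨u.1.1.1, u.2⟩).1 i - u.1.1.2 / (k + 1), by
      have := sg_cont g (show Continuous fun p : Wt (intBoundary (k + 1) X) => p.1.1 by fun_prop)
      exact continuous_pi fun i => ((continuous_apply i).comp (continuous_subtype_val.comp this)).sub
        (by fun_prop)⟩
    have hf : Topology.IsOpenEmbedding f := by
      refine oe_of (U := U) (he.isOpen_range.preimage (by fun_prop)) G (fun y => ⟨_, rfl⟩) (fun y => ?_)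
        fun u => ?_
      · funext i
        change (g ⟨e (a y), _⟩).1 i - s y / (k + 1) = y i
        rw [hg1]; exact add_sub_cancel_right _ _
      · have e1 : s (G u) = u.1.1.2 := by
          have h1 : ∑ i, G u i = ∑ i, (g ⟨u.1.1.1, u.2⟩).1 i - u.1.1.2 := by
            have := hsum (g ⟨u.1.1.1, u.2⟩).1 (-u.1.1.2)
            simp only [neg_div, ← sub_eq_add_neg] at this
            exact this
          have h2 := (g ⟨u.1.1.1, u.2⟩).2
          change max _ _ = _
          rw [h1]
          rcases u.1.2.2 with h | h
          · rw [h, sub_zero, max_eq_right (neg_nonpos.2 h2)]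
          · have h3 := (hs_bd he (g ⟨u.1.1.1, u.2⟩)).1 (by rw [hg2]; exact h)
            rw [h3, zero_sub, neg_neg, max_eq_left u.1.2.1]
        refine Subtype.ext (Prod.ext ?_ e1)
        refine Eq.trans (congrArg e (Subtype.ext ?_)) (hg2 ⟨u.1.1.1, u.2⟩)
        funext i
        change (g ⟨u.1.1.1, u.2⟩).1 i - u.1.1.2 / (k + 1) + s (G u) / (k + 1) = _
        rw [e1, sub_add_cancel]
    obtain ⟨f', h1, h2⟩ := trans_oe hf (G ⟨⟨(e 0, t), ht, hp⟩, 0, rfl⟩)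
    refine ⟨f', h1, h2.trans ?_⟩
    have e0 : ∀ i, G ⟨⟨(e 0, t), ht, hp⟩, 0, rfl⟩ i = - (t / (k + 1)) := fun i => by
      change (g ⟨e 0, _⟩).1 i - t / (k + 1) = _
      rw [hg1]; exact zero_sub _
    have e1 : s (G ⟨⟨(e 0, t), ht, hp⟩, 0, rfl⟩) = t := by
      have : (k + 1 : ℝ) ≠ 0 := by positivity
      change max (-∑ i, _) 0 = t
      simp only [e0]
      rw [Finset.sum_const, Finset.card_univ, Fintype.card_fin, nsmul_eq_mul]
      push_cast
      rw [mul_neg, neg_neg, mul_div_cancel₀ _ this, max_eq_left ht]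
    refine Subtype.ext (Prod.ext (congrArg e (Subtype.ext (funext fun i => ?_))) e1)
    change _ + s _ / (k + 1) = 0
    rw [e1, e0, neg_add_cancel]
  · obtain rfl : t = 0 := hp.resolve_right hx
    obtain ⟨e, he, rfl⟩ := notB.1 hx
    obtain ⟨g, hg1, hg2⟩ := oe_inv he
    refine ⟨(wi _).comp e, oe_of (U := (fun p => p.1.1) ⁻¹' Set.range e)
      (he.isOpen_range.preimage (by fun_prop)) ⟨fun u => g ⟨u.1.1.1, u.2⟩, sg_cont g (by fun_prop)⟩
      (fun y => ⟨y, rfl⟩) (fun y => hg1 y) fun u => ?_, rfl⟩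
    refine Subtype.ext (Prod.ext (hg2 ⟨u.1.1.1, u.2⟩) (u.1.2.2.resolve_right ?_).symm)
    obtain ⟨v, hv⟩ := u.2
    have hv : e v = u.1.1.1 := hv
    rw [← hv]
    exact notB.2 (trans_oe he v)
end SV
namespace SV
variable {X Y : Type} [TopologicalSpace X] [TopologicalSpace Y]
structure Good (A : Set X) : Prop where
  asph : Aspherical A
  bi : ∀ (x y : A) (p q : Path x y), (p.map continuous_subtype_val).Homotopic
    (q.map continuous_subtype_val) → p.Homotopic q
theorem hq_iff {x y : X} {p q : Path x y} :
    p.Homotopic q ↔ (p.trans q.symm).Homotopic (Path.refl x) := by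
  simp only [← Path.Homotopic.Quotient.eq, Path.Homotopic.Quotient.mk_trans,
    Path.Homotopic.Quotient.mk_symm, Path.Homotopic.Quotient.mk_refl]
  constructor
  · rintro h; rw [h, Path.Homotopic.Quotient.trans_symm]
  · intro h
    have := congrArg (fun z => z.trans (.mk q)) h
    simpa [Path.Homotopic.Quotient.trans_assoc] using this
theorem Good.of {n : ℕ} (h2 : BoundaryIrreducible n X) (h3 : Aspherical ↥(intBoundary n X)) :
    Good (intBoundary n X) := by
  refine ⟨h3, fun x y p q h => hq_iff.2 ?_⟩
  set γ := p.trans q.symm with hγ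
  have hm : ∀ t, (γ t : X) ∈ connectedComponentIn (intBoundary n X) x := fun t => by
    have : Set.range (fun t => (γ t : X)) ⊆ connectedComponentIn (intBoundary n X) x :=
      (isPreconnected_range (by fun_prop)).subset_connectedComponentIn ⟨0, by simp⟩
        (by rintro _ ⟨t, rfl⟩; exact (γ t).2)
    exact this ⟨t, rfl⟩
  let γ' : Path (X := ↥(connectedComponentIn (intBoundary n X) x))
    ⟨x, mem_connectedComponentIn x.2⟩ ⟨x, mem_connectedComponentIn x.2⟩ :=
    ⟨⟨fun t => ⟨γ t, hm t⟩, by fun_prop⟩, Subtype.ext (by simp), Subtype.ext (by simp)⟩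
  have h1 : (γ'.map continuous_subtype_val).Homotopic (Path.refl (x : X)) := by
    have := hq_iff.1 h
    rw [Path.map_symm, ← Path.map_trans] at this
    exact this
  have h4 := (h2 x x.2 γ' h1).map (⟨fun u => ⟨u.1, connectedComponentIn_subset _ _ u.2⟩, by fun_prop⟩ :
    C(connectedComponentIn (intBoundary n X) x, intBoundary n X))
  exact h4
theorem Good.cover {f : Y → X} (hf : IsCoveringMap f) {A : Set X} (h : Good A) : Good (f ⁻¹' A) := by
  have hr := hf.restrictPreimage A
  refine ⟨fun k hk y => ⟨?_⟩, fun x y p q e => ?_⟩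
  · rintro ⟨a⟩ ⟨b⟩
    refine Quotient.sound ?_
    have hs := h.asph k hk (A.restrictPreimage f y)
    let F : GenLoop (Fin k) (f ⁻¹' A) y → GenLoop (Fin k) A (A.restrictPreimage f y) := fun a =>
      ⟨(⟨_, hr.continuous⟩ : C(f ⁻¹' A, A)).comp a.1, fun u hu => congrArg (A.restrictPreimage f) (a.2 u hu)⟩
    have h1 : GenLoop.Homotopic (F a) (F b) := Quotient.exact (hs.elim ⟦F a⟧ ⟦F b⟧)
    have h0 : (0 : Fin k → unitInterval) ∈ Cube.boundary (Fin k) := ⟨⟨0, by omega⟩, .inl rfl⟩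
    exact (hr.homotopicRel_iff_comp ⟨0, h0, (a.2 _ h0).trans (b.2 _ h0).symm⟩).2 h1
  · refine Path.Homotopic.Quotient.eq.1 (hr.injective_path_homotopic_map _ _ ?_)
    have := h.bi _ _ (p.map hr.continuous) (q.map hr.continuous) (e.map ⟨f, hf.continuous⟩)
    exact Path.Homotopic.Quotient.eq.2 this
theorem cov_incl [T2Space X] [CompactSpace X] {S : Set X} (h : IsClopen S) :
    IsCoveringMap (Subtype.val : S → X) := by
  have := isCompact_iff_compactSpace.1 h.1.isCompact
  exact isLocalHomeomorph_iff_isCoveringMap.1 h.2.isOpenEmbedding_subtypeVal.isLocalHomeomorph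
end SV
namespace SV
variable {X Y : Type} [TopologicalSpace X] [TopologicalSpace Y]
theorem ball_homeo (k : ℕ) (hk : 0 < k) : ∃ (h : C(TSimplex k, E k)) (g : C(E k, TSimplex k)),
    (∀ x, ‖h x‖ ≤ 1) ∧ (∀ x, g (h x) = x) ∧ (∀ y, 1 ≤ ‖y‖ → ∃ i, (g y).1 i = 0) ∧
    ∀ x : TSimplex k, (∃ i, x.1 i = 0) → ‖h x‖ = 1 ∧ ∀ t : ℝ, 0 ≤ t → g ((1 + t) • h x) = x := by
  let s : Set (E k) := {v | (∀ i, 0 ≤ v i) ∧ ∑ i, v i ≤ 1}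
  let U : Set (E k) := {v | (∀ i, 0 < v i) ∧ ∑ i, v i < 1}
  have hs : IsClosed s := by
    have : s = (⋂ i, {v : E k | 0 ≤ v i}) ∩ {v | ∑ i, v i ≤ 1} := by ext v; simp [s]
    rw [this]
    exact (isClosed_iInter fun i => isClosed_le continuous_const (continuous_apply i)).inter
      (isClosed_le (by fun_prop) continuous_const)
  have hU : IsOpen U := by
    have : U = (⋂ i, {v : E k | 0 < v i}) ∩ {v | ∑ i, v i < 1} := by ext v; simp [U]
    rw [this]
    exact (isOpen_iInter_of_finite fun i => isOpen_lt continuous_const (continuous_apply i)).inter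
      (isOpen_lt (by fun_prop) continuous_const)
  have hUs : U ⊆ s := fun v hv => ⟨fun i => (hv.1 i).le, hv.2.le⟩
  have hc : Convex ℝ s := by
    rintro v ⟨h1, h2⟩ w ⟨h3, h4⟩ a b ha hb hab
    refine ⟨fun i => add_nonneg (mul_nonneg ha (h1 i)) (mul_nonneg hb (h3 i)), ?_⟩
    simp only [Pi.add_apply, Pi.smul_apply, smul_eq_mul, Finset.sum_add_distrib, ← Finset.mul_sum]
    nlinarith
  have hkr : (0 : ℝ) < k := by exact_mod_cast hk
  have hne : (interior s).Nonempty := by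
    refine ⟨fun _ => 1 / (k + 1), interior_maximal hUs hU ⟨fun i => by positivity, ?_⟩⟩
    rw [Finset.sum_const, Finset.card_univ, Fintype.card_fin, nsmul_eq_mul, mul_one_div,
      div_lt_one (by positivity)]
    linarith
  have hb : Bornology.IsBounded s := by
    refine (Metric.isBounded_closedBall (x := (0 : E k)) (r := 1)).subset fun v hv => ?_
    rw [mem_closedBall_zero_iff, pi_norm_le_iff_of_nonneg zero_le_one]
    intro i
    rw [Real.norm_eq_abs, abs_of_nonneg (hv.1 i)]
    exact (Finset.single_le_sum (fun j _ => hv.1 j) (Finset.mem_univ i)).trans hv.2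
  have hint : interior s ⊆ U := by
    intro v hv
    have hp : ∀ w : E k, ∃ ε : ℝ, 0 < ε ∧ v + ε • w ∈ s := fun w => by
      have h1 : Filter.Tendsto (fun ε : ℝ => v + ε • w) (nhds 0) (nhds v) := by
        have : Continuous fun ε : ℝ => v + ε • w := by fun_prop
        simpa using this.tendsto 0
      have h2 := (h1.eventually (mem_interior_iff_mem_nhds.1 hv)).filter_mono (nhdsWithin_le_nhds (s := Set.Ioi 0))
      obtain ⟨ε, h3, h4⟩ := (h2.and self_mem_nhdsWithin).exists
      exact ⟨ε, h4, h3⟩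
    refine ⟨fun i => ?_, ?_⟩
    · obtain ⟨ε, h1, h2⟩ := hp (-1)
      have := h2.1 i
      simp only [Pi.add_apply, Pi.smul_apply, Pi.neg_apply, Pi.one_apply, smul_eq_mul] at this
      linarith
    · obtain ⟨ε, h1, h2⟩ := hp 1
      have := h2.2
      simp only [Pi.add_apply, Pi.smul_apply, Pi.one_apply, smul_eq_mul, Finset.sum_add_distrib,
        Finset.sum_const, Finset.card_univ, Fintype.card_fin, nsmul_eq_mul] at this
      have := mul_pos hkr h1
      linarith
  obtain ⟨H, -, H1, H2⟩ := exists_homeomorph_image_interior_closure_frontier_eq_unitBall hc hne hb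
  rw [hs.closure_eq] at H1
  rw [hs.frontier_eq] at H2
  let d : TSimplex k → E k := fun x i => x.1 i.succ
  have hd : Continuous d := continuous_pi fun i => (continuous_apply _).comp continuous_subtype_val
  have hsum : ∀ x : TSimplex k, x.1 0 + ∑ i, d x i = 1 := fun x => by
    rw [← Fin.sum_univ_succ]; exact x.2.2
  have hds : ∀ x, d x ∈ s := fun x => ⟨fun i => x.2.1 _, by linarith [hsum x, x.2.1 0]⟩
  have hdU : ∀ x, d x ∈ interior s ↔ ¬ ∃ i, x.1 i = 0 := fun x => by
    constructor
    · rintro h ⟨i, hi⟩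
      have h' := hint h
      revert hi
      refine Fin.cases (fun hi => ?_) (fun i hi => ?_) i
      · linarith [hsum x, h'.2]
      · exact (h'.1 i).ne' hi
    · intro h
      push Not at h
      have h' : ∀ i, 0 < x.1 i := fun i => lt_of_le_of_ne (x.2.1 i) (h i).symm
      exact interior_maximal hUs hU ⟨fun i => h' _, by linarith [hsum x, h' 0]⟩
  let r : E k → E k := fun y => (max 1 ‖y‖)⁻¹ • y
  have hrc : Continuous r := by
    refine ((continuous_const.max continuous_norm).inv₀ fun y => ?_).smul continuous_id
    exact (lt_of_lt_of_le one_pos (le_max_left _ _)).ne'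
  have hr1 : ∀ y, ‖r y‖ ≤ 1 := fun y => by
    rw [norm_smul, norm_inv, Real.norm_of_nonneg (by positivity), inv_mul_le_one₀ (by positivity)]
    exact le_max_right _ _
  have hr2 : ∀ y, 1 ≤ ‖y‖ → ‖r y‖ = 1 := fun y hy => by
    rw [norm_smul, norm_inv, Real.norm_of_nonneg (by positivity), max_eq_right hy,
      inv_mul_cancel₀ (by positivity)]
  have hr3 : ∀ y, ‖y‖ ≤ 1 → r y = y := fun y hy => by simp [r, max_eq_left hy]
  have hG : ∀ y, ‖y‖ ≤ 1 → H.symm y ∈ s := fun y hy => by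
    obtain ⟨v, hv, e⟩ : y ∈ H '' s := by rw [H1]; simpa using hy
    rw [← e, H.symm_apply_apply]; exact hv
  let T : C(E k, TSimplex k) := ⟨fun y => ⟨Fin.cons (α := fun _ => ℝ) (1 - ∑ i, H.symm (r y) i) (H.symm (r y)), by
    have := hG _ (hr1 y)
    refine ⟨fun i => ?_, by simp [Fin.sum_univ_succ]⟩
    refine Fin.cases ?_ (fun j => ?_) i
    · simpa using this.2
    · exact this.1 j⟩, by
    refine Continuous.subtype_mk (continuous_pi fun i => ?_) _
    have h1 : Continuous fun y => H.symm (r y) := by fun_prop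
    refine Fin.cases ?_ (fun j => ?_) i
    · simp only [Fin.cons_zero]; fun_prop
    · simp only [Fin.cons_succ]; fun_prop⟩
  have hT : ∀ y x, r y = H (d x) → T y = x := fun y x e => by
    have e' : H.symm (r y) = d x := by rw [e, H.symm_apply_apply]
    refine ts_ext fun i => ?_
    change (Fin.cons (α := fun _ => ℝ) (1 - ∑ i, H.symm (r y) i) (H.symm (r y)) : E (k + 1)) i = _
    rw [e']
    refine Fin.cases ?_ (fun j => rfl) i
    simp only [Fin.cons_zero]; linarith [hsum x]
  have hd1 : ∀ x, ‖H (d x)‖ ≤ 1 := fun x => by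
    have : H (d x) ∈ H '' s := ⟨_, hds x, rfl⟩
    rw [H1] at this; simpa using this
  refine ⟨⟨fun x => H (d x), by fun_prop⟩, T, hd1, fun x => hT _ x (hr3 _ (hd1 x)), fun y hy => ?_,
    fun x hx => ?_⟩
  · by_contra hn
    have h1 := (hdU (T y)).2 hn
    have h2 : r y ∈ H '' (s \ interior s) := by rw [H2]; simpa using hr2 y hy
    obtain ⟨v, hv, e⟩ := h2
    refine hv.2 ?_
    convert h1 using 1
    rw [← H.symm_apply_apply v, e]; rfl
  · have h1 : ‖H (d x)‖ = 1 := by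
      have : H (d x) ∈ H '' (s \ interior s) := ⟨_, ⟨hds x, fun h => (hdU x).1 h hx⟩, rfl⟩
      rw [H2] at this; simpa using this
    refine ⟨h1, fun t ht => hT _ x ?_⟩
    change (max 1 ‖(1 + t) • H (d x)‖)⁻¹ • (1 + t) • H (d x) = _
    rw [norm_smul, h1, mul_one, Real.norm_of_nonneg (by positivity), max_eq_right (by linarith), smul_smul,
      inv_mul_cancel₀ (by positivity), one_smul]
end SV
namespace SV
variable {X Y : Type} [TopologicalSpace X] [TopologicalSpace Y]
abbrev Bs (k : ℕ) : Type := {x : TSimplex k // ∃ i, x.1 i = 0}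
theorem jn_one {k : ℕ} (x y : TSimplex k) : jn k (x, 1) = jn k (y, 1) := by
  refine ts_ext fun i => ?_
  refine Fin.cases rfl (fun j => ?_) i
  rw [jn_succ, jn_succ]; simp
theorem jn_inj {k : ℕ} {x y : TSimplex k} {s t : I} (h : jn k (x, s) = jn k (y, t)) :
    s = t ∧ (s ≠ 1 → x = y) := by
  have h0 : s = t := Subtype.ext (by rw [← jn_zero (x, s), h, jn_zero])
  subst h0
  refine ⟨rfl, fun hs => ts_ext fun i => ?_⟩
  have h1 : (1 - s : ℝ) ≠ 0 := fun e => hs (Subtype.ext (by simpa using (sub_eq_zero.1 e).symm))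
  have h2 : (jn k (x, s)).1 i.succ = (jn k (y, s)).1 i.succ := by rw [h]
  rw [jn_succ, jn_succ] at h2
  exact mul_left_cancel₀ h1 h2
theorem fill_b {k : ℕ} (hk : 0 < k) (hs : ∀ x : X, Subsingleton (HomotopyGroup (Fin k) X x))
    (b : C(Bs (k + 1), X)) : ∃ τ : C(TSimplex (k + 1), X), ∀ z : Bs (k + 1), τ z.1 = b z := by
  obtain ⟨h, g, hh, gh, g0, hb⟩ := ball_homeo k hk
  let pr : ℝ → I := fun s => Set.projIcc (0 : ℝ) 1 zero_le_one s
  have prc : Continuous pr := continuous_projIcc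
  have pr0 : ∀ s, s ≤ 0 → pr s = 0 := fun s hs => Set.projIcc_of_le_left _ hs
  have pr1 : ∀ s, 1 ≤ s → pr s = 1 := fun s hs => Set.projIcc_of_right_le _ hs
  have prI : ∀ s : I, pr s = s := fun s => Set.projIcc_val _ s
  have hB : ∀ y, ∃ i, (jn k (g y, pr (‖y‖ - 1))).1 i = 0 := fun y => by
    rcases le_total ‖y‖ 1 with h1 | h1
    · exact ⟨0, by rw [jn_zero]; simp [pr0 (‖y‖ - 1) (by linarith)]⟩
    · obtain ⟨i, hi⟩ := g0 y h1
      exact ⟨i.succ, by rw [jn_succ]; exact mul_eq_zero_of_right _ hi⟩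
  let G : C(E k, X) := ⟨fun y => b ⟨jn k (g y, pr (‖y‖ - 1)), hB y⟩,
    b.continuous.comp (Continuous.subtype_mk (by fun_prop) _)⟩
  have G1 : ∀ y (z : Bs (k + 1)), jn k (g y, pr (‖y‖ - 1)) = z.1 → G y = b z :=
    fun y z e => congrArg b (Subtype.ext e)
  let v : Bs (k + 1) := ⟨jn k (g 0, 1), Fin.succ 0, by rw [jn_succ]; simp⟩
  have G2 : ∀ y, 2 ≤ ‖y‖ → G y = b v := fun y hy => G1 y v (by
    rw [pr1 _ (by linarith)]; exact jn_one _ _)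
  let f : GenLoop (Fin k) X (b v) := ⟨⟨fun u => G fun i => 2 * (2 * (u i : ℝ) - 1), by fun_prop⟩, by
    rintro u ⟨i, hi⟩
    refine G2 _ (le_trans ?_ (norm_le_pi_norm _ i))
    rcases hi with hi | hi <;> simp [hi] <;> norm_num⟩
  obtain ⟨H⟩ : GenLoop.Homotopic f GenLoop.const :=
    Quotient.exact ((hs (b v)).elim (Quotient.mk _ f) (Quotient.mk _ GenLoop.const))
  let cu : E k → (Fin k → I) := fun w i => pr ((w i / 2 + 1) / 2)
  have cuc : Continuous cu := continuous_pi fun i => by fun_prop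
  have fcu : ∀ w, ‖w‖ ≤ 2 → f.1 (cu w) = G w := fun w hw => congrArg G (funext fun i => by
    have h1 := (norm_le_pi_norm w i).trans hw
    rw [Real.norm_eq_abs, abs_le] at h1
    have : ((cu w i : I) : ℝ) = (w i / 2 + 1) / 2 :=
      congrArg Subtype.val (prI ⟨(w i / 2 + 1) / 2, by linarith, by linarith⟩)
    rw [this]; ring)
  have bcu : ∀ w, ‖w‖ = 2 → cu w ∈ Cube.boundary (Fin k) := fun w hw => by
    obtain ⟨i, hi⟩ : ∃ i, ‖w i‖ = ‖w‖ := by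
      by_contra hn
      push Not at hn
      refine ((pi_norm_lt_iff (by rw [hw]; norm_num : 0 < ‖w‖)).2 fun i => ?_).false
      exact lt_of_le_of_ne (norm_le_pi_norm w i) (hn i)
    refine ⟨i, ?_⟩
    rw [hw, Real.norm_eq_abs, abs_eq (by norm_num)] at hi
    rcases hi with hi | hi
    · right; exact pr1 _ (by rw [hi]; norm_num)
    · left; exact pr0 _ (by rw [hi]; norm_num)
  have H0 : ∀ u, H (0, u) = f.1 u := fun u => H.apply_zero u
  have H1 : ∀ u, H (1, u) = b v := fun u => H.apply_one u
  have HB : ∀ s, ∀ u ∈ Cube.boundary (Fin k), H (s, u) = b v := fun s u hu =>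
    (H.eq_fst s hu).trans (f.2 u hu)
  let mu : TSimplex k × I → ℝ := fun p => (1 - p.2) + p.2 * (2 / max ‖h p.1‖ (1 / 2))
  have hmx : ∀ p : TSimplex k × I, 0 < max ‖h p.1‖ (1 / 2) := fun p => lt_max_of_lt_right (by norm_num)
  have muc : Continuous mu := by
    have : Continuous fun p : TSimplex k × I => 2 / max ‖h p.1‖ (1 / 2) :=
      continuous_const.div (by fun_prop) fun p => (hmx p).ne'
    fun_prop
  let F : C(TSimplex k × I, X) := ⟨fun p => H (pr (p.2 * min 1 (2 - 2 * ‖h p.1‖)), cu (mu p • h p.1)), by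
    fun_prop⟩
  have F0 : ∀ x, F (x, 0) = G (h x) := fun x => by
    change H (pr (((0 : I) : ℝ) * _), cu (mu (x, 0) • h x)) = _
    have : mu (x, 0) = 1 := by simp [mu]
    rw [this, one_smul, pr0 _ (by simp), H0, fcu _ ((hh x).trans (by norm_num))]
  have F1 : ∀ x, F (x, 1) = b v := fun x => by
    change H (pr (((1 : I) : ℝ) * min 1 (2 - 2 * ‖h x‖)), cu (mu (x, 1) • h x)) = _
    rcases le_total ‖h x‖ (1 / 2) with h1 | h1
    · rw [min_eq_left (by linarith), pr1 _ (by simp), H1]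
    · refine HB _ _ (bcu _ ?_)
      have : mu (x, 1) = 2 / ‖h x‖ := by simp only [mu]; rw [max_eq_left h1]; simp
      have h2 : 0 < ‖h x‖ := by linarith
      rw [this, norm_smul, norm_div, norm_norm, div_mul_cancel₀ _ h2.ne']; norm_num
  have FB : ∀ x t (e : ∃ i, x.1 i = 0), F (x, t) = G ((1 + (t : ℝ)) • h x) := fun x t e => by
    obtain ⟨h1, -⟩ := hb x e
    change H (pr ((t : ℝ) * min 1 (2 - 2 * ‖h x‖)), cu (mu (x, t) • h x)) = _
    have : mu (x, t) = 1 + t := by simp only [mu]; rw [h1, max_eq_left (by norm_num)]; ring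
    rw [this, pr0 _ (by rw [h1]; norm_num), H0, fcu]
    rw [norm_smul, h1, Real.norm_of_nonneg (by linarith [t.2.1])]; linarith [t.2.2]
  have hF : Function.FactorsThrough F (jn k) := by
    rintro ⟨x, s⟩ ⟨y, t⟩ e
    obtain ⟨rfl, h1⟩ := jn_inj e
    by_cases hs1 : s = 1
    · rw [hs1, F1, F1]
    · rw [h1 hs1]
  refine ⟨(jn_quot k).lift (f := jn k) F hF, fun z => ?_⟩
  obtain ⟨z, i, hi⟩ := z
  obtain ⟨⟨x, t⟩, rfl⟩ := jn_surj k z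
  refine (DFunLike.congr_fun ((jn_quot k).lift_comp (f := jn k) F hF) (x, t)).trans ?_
  by_cases ht1 : t = 1
  · subst ht1
    rw [F1]; exact congrArg b (Subtype.ext (jn_one _ _))
  by_cases ht0 : t = 0
  · subst ht0
    rw [F0]; refine G1 _ _ ?_
    rw [gh, pr0 _ (by linarith [hh x])]
  have hx : ∃ i, x.1 i = 0 := by
    revert hi
    refine Fin.cases (fun hi => ?_) (fun j hi => ⟨j, ?_⟩) i
    · exact absurd (Subtype.ext hi) ht0
    · rw [jn_succ] at hi
      refine (mul_eq_zero.1 hi).resolve_left fun e => ht1 (Subtype.ext (by simpa using (sub_eq_zero.1 e).symm))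
  rw [FB x t hx]
  obtain ⟨h1, h2⟩ := hb x hx
  refine G1 _ _ ?_
  rw [h2 _ t.2.1, norm_smul, h1, Real.norm_of_nonneg (by linarith [t.2.1])]
  have : (1 + (t : ℝ)) * 1 - 1 = t := by ring
  rw [this, prI]
theorem fm_inj {k : ℕ} (i : Fin (k + 2)) : Function.Injective (faceMap (n := k) i) := fun x y h =>
  ts_ext fun j => by rw [← fm_succ i x j, h, fm_succ]
theorem fm_ex {k : ℕ} (i : Fin (k + 2)) (z : TSimplex (k + 1)) (h : z.1 i = 0) :
    ∃ x, faceMap i x = z := by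
  refine ⟨⟨fun j => z.1 (i.succAbove j), fun j => z.2.1 _, ?_⟩, ts_ext fun j => ?_⟩
  · have := z.2.2
    rwa [Fin.sum_univ_succAbove _ i, h, zero_add] at this
  · rcases Fin.eq_self_or_eq_succAbove i j with rfl | ⟨l, rfl⟩
    · exact (fm_self _ _).trans h.symm
    · exact fm_succ _ _ _
theorem fill_wd {k : ℕ} (τ : Fin (k + 3) → C(TSimplex (k + 1), X))
    (hτ : ∀ i j, (τ i).comp (faceMap j) = (τ (i.succAbove j)).comp (faceMap (j.predAbove i)))
    (i i' : Fin (k + 3)) (x y : TSimplex (k + 1)) (e : faceMap i x = faceMap i' y) :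
    τ i x = τ i' y := by
  rcases Fin.eq_self_or_eq_succAbove i i' with rfl | ⟨j, rfl⟩
  · rw [fm_inj _ e]
  · have h0 : x.1 j = 0 := by rw [← fm_succ i x j, e, fm_self]
    obtain ⟨x, rfl⟩ := fm_ex j x h0
    have h1 : faceMap i (faceMap j x) = _ := DFunLike.congr_fun (fm_fm i j) x
    have h2 : faceMap (j.predAbove i) x = y := fm_inj _ (h1.symm.trans e)
    have h3 := DFunLike.congr_fun (hτ i j) x
    rw [ContinuousMap.comp_apply, ContinuousMap.comp_apply, h2] at h3
    exact h3
theorem fill {k : ℕ} (hs : ∀ x : X, Subsingleton (HomotopyGroup (Fin (k + 1)) X x))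
    (τ : Fin (k + 3) → C(TSimplex (k + 1), X))
    (hτ : ∀ i j, (τ i).comp (faceMap j) = (τ (i.succAbove j)).comp (faceMap (j.predAbove i))) :
    ∃ σ : C(TSimplex (k + 2), X), ∀ i, σ.comp (faceMap i) = τ i := by
  let p : C((_ : Fin (k + 3)) × TSimplex (k + 1), Bs (k + 2)) :=
    ⟨fun a => ⟨faceMap a.1 a.2, a.1, fm_self _ _⟩, by
      refine continuous_sigma fun i => Continuous.subtype_mk (faceMap i).continuous _⟩
  have hp : Topology.IsQuotientMap p := by
    refine p.continuous.isClosedMap.isQuotientMap p.continuous ?_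
    rintro ⟨z, i, hi⟩
    obtain ⟨x, rfl⟩ := fm_ex i z hi
    exact ⟨⟨i, x⟩, rfl⟩
  let F : C((_ : Fin (k + 3)) × TSimplex (k + 1), X) :=
    ⟨fun a => τ a.1 a.2, continuous_sigma fun i => (τ i).continuous⟩
  have hF : Function.FactorsThrough F p := by
    rintro ⟨i, x⟩ ⟨i', y⟩ e
    exact fill_wd τ hτ i i' x y (congrArg Subtype.val e)
  obtain ⟨b, hb⟩ : ∃ b : C(Bs (k + 2), X), b.comp p = F := ⟨_, hp.lift_comp (f := p) F hF⟩
  obtain ⟨σ, h⟩ := fill_b (Nat.succ_pos k) hs b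
  refine ⟨σ, fun i => ContinuousMap.ext fun x => ?_⟩
  exact (h (p ⟨i, x⟩)).trans (DFunLike.congr_fun hb ⟨i, x⟩)
end SV
namespace SV
variable {X Y : Type} [TopologicalSpace X] [TopologicalSpace Y]
abbrev HRel (c d : C(I, X)) : Prop := ContinuousMap.HomotopicRel c d {0, 1}
theorem HRel.toP {x y : X} {p : Path x y} {c : C(I, X)} (h : HRel p.toContinuousMap c) :
    ∃ q : Path x y, q.toContinuousMap = c ∧ p.Homotopic q := by
  obtain ⟨H⟩ := h
  refine ⟨⟨c, ?_, ?_⟩, rfl, ⟨H⟩⟩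
  · exact (H.fst_eq_snd (x := 0) (by simp)).symm.trans p.source
  · exact (H.fst_eq_snd (x := 1) (by simp)).symm.trans p.target
def sg : C(I, TSimplex 1) := ⟨fun t => ⟨![1 - (t : ℝ), t], by
    refine ⟨fun i => ?_, by simp⟩
    fin_cases i
    · exact sub_nonneg.2 t.2.2
    · exact t.2.1⟩, by
  refine Continuous.subtype_mk (continuous_pi fun i => ?_) _
  fin_cases i
  · exact continuous_const.sub continuous_subtype_val
  · exact continuous_subtype_val⟩
theorem sg_0 (t : I) : (sg t).1 0 = 1 - t := rfl
theorem sg_1 (t : I) : (sg t).1 1 = t := rfl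
def gs : C(TSimplex 1, I) := ⟨fun x => ⟨x.1 1, x.2.1 1, by
    have h := x.2.2
    rw [Fin.sum_univ_two] at h
    linarith [x.2.1 0]⟩, Continuous.subtype_mk ((continuous_apply 1).comp continuous_subtype_val) _⟩
theorem gs_sg (t : I) : gs (sg t) = t := rfl
theorem sg_gs (x : TSimplex 1) : sg (gs x) = x := by
  refine ts_ext fun i => ?_
  have h := x.2.2
  rw [Fin.sum_univ_two] at h
  fin_cases i
  · exact (sub_eq_iff_eq_add.2 h.symm)
  · rfl
def ln {k : ℕ} (a b : Fin (k + 1)) : C(I, TSimplex k) := (segMap a b).comp sg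
theorem ln_ap {k : ℕ} (a b j : Fin (k + 1)) (t : I) :
    (ln a b t).1 j = (if j = a then 1 - (t : ℝ) else 0) + (if j = b then (t : ℝ) else 0) := rfl
theorem ln_fm {k : ℕ} (i : Fin (k + 2)) (a b : Fin (k + 1)) :
    (faceMap i).comp (ln a b) = ln (i.succAbove a) (i.succAbove b) := by
  ext t : 1
  refine ts_ext fun j => ?_
  rcases Fin.eq_self_or_eq_succAbove i j with rfl | ⟨l, rfl⟩
  · refine (fm_self _ _).trans ?_
    rw [ln_ap, if_neg (Fin.succAbove_ne _ _).symm, if_neg (Fin.succAbove_ne _ _).symm, add_zero]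
  · refine (fm_succ _ _ _).trans ?_
    simp only [ln_ap, Fin.succAbove_right_inj]
theorem ln_self {k : ℕ} (a : Fin (k + 1)) (t : I) : ln a a t = vertexPt a := ts_ext fun j => by
  rw [ln_ap]; change _ = if j = a then (1 : ℝ) else 0; split <;> simp
def lnP {k : ℕ} (a b : Fin (k + 1)) : Path (vertexPt a : TSimplex k) (vertexPt b) :=
  ⟨ln a b, ts_ext fun j => by
      change (ln a b 0).1 j = if j = a then (1 : ℝ) else 0; rw [ln_ap]; simp,
    ts_ext fun j => by
      change (ln a b 1).1 j = if j = b then (1 : ℝ) else 0; rw [ln_ap]; simp⟩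
theorem ts_paths {k : ℕ} {x y : TSimplex k} (p q : Path x y) : p.Homotopic q := by
  haveI : ContractibleSpace (TSimplex k) :=
    (convex_stdSimplex ℝ (Fin (k + 1))).contractibleSpace ⟨x.1, x.2⟩
  exact SimplyConnectedSpace.paths_homotopic p q
def EE (A : Set X) {k : ℕ} (σ : SingSimplex k X) (a b : Fin (k + 1)) : Prop :=
  ∃ c : C(I, X), HRel (σ.comp (ln a b)) c ∧ ∀ t, c t ∈ A
theorem EE.tr {A : Set X} {k : ℕ} {σ : SingSimplex k X} {a b c : Fin (k + 1)} (h1 : EE A σ a c)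
    (h2 : EE A σ c b) : EE A σ a b := by
  obtain ⟨f, hf, fA⟩ := h1
  obtain ⟨g, hg, gA⟩ := h2
  obtain ⟨p, rfl, hp⟩ := HRel.toP (p := (lnP a c).map σ.continuous) hf
  obtain ⟨q, rfl, hq⟩ := HRel.toP (p := (lnP c b).map σ.continuous) hg
  refine ⟨(p.trans q).toContinuousMap, ?_, fun t => ?_⟩
  · have h3 := (ts_paths (lnP a b) ((lnP a c).trans (lnP c b))).map σ
    have h4 : ((lnP a b).map σ.continuous).Homotopic (p.trans q) :=
      h3.trans (by rw [Path.map_trans]; exact hp.hcomp hq)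
    exact h4
  · change (p.trans q) t ∈ A
    rw [Path.trans_apply]
    split
    · exact fA _
    · exact gA _
def ES (A : Set X) {k : ℕ} (σ : SingSimplex k X) : Prop := ∀ a b, EE A σ a b
theorem ES_of {A : Set X} {k : ℕ} {σ : SingSimplex k X} (h : Set.range σ ⊆ A) : ES A σ :=
  fun _ _ => ⟨_, .refl _, fun _ => h ⟨_, rfl⟩⟩
theorem EE_fm {A : Set X} {k : ℕ} {σ : SingSimplex (k + 1) X} {i : Fin (k + 2)} {a b : Fin (k + 1)} :
    EE A (σ.comp (faceMap i)) a b ↔ EE A σ (i.succAbove a) (i.succAbove b) := by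
  rw [EE, EE, ContinuousMap.comp_assoc, ln_fm]
theorem ES.fm {A : Set X} {k : ℕ} {σ : SingSimplex (k + 1) X} (h : ES A σ) (i : Fin (k + 2)) :
    ES A (σ.comp (faceMap i)) := fun _ _ => EE_fm.2 (h _ _)
theorem ES_two {A : Set X} {k : ℕ} {σ : SingSimplex (k + 2) X} {i j : Fin (k + 3)} (hij : i ≠ j)
    (hi : ES A (σ.comp (faceMap i))) (hj : ES A (σ.comp (faceMap j))) : ES A σ := by
  have key : ∀ l, ES A (σ.comp (faceMap l)) → ∀ a b, a ≠ l → b ≠ l → EE A σ a b := fun l h a b ha hb => by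
    obtain ⟨a, rfl⟩ := (Fin.eq_self_or_eq_succAbove l a).resolve_left ha
    obtain ⟨b, rfl⟩ := (Fin.eq_self_or_eq_succAbove l b).resolve_left hb
    exact EE_fm.1 (h a b)
  obtain ⟨c, hci, hcj⟩ : ∃ c : Fin (k + 3), c ≠ i ∧ c ≠ j := by
    have : ({i, j} : Finset (Fin (k + 3)))ᶜ.Nonempty := by
      rw [← Finset.card_pos, Finset.card_compl, Fintype.card_fin]
      have := Finset.card_le_two (a := i) (b := j)
      omega
    obtain ⟨c, hc⟩ := this
    simp only [Finset.mem_compl, Finset.mem_insert, Finset.mem_singleton, not_or] at hc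
    exact ⟨c, hc⟩
  intro a b
  by_cases h1 : a ≠ i ∧ b ≠ i
  · exact key i hi a b h1.1 h1.2
  by_cases h2 : a ≠ j ∧ b ≠ j
  · exact key j hj a b h2.1 h2.2
  by_cases ha : a = i
  · have hb : b ≠ i := fun e => h2 ⟨by rwa [ha], by rwa [e]⟩
    exact (key j hj a c (by rwa [ha]) hcj).tr (key i hi c b hci hb)
  · have hb : b = i := by tauto
    exact (key i hi a c ha hci).tr (key j hj c b hcj (by rwa [hb]))
theorem ES.zero {A : Set X} {σ : SingSimplex 0 X} (h : ES A σ) : Set.range σ ⊆ A := by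
  rintro _ ⟨x, rfl⟩
  obtain ⟨c, ⟨H⟩, hc⟩ := h 0 0
  have h0 := H.fst_eq_snd (x := 0) (by simp)
  have : ln 0 0 0 = x := ts_ext fun j => by
    have := x.2.2
    rw [Fin.sum_univ_one] at this
    obtain rfl : j = 0 := by fin_cases j; rfl
    rw [ln_self, this]; rfl
  rw [← this]
  change σ (ln 0 0 0) = _ at h0
  rw [h0]; exact hc 0
def sq : C(I × I, TSimplex 2) := ⟨fun p => ⟨![1 - p.2 - p.1 * (1 - |2 * (p.2 : ℝ) - 1|) / 2,
    p.1 * (1 - |2 * (p.2 : ℝ) - 1|), p.2 - p.1 * (1 - |2 * (p.2 : ℝ) - 1|) / 2], by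
  have h1 := p.1.2.1
  have h2 := p.1.2.2
  have h3 := p.2.2.1
  have h4 := p.2.2.2
  have h5 : |2 * (p.2 : ℝ) - 1| ≤ 1 := abs_le.2 ⟨by linarith, by linarith⟩
  have h6 := le_abs_self (2 * (p.2 : ℝ) - 1)
  have h7 := neg_abs_le (2 * (p.2 : ℝ) - 1)
  have h8 : (p.1 : ℝ) * (1 - |2 * (p.2 : ℝ) - 1|) ≤ 1 * (1 - |2 * (p.2 : ℝ) - 1|) :=
    mul_le_mul_of_nonneg_right h2 (by linarith)
  refine ⟨fun i => ?_, by simp [Fin.sum_univ_three]; ring⟩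
  fin_cases i
  · change 0 ≤ 1 - (p.2 : ℝ) - p.1 * (1 - |2 * (p.2 : ℝ) - 1|) / 2; linarith
  · exact mul_nonneg h1 (by linarith)
  · change 0 ≤ (p.2 : ℝ) - p.1 * (1 - |2 * (p.2 : ℝ) - 1|) / 2; linarith⟩, by
  refine Continuous.subtype_mk (continuous_pi fun i => ?_) _
  fin_cases i
  · change Continuous fun p : I × I => 1 - (p.2 : ℝ) - p.1 * (1 - |2 * (p.2 : ℝ) - 1|) / 2; fun_prop
  · change Continuous fun p : I × I => (p.1 : ℝ) * (1 - |2 * (p.2 : ℝ) - 1|); fun_prop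
  · change Continuous fun p : I × I => (p.2 : ℝ) - p.1 * (1 - |2 * (p.2 : ℝ) - 1|) / 2; fun_prop⟩
theorem sq_0 (p : I × I) : (sq p).1 0 = 1 - p.2 - p.1 * (1 - |2 * (p.2 : ℝ) - 1|) / 2 := rfl
theorem sq_1 (p : I × I) : (sq p).1 1 = p.1 * (1 - |2 * (p.2 : ℝ) - 1|) := rfl
theorem sq_2 (p : I × I) : (sq p).1 2 = p.2 - p.1 * (1 - |2 * (p.2 : ℝ) - 1|) / 2 := rfl
theorem ts2 {x y : TSimplex 2} (h1 : x.1 1 = y.1 1) (h2 : x.1 2 = y.1 2) : x = y := ts_ext fun i => by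
  have hx := x.2.2
  have hy := y.2.2
  rw [Fin.sum_univ_three] at hx hy
  fin_cases i
  · change x.1 0 = y.1 0; linarith
  · exact h1
  · exact h2
theorem sq_surj : Function.Surjective sq := by
  intro x
  have hx := x.2.2
  rw [Fin.sum_univ_three] at hx
  have h0 := x.2.1 0
  have h1 := x.2.1 1
  have h2 := x.2.1 2
  let u : I := ⟨x.1 2 + x.1 1 / 2, by linarith, by linarith⟩
  have h3 : x.1 1 ≤ 1 - |2 * (u : ℝ) - 1| := by
    have : |2 * (u : ℝ) - 1| ≤ 1 - x.1 1 := abs_le.2 ⟨by simp only [u]; linarith, by simp only [u]; linarith⟩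
    linarith
  have h4 : (x.1 1 / (1 - |2 * (u : ℝ) - 1|)) * (1 - |2 * (u : ℝ) - 1|) = x.1 1 := by
    by_cases h : 1 - |2 * (u : ℝ) - 1| = 0
    · rw [h] at h3 ⊢; linarith
    · exact div_mul_cancel₀ _ h
  refine ⟨(⟨x.1 1 / (1 - |2 * (u : ℝ) - 1|), div_nonneg h1 (h1.trans h3), div_le_one_of_le₀ h3 (h1.trans h3)⟩, u),
    ts2 h4 ?_⟩
  rw [sq_2]; simp only [h4]; simp only [u]; ring
theorem fill2 {x y z : X} {p : Path x y} {q : Path y z} {r : Path x z} (h : r.Homotopic (p.trans q)) :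
    ∃ τ : C(TSimplex 2, X), (∀ t, τ (ln 0 1 t) = p t) ∧ (∀ t, τ (ln 1 2 t) = q t) ∧
      ∀ t, τ (ln 0 2 t) = r t := by
  obtain ⟨H⟩ := h
  have hq : Topology.IsQuotientMap sq := sq.continuous.isClosedMap.isQuotientMap sq.continuous sq_surj
  let F : C(I × I, X) := H.toContinuousMap
  have hF : Function.FactorsThrough F sq := by
    rintro ⟨s, u⟩ ⟨s', u'⟩ e
    have e1 : (sq (s, u)).1 1 = (sq (s', u')).1 1 := by rw [e]
    have e2 : (sq (s, u)).1 2 = (sq (s', u')).1 2 := by rw [e]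
    rw [sq_1, sq_1] at e1
    rw [sq_2, sq_2, ← e1] at e2
    have : u = u' := Subtype.ext (by simpa using e2)
    subst this
    by_cases h0 : 1 - |2 * (u : ℝ) - 1| = 0
    · have h1 : u = 0 ∨ u = 1 := by
        rcases abs_choice (2 * (u : ℝ) - 1) with h | h
        · right; exact Subtype.ext (by change (u : ℝ) = 1; linarith)
        · left; exact Subtype.ext (by change (u : ℝ) = 0; linarith)
      change H (s, u) = H (s', u)
      rcases h1 with rfl | rfl
      · rw [H.source, H.source]
      · rw [H.target, H.target]
    · have : s = s' := Subtype.ext (mul_right_cancel₀ h0 e1)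
      rw [this]
  obtain ⟨τ, hτ⟩ : ∃ τ : C(TSimplex 2, X), τ.comp sq = F := ⟨_, hq.lift_comp (f := sq) F hF⟩
  have key : ∀ w s u, sq (s, u) = w → τ w = H (s, u) := fun w s u e => by
    rw [← e]; exact DFunLike.congr_fun hτ (s, u)
  refine ⟨τ, fun t => ?_, fun t => ?_, fun t => ?_⟩
  · have h1 : (t : ℝ) / 2 ≤ 1 / 2 := by linarith [t.2.2]
    have h2 : |2 * ((t : ℝ) / 2) - 1| = 1 - t := by
      rw [abs_of_nonpos (by linarith)]; ring
    rw [key _ 1 ⟨t / 2, by linarith [t.2.1], by linarith⟩ (ts2 (by rw [sq_1, ln_ap]; simp only [h2]; simp)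
      (by rw [sq_2, ln_ap]; simp only [h2]; simp)), H.apply_one]
    change (p.trans q) _ = _
    rw [Path.trans_apply, dif_pos (by simpa using h1)]
    exact congrArg p (Subtype.ext (by change 2 * ((t : ℝ) / 2) = t; ring))
  · have h0 := t.2.1
    have h3 := t.2.2
    have h2 : |2 * ((1 + t : ℝ) / 2) - 1| = t := by
      rw [abs_of_nonneg (by linarith)]; ring
    rw [key _ 1 ⟨(1 + t) / 2, by linarith, by linarith⟩ (ts2 (by rw [sq_1, ln_ap]; simp only [h2]; simp)
      (by rw [sq_2, ln_ap]; simp only [h2]; simp; ring)), H.apply_one]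
    change (p.trans q) _ = _
    rw [Path.trans_apply]
    split
    · rename_i h
      have h : (1 + t : ℝ) / 2 ≤ 1 / 2 := h
      have : t = 0 := Subtype.ext (by change (t : ℝ) = 0; linarith)
      subst this
      rw [q.source]; convert p.target using 2; exact Subtype.ext (by simp)
    · exact congrArg q (Subtype.ext (by change 2 * ((1 + t : ℝ) / 2) - 1 = t; ring))
  · rw [key _ 0 t (ts2 (by rw [sq_1, ln_ap]; simp) (by rw [sq_2, ln_ap]; simp)), H.apply_zero]; rfl
end SV
namespace SV
variable {X Y : Type} [TopologicalSpace X] [TopologicalSpace Y]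
theorem ln01 (t : I) : ln 0 1 t = sg t := ts_ext fun i => by
  rw [ln_ap]
  fin_cases i
  · simp [sg_0]
  · simp [sg_1]
theorem e_ext {e f : C(TSimplex 1, X)} (h : ∀ t, e (ln 0 1 t) = f (ln 0 1 t)) : e = f :=
  ContinuousMap.ext fun x => by have := h (gs x); rwa [ln01, sg_gs] at this
def lf {A : Set X} (f : C(Y, X)) (h : Set.range f ⊆ A) : C(Y, A) :=
  ⟨fun y => ⟨f y, h ⟨y, rfl⟩⟩, f.continuous.subtype_mk _⟩
def ival (A : Set X) : C(A, X) := ⟨Subtype.val, continuous_subtype_val⟩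
def lp {A : Set X} {x y : X} (q : Path x y) (h : ∀ t, q t ∈ A) (hx : x ∈ A) (hy : y ∈ A) :
    Path (⟨x, hx⟩ : A) ⟨y, hy⟩ :=
  ⟨⟨fun t => ⟨q t, h t⟩, q.continuous.subtype_mk _⟩, Subtype.ext q.source, Subtype.ext q.target⟩
theorem lp_map {A : Set X} {x y : X} (q : Path x y) (h : ∀ t, q t ∈ A) (hx : x ∈ A) (hy : y ∈ A) :
    (lp q h hx hy).map continuous_subtype_val = q := rfl
def PT (A : Set X) (k : ℕ) (f : SingSimplex k X → SingSimplex k X) (σ τ : SingSimplex (k + 1) X) : Prop :=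
  Set.range τ ⊆ A ∧ (∀ i, τ.comp (faceMap i) = f (σ.comp (faceMap i))) ∧
    (Set.range σ ⊆ A → τ = σ) ∧ (k = 0 → HRel (σ.comp (ln 0 1)) (τ.comp (ln 0 1)))
open Classical in
def TT (A : Set X) : (k : ℕ) → SingSimplex k X → SingSimplex k X
  | 0 => id
  | k + 1 => fun σ => if h : ∃ τ, PT A k (TT A k) σ τ then h.choose else σ
theorem TT_of {A : Set X} {k : ℕ} {σ : SingSimplex (k + 1) X} (h : ∃ τ, PT A k (TT A k) σ τ) :
    PT A k (TT A k) σ (TT A (k + 1) σ) := by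
  rw [TT]; beta_reduce; rw [dif_pos h]; exact h.choose_spec
theorem range_comp {A : Set X} {j k : ℕ} {σ : SingSimplex k X} (h : Set.range σ ⊆ A)
    (f : C(TSimplex j, TSimplex k)) : Set.range (σ.comp f) ⊆ A :=
  fun _ ⟨x, e⟩ => h ⟨f x, e⟩
theorem TT_tri {A : Set X} (hA : Good A) {σ : SingSimplex 2 X} (hσ : ES A σ)
    (sp : ∀ σ : SingSimplex 1 X, ES A σ → PT A 0 (TT A 0) σ (TT A 1 σ)) :
    ∃ τ : SingSimplex 2 X, Set.range τ ⊆ A ∧ ∀ i, τ.comp (faceMap i) = TT A 1 (σ.comp (faceMap i)) := by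
  have key : ∀ (i : Fin 3) (a b : Fin 3), i.succAbove 0 = a → i.succAbove 1 = b →
      ∃ q : Path (σ (vertexPt a)) (σ (vertexPt b)), ((lnP a b).map σ.continuous).Homotopic q ∧
        ∀ t, (TT A 1 (σ.comp (faceMap i))) (ln 0 1 t) = q t := by
    rintro i _ _ rfl rfl
    have h := (sp _ (hσ.fm i)).2.2.2 rfl
    rw [ContinuousMap.comp_assoc, ln_fm] at h
    obtain ⟨q, hq, h⟩ := HRel.toP (p := (lnP (i.succAbove 0) (i.succAbove 1)).map σ.continuous) h
    exact ⟨q, h, fun t => (DFunLike.congr_fun hq t).symm⟩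
  have inA : ∀ (i : Fin 3) t, (TT A 1 (σ.comp (faceMap i))) (ln 0 1 t) ∈ A :=
    fun i t => (sp _ (hσ.fm i)).1 ⟨_, rfl⟩
  obtain ⟨q, hq, eq⟩ := key 0 1 2 rfl rfl
  obtain ⟨r, hr, er⟩ := key 1 0 2 rfl rfl
  obtain ⟨p, hp, ep⟩ := key 2 0 1 rfl rfl
  have qA : ∀ t, q t ∈ A := fun t => eq t ▸ inA 0 t
  have rA : ∀ t, r t ∈ A := fun t => er t ▸ inA 1 t
  have pA : ∀ t, p t ∈ A := fun t => ep t ▸ inA 2 t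
  have h0 : σ (vertexPt 0) ∈ A := by simpa using pA 0
  have h1 : σ (vertexPt 1) ∈ A := by simpa using pA 1
  have h2 : σ (vertexPt 2) ∈ A := by simpa using qA 1
  have hh : r.Homotopic (p.trans q) := by
    refine hr.symm.trans (((ts_paths (lnP 0 2) ((lnP 0 1).trans (lnP 1 2))).map σ).trans ?_)
    rw [Path.map_trans]; exact hp.hcomp hq
  have hg := hA.bi _ _ (lp r rA h0 h2) ((lp p pA h0 h1).trans (lp q qA h1 h2)) (by
    rw [Path.map_trans]; exact hh)
  obtain ⟨τ, t1, t2, t3⟩ := fill2 hg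
  refine ⟨(ival A).comp τ, ?_, fun i => e_ext fun t => ?_⟩
  · rintro _ ⟨x, rfl⟩; exact (τ x).2
  · have e : ∀ a b, i.succAbove 0 = a → i.succAbove 1 = b →
        ((ival A).comp τ).comp (faceMap i) (ln 0 1 t) = (τ (ln a b t)).1 := by
      rintro _ _ rfl rfl
      rw [← ln_fm]; rfl
    fin_cases i
    · rw [e 1 2 rfl rfl, t2]; exact (eq t).symm
    · rw [e 0 2 rfl rfl, t3]; exact (er t).symm
    · rw [e 0 1 rfl rfl, t1]; exact (ep t).symm
theorem TT_spec {A : Set X} (hA : Good A) : ∀ k (σ : SingSimplex (k + 1) X), ES A σ →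
    PT A k (TT A k) σ (TT A (k + 1) σ)
  | 0, σ, hσ => by
    refine TT_of ?_
    by_cases h : Set.range σ ⊆ A
    · exact ⟨σ, h, fun i => rfl, fun _ => rfl, fun _ => .refl _⟩
    obtain ⟨c, hc, hcA⟩ := hσ 0 1
    have e : (c.comp gs).comp (ln 0 1) = c := by ext t; change c (gs (ln 0 1 t)) = _; rw [ln01, gs_sg]
    refine ⟨c.comp gs, ?_, fun i => ContinuousMap.ext fun x => ?_, fun h' => absurd h' h, fun _ => by rwa [e]⟩
    · rintro _ ⟨x, rfl⟩; exact hcA _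
    · obtain ⟨H⟩ := hc
      have h0 : x.1 0 = 1 := by simpa using x.2.2
      have hv : ∀ s : I, s ∈ ({0, 1} : Set I) → c s = σ (sg s) := fun s hs => by
        rw [← H.fst_eq_snd hs]; change σ (ln 0 1 s) = _; rw [ln01]
      change c (gs (faceMap i x)) = σ (faceMap i x)
      rw [hv, sg_gs]
      fin_cases i
      · right; exact Subtype.ext ((fm_succ (0 : Fin 2) x 0).trans h0)
      · left; exact Subtype.ext (fm_self (1 : Fin 2) x)
  | k + 1, σ, hσ => by
    have sp := TT_spec hA k
    refine TT_of ?_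
    by_cases h : Set.range σ ⊆ A
    · exact ⟨σ, h, fun i => ((sp _ (hσ.fm i)).2.2.1 (range_comp h _)).symm, fun _ => rfl, fun e => by omega⟩
    suffices ∃ τ : SingSimplex (k + 2) X, Set.range τ ⊆ A ∧
        ∀ i, τ.comp (faceMap i) = TT A (k + 1) (σ.comp (faceMap i)) by
      obtain ⟨τ, h1, h2⟩ := this
      exact ⟨τ, h1, h2, fun h' => absurd h' h, fun e => by omega⟩
    cases k with
    | zero => exact TT_tri hA hσ sp
    | succ j =>
      obtain ⟨τ, hτ⟩ := fill (k := j + 1) (fun x => hA.asph (j + 2) (by omega) x)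
        (fun i => lf (TT A (j + 2) (σ.comp (faceMap i))) (sp _ (hσ.fm i)).1) (fun i l => by
          have h1 := (sp _ (hσ.fm i)).2.1 l
          have h2 := (sp _ (hσ.fm (i.succAbove l))).2.1 (l.predAbove i)
          rw [ContinuousMap.comp_assoc, fm_fm, ← ContinuousMap.comp_assoc, ← h2] at h1
          exact ContinuousMap.ext fun x => Subtype.ext (DFunLike.congr_fun h1 x))
      refine ⟨(ival A).comp τ, ?_, fun i => ContinuousMap.ext fun x => ?_⟩
      · rintro _ ⟨x, rfl⟩; exact (τ x).2
      · exact congrArg Subtype.val (DFunLike.congr_fun (hτ i) x)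
end SV
namespace SV
variable {X Y : Type} [TopologicalSpace X] [TopologicalSpace Y]
def nrm {α : Type} (z : α →₀ ℝ) : ℝ := ∑ a ∈ z.support, |z a|
theorem nrm_nn {α : Type} (z : α →₀ ℝ) : 0 ≤ nrm z := Finset.sum_nonneg fun _ _ => abs_nonneg _
theorem nrm_eq {α : Type} {z : α →₀ ℝ} {s : Finset α} (h : z.support ⊆ s) : nrm z = ∑ a ∈ s, |z a| :=
  Finset.sum_subset h fun a _ ha => by rw [Finsupp.notMem_support_iff.1 ha, abs_zero]
theorem nrm_single {α : Type} (a : α) (r : ℝ) : nrm (Finsupp.single a r) = |r| := by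
  classical
  rw [nrm_eq (Finsupp.support_single_subset), Finset.sum_singleton, Finsupp.single_eq_same]
theorem nrm_smul {α : Type} (r : ℝ) (z : α →₀ ℝ) : nrm (r • z) = |r| * nrm z := by
  rw [nrm_eq (Finsupp.support_smul), nrm, Finset.mul_sum]
  exact Finset.sum_congr rfl fun a _ => by rw [Finsupp.smul_apply, smul_eq_mul, abs_mul]
theorem nrm_add {α : Type} (z w : α →₀ ℝ) : nrm (z + w) ≤ nrm z + nrm w := by
  classical
  rw [nrm_eq (Finsupp.support_add), nrm_eq (z := z) Finset.subset_union_left,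
    nrm_eq (z := w) Finset.subset_union_right, ← Finset.sum_add_distrib]
  exact Finset.sum_le_sum fun a _ => abs_add_le _ _
theorem nrm_map {α β : Type} (L : (α →₀ ℝ) →ₗ[ℝ] (β →₀ ℝ)) (z : α →₀ ℝ)
    (h : ∀ a ∈ z.support, nrm (L (Finsupp.single a 1)) ≤ 1) : nrm (L z) ≤ nrm z := by
  have key : ∀ s : Finset α, (∀ a ∈ s, nrm (L (Finsupp.single a 1)) ≤ 1) →
      nrm (L (∑ a ∈ s, z a • Finsupp.single a 1)) ≤ ∑ a ∈ s, |z a| := fun s hs => by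
    classical
    induction s using Finset.induction_on with
    | empty => simp [nrm]
    | insert a s ha ih =>
      rw [Finset.sum_insert ha, Finset.sum_insert ha, map_add, map_smul]
      refine (nrm_add _ _).trans (add_le_add ?_ (ih fun b hb => hs b (Finset.mem_insert_of_mem hb)))
      rw [nrm_smul]
      exact mul_le_of_le_one_right (abs_nonneg _) (hs a (Finset.mem_insert_self _ _))
  have := key z.support h
  have e : ∑ a ∈ z.support, z a • Finsupp.single a (1 : ℝ) = z := by
    conv_rhs => rw [← z.sum_single]
    exact Finset.sum_congr rfl fun a _ => by rw [Finsupp.smul_single, smul_eq_mul, mul_one]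
  rwa [e] at this
theorem nrm_pf {k : ℕ} (f : C(X, Y)) (z : SChain ℝ k X) : nrm (pf f z) ≤ nrm z :=
  nrm_map _ _ fun σ _ => by rw [pf_single, nrm_single, abs_one]
theorem relNorm_e {k : ℕ} (z : SChain ℝ k X) : relNorm ∅ z = nrm z := by
  refine Finset.sum_congr (Finset.ext fun σ => (@Finset.mem_filter _ _ (fun _ => Classical.dec _) _ _).trans ?_) fun _ _ => rfl
  exact ⟨fun h => h.1, fun h => ⟨h, fun h => h ⟨vertexPt 0, rfl⟩⟩⟩
theorem relNorm_ge {k : ℕ} {A : Set X} {z : SChain ℝ k X} {s : Finset (SingSimplex k X)}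
    (h : ∀ σ ∈ s, z σ ≠ 0 ∧ ¬ Set.range σ ⊆ A) : ∑ σ ∈ s, |z σ| ≤ relNorm A z :=
  Finset.sum_le_sum_of_subset_of_nonneg (f := fun σ => ‖z σ‖)
    (fun σ hσ => (@Finset.mem_filter _ _ (fun _ => Classical.dec _) _ _).2 ⟨Finsupp.mem_support_iff.2 (h σ hσ).1, (h σ hσ).2⟩)
    fun _ _ _ => norm_nonneg _
def fil {k : ℕ} (P : SingSimplex k X → Prop) : SChain ℝ k X →ₗ[ℝ] SChain ℝ k X :=
  open Classical in
  { toFun := Finsupp.filter P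
    map_add' := fun _ _ => Finsupp.filter_add
    map_smul' := fun _ _ => Finsupp.filter_smul }
open Classical in
theorem fil_single {k : ℕ} (P : SingSimplex k X → Prop) (σ : SingSimplex k X) (r : ℝ) :
    fil P (Finsupp.single σ r) = if P σ then Finsupp.single σ r else 0 := by
  change Finsupp.filter P _ = _
  split
  · exact Finsupp.filter_single_of_pos _ ‹_›
  · exact Finsupp.filter_single_of_neg _ ‹_›
open Classical in
theorem fil_ap {k : ℕ} (P : SingSimplex k X → Prop) (z : SChain ℝ k X) (σ : SingSimplex k X) :
    fil P z σ = if P σ then z σ else 0 := Finsupp.filter_apply _ _ _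
theorem fil_supp {k : ℕ} {P : SingSimplex k X → Prop} {z : SChain ℝ k X} {σ : SingSimplex k X}
    (h : σ ∈ (fil P z).support) : z σ ≠ 0 ∧ P σ ∧ fil P z σ = z σ := by
  rw [Finsupp.mem_support_iff, fil_ap] at h
  rw [fil_ap]
  split at h <;> simp_all
theorem supported_le {α : Type} {P : α → Prop} {p : Submodule ℝ (α →₀ ℝ)}
    (h : ∀ a, P a → Finsupp.single a (1 : ℝ) ∈ p) : Finsupp.supported ℝ ℝ {a | P a} ≤ p := by
  rw [Finsupp.supported_eq_span_single, Submodule.span_le]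
  rintro _ ⟨a, ha, rfl⟩
  exact h a ha
theorem core {A : Set X} (hA : Good A) {m : ℕ} {z : SChain ℝ (m + 2) X} (hz : z ∈ Cy ℝ (m + 1) A) :
    ∃ β ∈ suppOn ℝ (m + 1) A, nrm β ≤ relNorm A z ∧ ∃ w ∈ suppOn ℝ (m + 2) A,
      β = sbdry ℝ z - sbdry ℝ w := by
  classical
  let SE (k : ℕ) : Submodule ℝ (SChain ℝ k X) := Finsupp.supported ℝ ℝ {σ | ES A σ}
  let Tl (k : ℕ) : SChain ℝ k X →ₗ[ℝ] SChain ℝ k X := Finsupp.lmapDomain ℝ ℝ (TT A k)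
  have Tls : ∀ k σ r, Tl k (Finsupp.single σ r) = Finsupp.single (TT A k σ) r := fun k σ r => by
    simp [Tl]
  have AE : ∀ k, suppOn ℝ k A ≤ SE k := fun k => supp_le fun σ hσ =>
    Finsupp.single_mem_supported ℝ _ (ES_of (by rintro _ ⟨x, rfl⟩; exact hσ x))
  have TA : ∀ k, SE (k + 1) ≤ (suppOn ℝ (k + 1) A).comap (Tl (k + 1)) := fun k => supported_le fun σ hσ => by
    rw [Submodule.mem_comap, Tls]
    exact single_mem (fun x => (TT_spec hA k σ hσ).1 ⟨x, rfl⟩) _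
  have Tfix : ∀ k, suppOn ℝ (k + 1) A ≤ LinearMap.eqLocus (Tl (k + 1)) .id := fun k => supp_le fun σ hσ => by
    have h : Set.range σ ⊆ A := by rintro _ ⟨x, rfl⟩; exact hσ x
    rw [LinearMap.mem_eqLocus, Tls, (TT_spec hA k σ (ES_of h)).2.2.1 h]; rfl
  have Tb : ∀ k, SE (k + 1) ≤ LinearMap.eqLocus (Tl k ∘ₗ sbdry ℝ) (sbdry ℝ ∘ₗ Tl (k + 1)) :=
    fun k => supported_le fun σ hσ => by
      rw [LinearMap.mem_eqLocus, LinearMap.comp_apply, LinearMap.comp_apply, Tls, sb_single, sb_single, map_sum]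
      exact Finset.sum_congr rfl fun i _ => by rw [map_zsmul, Tls, (TT_spec hA k σ hσ).2.1 i]
  have bE : ∀ k, SE (k + 1) ≤ (SE k).comap (sbdry ℝ) := fun k => supported_le fun σ hσ => by
    rw [Submodule.mem_comap, sb_single]
    exact Submodule.sum_mem _ fun i _ => zsmul_mem (Finsupp.single_mem_supported ℝ _ (hσ.fm i)) _
  set zE := fil (fun σ => ES A σ) z with hzE
  set z' := fil (fun σ => ¬ ES A σ) z with hz'
  have hsum : zE + z' = z := by
    ext σ
    rw [Finsupp.add_apply, fil_ap, fil_ap]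
    by_cases h : ES A σ <;> simp [h]
  have h1 : zE ∈ SE (m + 2) := by
    rw [Finsupp.mem_supported]
    intro σ hσ
    exact (fil_supp hσ).2.1
  have h2 : sbdry ℝ z' ∈ SE (m + 1) := by
    rw [eq_sub_of_add_eq' hsum, map_sub]
    exact sub_mem (AE _ (mem_Cy.1 hz)) (bE _ h1)
  have h2' : fil (fun σ => ES A σ) (sbdry ℝ z') = sbdry ℝ z' := by
    refine Finsupp.filter_eq_self_iff _ _ |>.2 fun σ hσ => ?_
    exact (Finsupp.mem_supported _ _).1 h2 (Finsupp.mem_support_iff.2 hσ)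
  refine ⟨Tl _ (sbdry ℝ z'), TA _ h2, ?_, Tl _ zE, TA _ h1, ?_⟩
  · calc nrm (Tl _ (sbdry ℝ z')) ≤ nrm (sbdry ℝ z') := nrm_map _ _ fun σ _ => by
          rw [Tls, nrm_single, abs_one]
      _ ≤ nrm z' := by
          have := nrm_map (fil (fun σ => ES A σ) ∘ₗ sbdry ℝ) z' fun σ hσ => ?_
          · rwa [LinearMap.comp_apply, h2'] at this
          have hσ : ¬ ES A σ := (fil_supp hσ).2.1
          rw [LinearMap.comp_apply, sb_single, map_sum]
          by_cases h : ∃ i, ES A (σ.comp (faceMap i))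
          · obtain ⟨i, hi⟩ := h
            rw [Finset.sum_eq_single i]
            · rw [map_zsmul, fil_single, if_pos hi, ← Int.cast_smul_eq_zsmul ℝ, nrm_smul, nrm_single]
              simp
            · intro j _ hj
              rw [map_zsmul, fil_single, if_neg fun h => hσ (ES_two hj h hi), smul_zero]
            · simp
          · push Not at h
            rw [Finset.sum_eq_zero fun i _ => by rw [map_zsmul, fil_single, if_neg (h i), smul_zero]]
            simp [nrm]
      _ ≤ relNorm A z := by
          rw [nrm, Finset.sum_congr rfl fun σ hσ => by rw [(fil_supp hσ).2.2]]
          exact relNorm_ge fun σ hσ => ⟨(fil_supp hσ).1, fun h => (fil_supp hσ).2.1 (ES_of h)⟩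
  · have h3 : Tl _ (sbdry ℝ zE) = sbdry ℝ (Tl _ zE) := Tb _ h1
    have h4 : Tl _ (sbdry ℝ z) = sbdry ℝ z := Tfix _ (mem_Cy.1 hz)
    rw [eq_sub_of_add_eq' hsum, map_sub, map_sub, h3, h4]
end SV
namespace SV
variable {X Y B : Type} [TopologicalSpace X] [TopologicalSpace Y] [TopologicalSpace B]
def ir {n : ℕ} : SChain ℤ n X →+ SChain ℝ n X := Finsupp.mapRange.addMonoidHom (Int.castAddHom ℝ)
theorem ir_single {n : ℕ} (σ : SingSimplex n X) (k : ℤ) :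
    ir (Finsupp.single σ k) = Finsupp.single σ (k : ℝ) := by
  simp [ir]
theorem ir_sb {n : ℕ} (c : SChain ℤ (n + 1) X) : sbdry ℝ (ir c) = ir (sbdry ℤ c) := by
  induction c using Finsupp.induction_linear with
  | zero => simp
  | add f g hf hg => simp [hf, hg]
  | single σ r => simp only [ir_single, sb_single, map_sum, map_zsmul]
theorem ir_pf {n : ℕ} (f : C(X, Y)) (c : SChain ℤ n X) : pf f (ir c) = ir (pf f c) := by
  induction c using Finsupp.induction_linear with
  | zero => simp
  | add f g hf hg => simp [hf, hg]
  | single σ r => simp only [ir_single, pf_single]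
theorem ir_supp {n : ℕ} {A : Set X} {c : SChain ℤ n X} (h : c ∈ suppOn ℤ n A) : ir c ∈ suppOn ℝ n A :=
  mem_supp.2 fun σ hσ => mem_supp.1 h σ (Finsupp.support_mapRange (hf := Int.cast_zero) hσ)
theorem ir_Bd {n : ℕ} {A : Set X} {c : SChain ℤ n X} (h : c ∈ Bd ℤ n A) : ir c ∈ Bd ℝ n A := by
  obtain ⟨w, hw⟩ := mem_Bd.1 h
  exact mem_Bd.2 ⟨ir w, by rw [ir_sb, ← map_sub]; exact ir_supp hw⟩
structure Pc (j : C(B, Y)) (A : Set Y) : Prop where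
  emb : Topology.IsEmbedding j
  sub : ∀ b, j b ∈ A
  sep : ∀ (n : ℕ) (σ : SingSimplex n Y), (∀ x, σ x ∈ A) →
    (∀ x, σ x ∈ Set.range j) ∨ ∀ x, σ x ∉ Set.range j
theorem emb_lift {j : C(B, Y)} (hj : Topology.IsEmbedding j) {n : ℕ} {σ : SingSimplex n Y}
    (h : ∀ x, σ x ∈ Set.range j) : ∃ τ : SingSimplex n B, σ = j.comp τ := by
  choose f hf using h
  exact ⟨⟨f, hj.continuous_iff.2 (by rw [show j ∘ f = σ from funext hf]; exact σ.continuous)⟩,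
    ContinuousMap.ext fun x => (hf x).symm⟩
theorem sep_clopen {S : Set X} (h : IsClopen S) {n : ℕ} (σ : SingSimplex n X) :
    (∀ x, σ x ∈ S) ∨ ∀ x, σ x ∉ S := by
  rcases isClopen_iff.1 (h.preimage σ.continuous) with h | h
  · exact .inr fun x hx => Set.eq_empty_iff_forall_notMem.1 h x hx
  · exact .inl fun x => h.ge (Set.mem_univ x)
theorem Pc.comp {j : C(B, Y)} {A : Set Y} (h : Pc j A) {S : Set B} (hS : IsClopen S) :
    Pc (j.comp (vl S)) A where
  emb := h.emb.comp Topology.IsEmbedding.subtypeVal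
  sub _ := h.sub _
  sep n σ hσ := by
    rcases h.sep n σ hσ with h1 | h1
    · obtain ⟨τ, rfl⟩ := emb_lift h.emb h1
      refine (sep_clopen hS τ).imp (fun h2 x => ⟨⟨_, h2 x⟩, rfl⟩) fun h2 x hx => ?_
      obtain ⟨s, hs⟩ := hx
      exact h2 x (by rw [← h.emb.injective hs]; exact s.2)
    · exact .inr fun x ⟨s, hs⟩ => h1 x ⟨_, hs⟩
theorem Pc.vl {S : Set X} (hS : IsClopen S) : Pc (vl S) Set.univ where
  emb := Topology.IsEmbedding.subtypeVal
  sub _ := trivial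
  sep n σ _ := by
    rw [show Set.range (SV.vl S) = S from Subtype.range_coe]
    exact sep_clopen hS σ
theorem comp_inj {j : C(B, Y)} (hj : Function.Injective j) (n : ℕ) :
    Function.Injective fun σ : SingSimplex n B => j.comp σ := fun σ τ h =>
  ContinuousMap.ext fun x => hj (DFunLike.congr_fun h x)
section
variable {R : Type} [CommRing R] {j : C(B, Y)} {A : Set Y}
def rs (h : Topology.IsEmbedding j) {n : ℕ} : SChain R n Y →ₗ[R] SChain R n B :=
  Finsupp.lcomapDomain (fun σ : SingSimplex n B => j.comp σ) (comp_inj h.injective n)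
theorem rs_ap (h : Topology.IsEmbedding j) {n : ℕ} (z : SChain R n Y) (σ : SingSimplex n B) :
    rs h z σ = z (j.comp σ) := rfl
theorem rs_pf (h : Topology.IsEmbedding j) {n : ℕ} (z : SChain R n B) : rs h (pf j z) = z :=
  Finsupp.ext fun σ => (rs_ap h _ σ).trans (Finsupp.mapDomain_apply (comp_inj h.injective n) z σ)
theorem rs_out (h : Topology.IsEmbedding j) {n : ℕ} {σ : SingSimplex n Y} (hσ : ∀ x, σ x ∉ Set.range j)
    (r : R) : rs h (Finsupp.single σ r) = 0 := by
  classical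
  refine Finsupp.ext fun τ => ?_
  rw [rs_ap, Finsupp.single_apply, if_neg]; · rfl
  rintro rfl
  exact hσ (vertexPt 0) ⟨_, rfl⟩
theorem rs_supp (h : Topology.IsEmbedding j) {n : ℕ} {T : Set Y} {z : SChain R n Y} (hz : z ∈ suppOn R n T) :
    rs h z ∈ suppOn R n (j ⁻¹' T) := mem_supp.2 fun σ hσ x =>
  mem_supp.1 hz (j.comp σ) (Finsupp.mem_support_iff.2 fun e => Finsupp.mem_support_iff.1 hσ e) x
theorem Pc.dec (h : Pc j A) {n : ℕ} {z : SChain R n Y} (hz : z ∈ suppOn R n A) :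
    z - pf j (rs h.emb z) ∈ suppOn R n (A \ Set.range j) := by
  suffices suppOn R n A ≤ (suppOn R n (A \ Set.range j)).comap (.id - pf j ∘ₗ rs h.emb) from this hz
  refine supp_le fun σ hσ => ?_
  rw [Submodule.mem_comap, LinearMap.sub_apply, LinearMap.comp_apply]
  rcases h.sep n σ hσ with h1 | h1
  · obtain ⟨τ, rfl⟩ := emb_lift h.emb h1
    rw [← pf_single, rs_pf, LinearMap.id_apply, sub_self]
    exact zero_mem _
  · rw [rs_out _ h1, map_zero, sub_zero]
    exact single_mem (σ := σ) (fun x => And.intro (hσ x) (h1 x)) _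
theorem Pc.rs_sb (h : Pc j A) {n : ℕ} {z : SChain R (n + 1) Y} (hz : z ∈ suppOn R (n + 1) A) :
    rs h.emb (sbdry R z) = sbdry R (rs h.emb z) := by
  suffices suppOn R (n + 1) A ≤ LinearMap.eqLocus (rs h.emb ∘ₗ sbdry R) (sbdry R ∘ₗ rs h.emb) from this hz
  refine supp_le fun σ hσ => ?_
  rw [LinearMap.mem_eqLocus, LinearMap.comp_apply, LinearMap.comp_apply]
  rcases h.sep _ σ hσ with h1 | h1
  · obtain ⟨τ, rfl⟩ := emb_lift h.emb h1
    rw [← pf_single, rs_pf, sb_pf, rs_pf]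
  · rw [rs_out _ h1, map_zero, sb_single, map_sum]
    exact Finset.sum_eq_zero fun i _ => by
      rw [map_zsmul, rs_out _ fun x => h1 (faceMap i x), smul_zero]
theorem Pc.rs_Bd (h : Pc j Set.univ) {n : ℕ} {T : Set Y} {z : SChain R n Y} (hz : z ∈ Bd R n T) :
    rs h.emb z ∈ Bd R n (j ⁻¹' T) := by
  obtain ⟨w, hw⟩ := mem_Bd.1 hz
  exact mem_Bd.2 ⟨rs h.emb w, by rw [← h.rs_sb (supp_univ w), ← map_sub]; exact rs_supp _ hw⟩
end
theorem rs_ir {j : C(B, Y)} (h : Topology.IsEmbedding j) {n : ℕ} (z : SChain ℤ n Y) :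
    rs h (ir z) = ir (rs h z) := Finsupp.ext fun _ => rfl
theorem nrm_rs {ι : Type} (s : Finset ι) {D : ι → Type} [∀ d, TopologicalSpace (D d)]
    (j : ∀ d, C(D d, Y)) (hj : ∀ d, Topology.IsEmbedding (j d))
    (hd : ∀ d d' x x', j d x = j d' x' → d = d') {n : ℕ} (z : SChain ℝ n Y) :
    ∑ d ∈ s, nrm (rs (hj d) z) ≤ nrm z := by
  classical
  have e : ∀ d, nrm (rs (hj d) z) =
      ∑ σ ∈ (rs (hj d) z).support.image fun τ => (j d).comp τ, |z σ| := fun d => by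
    rw [Finset.sum_image (comp_inj (hj d).injective n).injOn]; rfl
  rw [Finset.sum_congr rfl fun d _ => e d, ← Finset.sum_biUnion]
  · refine Finset.sum_le_sum_of_subset_of_nonneg ?_ fun _ _ _ => abs_nonneg _
    intro σ hσ
    obtain ⟨d, -, h⟩ := Finset.mem_biUnion.1 hσ
    obtain ⟨τ, h', rfl⟩ := Finset.mem_image.1 h
    exact Finsupp.mem_support_iff.2 fun e => Finsupp.mem_support_iff.1 h' e
  · intro d _ d' _ hne
    refine Finset.disjoint_left.2 fun σ h1 h2 => hne ?_
    obtain ⟨τ, -, rfl⟩ := Finset.mem_image.1 h1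
    obtain ⟨τ', -, h⟩ := Finset.mem_image.1 h2
    exact (hd _ _ _ _ (DFunLike.congr_fun h (vertexPt 0))).symm
theorem bound {m : ℕ} (hO : HomOrientable (m + 1) B ∅) {w : SChain ℤ (m + 1) B} (hw : w ∈ Cy ℤ m ∅)
    (hw' : w ∉ Bd ℤ (m + 1) ∅) {β : SChain ℝ (m + 1) B} (hb : β - ir w ∈ Bd ℝ (m + 1) ∅) :
    simVolOr (m + 1) B ∅ ≤ nrm β := by
  obtain ⟨b, hb1, -⟩ := hO
  obtain ⟨k, hk⟩ := hb1.2 w hw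
  have hk' : w - k • b ∈ Bd ℤ (m + 1) ∅ := mem_Bd.2 hk
  have k0 : k ≠ 0 := by
    rintro rfl
    exact hw' (by simpa using hk')
  have k1 : (k : ℝ) ≠ 0 := by exact_mod_cast k0
  have h1 : β - (k : ℝ) • ir b ∈ Bd ℝ (m + 1) ∅ := by
    have := add_mem hb (ir_Bd hk')
    rw [map_sub, map_zsmul, ← Int.cast_smul_eq_zsmul ℝ] at this
    convert this using 1; abel
  have h2 := Submodule.smul_mem _ (k : ℝ)⁻¹ h1
  rw [smul_sub, inv_smul_smul₀ k1] at h2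
  have key : simVolOr (m + 1) B ∅ ≤ relNorm ∅ ((k : ℝ)⁻¹ • β) := by
    refine csInf_le ⟨0, ?_⟩ ⟨_, ⟨b, hb1, mem_Bd.1 h2⟩, rfl⟩
    rintro _ ⟨z, -, rfl⟩
    rw [relNorm_e]; exact nrm_nn z
  refine key.trans ?_
  · rw [relNorm_e, nrm_smul]
    refine mul_le_of_le_one_left (nrm_nn _) ?_
    rw [abs_inv]
    refine inv_le_one_of_one_le₀ ?_
    exact_mod_cast Int.one_le_abs k0
structure Dat (m : ℕ) (Y : Type) [TopologicalSpace Y] (A : Set Y) (c : SChain ℤ (m + 2) Y)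
    (β : SChain ℝ (m + 1) Y) : Prop where
  pr : Pair (m + 1) Y A
  vp : VP (m + 1) Y A
  cy : c ∈ Cy ℤ (m + 1) A
  nb : c ∉ Bd ℤ (m + 2) A
  bA : β ∈ suppOn ℝ (m + 1) A
  hm : ∃ a ∈ suppOn ℝ (m + 2) A, β - ir (sbdry ℤ c) = sbdry ℝ a
section
variable {m : ℕ} {A : Set Y} {c : SChain ℤ (m + 2) Y} {β : SChain ℝ (m + 1) Y} {j : C(B, Y)}
theorem Dat.cyc (h : Dat m Y A c β) (hj : Pc j A) : rs hj.emb (sbdry ℤ c) ∈ Cy ℤ m ∅ := by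
  rw [mem_Cy, ← hj.rs_sb h.cy, sb_sb, map_zero]; exact zero_mem _
theorem Dat.ne (h : Dat m Y A c β) (hj : Pc j A) [hB : Nonempty B] :
    rs hj.emb (sbdry ℤ c) ∉ Bd ℤ (m + 1) ∅ := by
  intro hb
  obtain ⟨w, hw⟩ := mem_Bd.1 hb
  obtain ⟨b⟩ := hB
  refine bdry_ne h.pr h.vp h.cy h.nb one_ne_zero (w := pf j w)
    (supp_pf (A := Set.univ) (fun x _ => hj.sub x) (supp_univ w)) (A1 := A \ Set.range j) Set.sdiff_subset
    (hj.sub b) (fun h => h.2 ⟨b, rfl⟩) ?_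
  rw [one_smul, sb_pf]
  have e := add_mem (hj.dec h.cy) (supp_pf (f := j) (B := A \ Set.range j) (fun _ h => h.elim) hw)
  rw [map_sub] at e
  convert e using 1; abel
theorem Dat.hom (h : Dat m Y A c β) (hj : Pc j A) :
    rs hj.emb β - ir (rs hj.emb (sbdry ℤ c)) ∈ Bd ℝ (m + 1) ∅ := by
  obtain ⟨a, ha, e⟩ := h.hm
  rw [← rs_ir, ← map_sub, e, hj.rs_sb ha]
  exact sb_Bd _
theorem Dat.ho (h : Dat m Y A c β) (hj : Pc j A) [Nonempty B] (hp : Pair m B ∅) (hv : VP m B ∅) :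
    HomOrientable (m + 1) B ∅ := hp.HO hv (h.cyc hj) (h.ne hj)
theorem Dat.le (h : Dat m Y A c β) (hj : Pc j A) [Nonempty B] (hO : HomOrientable (m + 1) B ∅) :
    simVolOr (m + 1) B ∅ ≤ nrm (rs hj.emb β) := bound hO (h.cyc hj) (h.ne hj) (h.hom hj)
end
end SV
namespace SV
variable {X Y B D : Type} [TopologicalSpace X] [TopologicalSpace Y] [TopologicalSpace B] [TopologicalSpace D]
def LC (X : Type) [TopologicalSpace X] : Prop := ∀ x : X, ∃ C ∈ nhds x, IsPreconnected C
theorem LC.op (h : LC X) (x : X) : IsClopen (connectedComponent x) := by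
  refine ⟨isClosed_connectedComponent, isOpen_iff_mem_nhds.2 fun y hy => ?_⟩
  obtain ⟨C, hC, hp⟩ := h y
  rw [connectedComponent_eq hy]
  exact Filter.mem_of_superset hC (hp.subset_connectedComponent (mem_of_mem_nhds hC))
theorem LE.lc {d : ℕ} (h : LE d X) : LC X := fun x => by
  obtain ⟨e, he, rfl⟩ := h x
  exact ⟨Set.range e, he.isOpen_range.mem_nhds ⟨0, rfl⟩, isPreconnected_range e.continuous⟩
theorem LC.wt {A : Set X} (h : LC (Wt A)) : LC X := fun x => by
  obtain ⟨C, hC, hp⟩ := h (wi A x)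
  exact ⟨wr A '' C, Filter.mem_of_superset ((wi A).continuous.continuousAt.preimage_mem_nhds hC)
    fun y hy => ⟨_, hy, rfl⟩, hp.image _ (wr A).continuous.continuousOn⟩
theorem Pair.lc {n : ℕ} {A : Set X} (h : Pair n X A) : LC X := h.le.lc.wt
theorem Pair.clopen {n : ℕ} {A : Set X} (h : Pair n X A) {S : Set X} (hS : IsClopen S) :
    Pair n S (vl S ⁻¹' A) := by
  have := h.t2
  have := h.cpt
  exact ⟨inferInstance, isCompact_iff_compactSpace.1 hS.1.isCompact,
    h.le.pull (wp_lh (f := vl S) hS.2.isOpenEmbedding_subtypeVal.isLocalHomeomorph A)⟩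
theorem supp_empty {R : Type} [CommRing R] {n : ℕ} {z : SChain R n X} (h : z ∈ suppOn R n (∅ : Set X)) :
    z = 0 := by
  by_contra hz
  obtain ⟨σ, hσ⟩ := Finsupp.support_nonempty_iff.2 hz
  exact mem_supp.1 h σ hσ (vertexPt 0)
section
variable {m : ℕ} {A : Set Y} {c : SChain ℤ (m + 2) Y} {β : SChain ℝ (m + 1) Y} {j : C(B, Y)}
theorem rs_vl {R : Type} [CommRing R] {n : ℕ} {S : Set B} (hj : Pc j A) (hS : IsClopen S)
    (z : SChain R n Y) : rs (hj.comp hS).emb z = rs (Pc.vl hS).emb (rs hj.emb z) := Finsupp.ext fun _ => rfl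
theorem Dat.nv (h : Dat m Y A c β) (hj : Pc j A) (hp : Pair m B ∅) (y : B) :
    rs hj.emb (sbdry ℤ c) ∉ Bd ℤ (m + 1) {y}ᶜ := by
  intro hb
  have hS := hp.lc.op y
  have := isPreconnected_iff_preconnectedSpace.1 (isPreconnected_connectedComponent (x := y))
  have : Nonempty (connectedComponent y) := ⟨⟨y, mem_connectedComponent⟩⟩
  have hp' := hp.clopen hS
  rw [Set.preimage_empty] at hp'
  have h1 := (Pc.vl hS).rs_Bd hb
  rw [← rs_vl hj hS] at h1
  refine hp'.nv hp'.vp (h.cyc (hj.comp hS)) (h.ne (hj.comp hS)) ⟨y, mem_connectedComponent⟩ (Bd_mono ?_ h1)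
  exact fun z hz e => hz (congrArg Subtype.val e)
theorem Dat.half (h : Dat m Y A c β) (hj : Pc j A) (hp : Pair m B ∅) {f : C(B, D)} (hf : DC f)
    (hD : Pair m D ∅) (hO : HomOrientable (m + 1) D ∅) {S : Set B} (hS : IsClopen S)
    (hi : Set.InjOn f S) {y : B} (hy : y ∈ S) :
    simVolOr (m + 1) D ∅ ≤ nrm (rs (Pc.vl hS).emb (rs hj.emb β)) := by
  have := hp.t2
  have := hD.t2
  set u := rs hj.emb (sbdry ℤ c)
  have hu : u - pf (vl S) (rs (Pc.vl hS).emb u) ∈ suppOn ℤ (m + 1) {y}ᶜ :=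
    supp_mono (fun z hz e => hz.2 ⟨⟨y, hy⟩, e.symm⟩) ((Pc.vl hS).dec (supp_univ u))
  have h1 : pf (vl S) (rs (Pc.vl hS).emb u) ∉ Bd ℤ (m + 1) {y}ᶜ := fun h1 => h.nv hj hp y (by
    have := add_mem (supp_Bd hu) h1
    rwa [sub_add_cancel] at this)
  have h2 : pf (f.comp (vl S)) (rs (Pc.vl hS).emb u) ∉ Bd ℤ (m + 1) {f y}ᶜ := by
    rw [← pf_pf, lh_iff hf.lh hS.2 hi hy (supp_pf (A := Set.univ) (fun x _ => x.2) (supp_univ _))]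
    exact h1
  have e := h.cyc (hj.comp hS)
  rw [rs_vl hj hS] at e
  refine (bound hO (pf_Cy (f := f.comp (vl S)) (A := ∅) (fun _ h => h.elim) e)
    (fun h3 => h2 (Bd_mono (Set.empty_subset _) h3)) (β := pf (f.comp (vl S)) (rs (Pc.vl hS).emb (rs hj.emb β))) ?_).trans
      (nrm_pf _ _)
  rw [← ir_pf, ← map_sub]
  refine pf_Bd (A := ∅) (fun _ h => h.elim) ?_
  have := h.hom (hj.comp hS)
  rwa [rs_vl hj hS, rs_vl hj hS] at this
theorem Dat.twice (h : Dat m Y A c β) (hj : Pc j A) (hp : Pair m B ∅) {f : C(B, D)} (hf : DC f)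
    [ConnectedSpace D] (hD : Pair m D ∅) (hO : HomOrientable (m + 1) D ∅)
    (hb : pf f (rs hj.emb (sbdry ℤ c)) ∈ Bd ℤ (m + 1) ∅) :
    2 * simVolOr (m + 1) D ∅ ≤ nrm (rs hj.emb β) := by
  have := hp.t2
  have := hD.t2
  obtain ⟨v, hv⟩ := hD.cg hD.vp hO
  obtain ⟨S, o1, o2, i1, i2⟩ := sign_split hf hv (fun y => Cy_mono (Set.empty_subset _) (h.cyc hj))
    (fun x => Bd_mono (Set.empty_subset _) hb) (h.nv hj hp)
  have hS : IsClopen S := ⟨⟨o2⟩, o1⟩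
  obtain ⟨x⟩ : Nonempty D := inferInstance
  obtain ⟨y1, y2, hne, e1, e2, -⟩ := hf.two x
  have hx : (∃ y, y ∈ S) ∧ ∃ y, y ∈ Sᶜ := by
    by_cases h1 : y1 ∈ S <;> by_cases h2 : y2 ∈ S
    · exact absurd (i1 h1 h2 (e1.trans e2.symm)) hne
    · exact ⟨⟨_, h1⟩, _, h2⟩
    · exact ⟨⟨_, h2⟩, _, h1⟩
    · exact absurd (i2 h1 h2 (e1.trans e2.symm)) hne
  obtain ⟨⟨a, ha⟩, b, hb⟩ := hx
  have k1 := h.half hj hp hf hD hO hS i1 ha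
  have k2 := h.half hj hp hf hD hO hS.compl i2 hb
  have k3 := nrm_rs (Finset.univ : Finset Bool) (D := fun t => ↥(cond t S Sᶜ)) (fun t => vl (cond t S Sᶜ))
    (fun _ => Topology.IsEmbedding.subtypeVal) (fun t t' x x' e => by
      have hx := x.2
      have hx' := x'.2
      rw [show (x : B) = x' from e] at hx
      cases t <;> cases t' <;> first | rfl | exact absurd hx' hx | exact absurd hx hx') (rs hj.emb β)
  rw [Fintype.sum_bool] at k3
  change nrm (rs (Pc.vl hS).emb (rs hj.emb β)) + nrm (rs (Pc.vl hS.compl).emb (rs hj.emb β)) ≤ _ at k3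
  linarith
end
theorem dcov {p : Y → X} (hp : IsDoubleCover p) {j : C(D, X)} (hj : Topology.IsEmbedding j) :
    ∃ f : ↥(p ⁻¹' Set.range j) → D, IsDoubleCover f ∧ ∀ y, j (f y) = p y := by
  have e : ∀ y, j (hj.toHomeomorph.symm ((Set.range j).restrictPreimage p y)) = p y := fun y =>
    congrArg Subtype.val (hj.toHomeomorph.apply_symm_apply _)
  refine ⟨hj.toHomeomorph.symm ∘ (Set.range j).restrictPreimage p,
    ⟨(hp.1.restrictPreimage _).homeomorph_comp _, fun x => ?_⟩, e⟩
  rw [← hp.2 (j x)]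
  exact Nat.card_congr ⟨fun y => ⟨y.1.1, (e y.1).symm.trans (congrArg j y.2)⟩,
    fun y => ⟨⟨y.1, x, y.2.symm⟩, hj.injective ((e _).trans y.2)⟩, fun _ => rfl, fun _ => rfl⟩
theorem Pc.cov {p : C(Y, X)} {A : Set X} {j : C(D, X)} (hj : Pc j A) :
    Pc (SV.vl (p ⁻¹' Set.range j)) (p ⁻¹' A) where
  emb := Topology.IsEmbedding.subtypeVal
  sub b := by obtain ⟨x, hx⟩ := b.2; exact Set.mem_preimage.2 (hx ▸ hj.sub x)
  sep n σ hσ := by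
    rw [show Set.range (SV.vl (p ⁻¹' Set.range j)) = _ from Subtype.range_coe]
    exact hj.sep n (p.comp σ) hσ
theorem rs_push {R : Type} [CommRing R] {n : ℕ} {p : C(Y, X)} {A : Set X} {j : C(D, X)} (hj : Pc j A)
    {f : C(p ⁻¹' Set.range j, D)} (hf : ∀ y, j (f y) = p y) {z : SChain R n Y} (hz : z ∈ suppOn R n (p ⁻¹' A)) :
    rs hj.emb (pf p z) = pf f (rs (hj.cov (p := p)).emb z) := by
  have h1 := supp_pf (f := p) (B := A \ Set.range j) (fun y hy => ⟨hy.1, fun h => hy.2 ⟨⟨y, h⟩, rfl⟩⟩)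
    ((hj.cov (p := p)).dec hz)
  have h2 := supp_empty (supp_mono (fun x hx => hx.2 ⟨x, rfl⟩) (rs_supp hj.emb h1))
  rw [map_sub, map_sub, sub_eq_zero, pf_pf, show p.comp (vl (p ⁻¹' Set.range j)) = j.comp f from
    ContinuousMap.ext fun y => (hf y).symm, ← pf_pf, rs_pf] at h2
  exact h2
end SV
namespace SV
variable {X Y : Type} [TopologicalSpace X] [TopologicalSpace Y]
theorem mkDat {m : ℕ} {A : Set Y} (hp : Pair (m + 1) Y A) (hv : VP (m + 1) Y A) (hA : Good A)
    {c : SChain ℤ (m + 2) Y} (hc : c ∈ Cy ℤ (m + 1) A) (hn : c ∉ Bd ℤ (m + 2) A)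
    {z : SChain ℝ (m + 2) Y} (hz : RelHomologous ℝ (m + 2) A z (intToReal c)) :
    ∃ β, nrm β ≤ relNorm A z ∧ Dat m Y A c β := by
  obtain ⟨w, hw⟩ := hz
  change z - ir c - sbdry ℝ w ∈ _ at hw
  have e : sbdry ℝ z = ir (sbdry ℤ c) + sbdry ℝ (z - ir c - sbdry ℝ w) := by
    rw [map_sub, map_sub, sb_sb, ir_sb]; abel
  obtain ⟨β, hβ, h1, w', hw', h2⟩ := core hA (z := z) (by
    rw [mem_Cy, e]; exact add_mem (ir_supp hc) (supp_sb hw))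
  refine ⟨β, h1, hp, hv, hc, hn, hβ, _, sub_mem hw hw', ?_⟩
  rw [h2, map_sub (sbdry ℝ) _ w', e]; abel
theorem simVolConn_le {m : ℕ} {D : Type} [TopologicalSpace D] (hO : ¬ HomOrientable (m + 1) D ∅)
    {B : Type} [TopologicalSpace B] {p : B → D} (hp : IsDoubleCover p) (hB : HomOrientable (m + 1) B ∅) :
    2 * simVolConn (m + 1) D ∅ ≤ simVolOr (m + 1) B ∅ := by
  rw [simVolConn, if_neg hO, ← mul_assoc, mul_one_div_cancel two_ne_zero, one_mul]
  refine csInf_le ⟨0, ?_⟩ ⟨TopCat.of B, p, hp, hB, rfl⟩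
  rintro _ ⟨Y, p, -, -, rfl⟩
  refine Real.sInf_nonneg ?_
  rintro _ ⟨z, -, rfl⟩
  exact Finset.sum_nonneg fun _ _ => norm_nonneg _
theorem le_simVolOr {m : ℕ} {A : Set X} {r : ℝ} (hO : HomOrientable (m + 1) X A)
    (h : ∀ (c : SChain ℤ (m + 1) X) (z : SChain ℝ (m + 1) X), c ∈ Cy ℤ m A → c ∉ Bd ℤ (m + 1) A →
      RelHomologous ℝ (m + 1) A z (intToReal c) → r ≤ relNorm A z) : r ≤ simVolOr (m + 1) X A := by
  obtain ⟨c, hc, -⟩ := id hO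
  refine le_csInf ⟨_, intToReal c, ⟨c, hc, 0, by rw [sub_self, map_zero, sub_zero]; exact zero_mem _⟩, rfl⟩ ?_
  rintro _ ⟨z, ⟨c, hc, hz⟩, rfl⟩
  exact h c z hc.1 (fund_ne hO hc) hz
theorem per_comp {m : ℕ} {A : Set X} [ConnectedSpace X] (hp : Pair (m + 1) X A) (hA : Good A)
    {ι : Type} (s : Finset ι) {D : ι → Type} [∀ d, TopologicalSpace (D d)]
    (j : ∀ d, C(D d, X)) (hj : ∀ d, Pc (j d) A)
    (hd : ∀ d d' x x', j d x = j d' x' → d = d') [∀ d, ConnectedSpace (D d)]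
    (hD : ∀ d, Pair m (D d) ∅) :
    ∑ d ∈ s, simVolConn (m + 1) (D d) ∅ ≤ simVolConn (m + 2) X A := by
  by_cases hO : HomOrientable (m + 2) X A
  · rw [simVolConn, if_pos hO]
    refine le_simVolOr hO fun c z hc hn hz => ?_
    obtain ⟨β, h1, h⟩ := mkDat hp hp.vp hA hc hn hz
    refine le_trans (Finset.sum_le_sum fun d _ => ?_) ((nrm_rs s j (fun d => (hj d).emb) hd β).trans h1)
    have := h.ho (hj d) (hD d) (hD d).vp
    rw [simVolConn, if_pos this]
    exact h.le (hj d) this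
  · rw [simVolConn, if_neg hO]
    suffices h : 2 * ∑ d ∈ s, simVolConn (m + 1) (D d) ∅ ≤ sInf {r : ℝ | ∃ (Y : TopCat.{0}) (p : ↥Y → X), IsDoubleCover p ∧
        HomOrientable (m + 2) ↥Y (p ⁻¹' A) ∧ r = simVolOr (m + 2) ↥Y (p ⁻¹' A)} by linarith
    refine le_csInf ?_ ?_
    · obtain ⟨Y, p, h1, h2⟩ := hp.ocov hO
      exact ⟨_, Y, p, h1, h2, rfl⟩
    rintro _ ⟨Y, p, hpc, hY, rfl⟩
    have := hp.t2
    have := dc_t2 hpc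
    let P : C(Y, X) := ⟨p, hpc.1.continuous⟩
    have hP : DC P := dc_of hpc
    refine le_simVolOr hY fun c z hc hn hz => ?_
    obtain ⟨β, h1, h⟩ := mkDat (hp.pull hP) (hp.vp_cover hO hP) (hA.cover hpc.1) hc hn hz
    have hj' : ∀ d, Pc (vl (P ⁻¹' Set.range (j d))) (P ⁻¹' A) := fun d => (hj d).cov
    rw [Finset.mul_sum]
    refine le_trans (Finset.sum_le_sum fun d _ => ?_) ((nrm_rs s (fun d => vl (P ⁻¹' Set.range (j d)))
      (fun d => (hj' d).emb) (fun d d' x x' e => by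
        obtain ⟨a, ha⟩ := x.2
        obtain ⟨b, hb⟩ := x'.2
        exact hd _ _ a b (ha.trans ((congrArg P e).trans hb.symm))) β).trans h1)
    obtain ⟨f, hf, e⟩ := dcov hpc (hj d).emb
    have := (hD d).t2
    have hF : DC (⟨f, hf.1.continuous⟩ : C(_, D d)) := dc_of hf
    have hB := (hD d).pull hF
    rw [Set.preimage_empty] at hB
    by_cases hOd : HomOrientable (m + 1) (D d) ∅
    · rw [simVolConn, if_pos hOd]
      refine h.twice (hj' d) hB hF (hD d) hOd ?_
      have k := rs_push (p := P) (hj d) (f := ⟨f, hf.1.continuous⟩) e (mem_Cy.1 hc)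
      obtain ⟨w, hw⟩ := mem_Bd.1 (hp.N hp.vp hO (pf_Cy (f := P) (B := A) (fun _ h => h) hc))
      have e2 : pf P (sbdry ℤ c) = sbdry ℤ (pf P c - sbdry ℤ w) := by rw [map_sub, sb_sb, sub_zero, sb_pf]
      rw [e2, (hj d).rs_sb hw] at k
      exact k ▸ sb_Bd _
    · have hv := (hD d).vp_cover hOd hF
      rw [Set.preimage_empty] at hv
      obtain ⟨y, -⟩ := hF.two (Classical.arbitrary _)
      have : Nonempty ↥(P ⁻¹' Set.range (j d)) := ⟨y⟩
      have hO' := h.ho (hj' d) hB hv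
      exact (simVolConn_le hOd hf hO').trans (h.le (hj' d) hO')
end SV
namespace SV
variable {X Y : Type} [TopologicalSpace X] [TopologicalSpace Y]
theorem LC.comp (h : LC X) (c : ConnectedComponents X) : IsClopen {x : X | ConnectedComponents.mk x = c} := by
  obtain ⟨x, rfl⟩ := ConnectedComponents.surjective_coe c
  have e : {y : X | ConnectedComponents.mk y = ConnectedComponents.mk x} = connectedComponent x :=
    Set.ext fun y => ConnectedComponents.coe_eq_coe'
  rw [e]
  exact h.op x
theorem comp_conn (c : ConnectedComponents X) : ConnectedSpace ↥{x : X | ConnectedComponents.mk x = c} := by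
  obtain ⟨x, rfl⟩ := ConnectedComponents.surjective_coe c
  have e : {y : X | ConnectedComponents.mk y = ConnectedComponents.mk x} = connectedComponent x :=
    Set.ext fun y => ConnectedComponents.coe_eq_coe'
  rw [e]
  exact isConnected_iff_connectedSpace.1 isConnected_connectedComponent
theorem LC.fin [CompactSpace X] (h : LC X) : Finite (ConnectedComponents X) := by
  have : DiscreteTopology (ConnectedComponents X) := discreteTopology_iff_isOpen_singleton.2 fun c =>
    ConnectedComponents.isQuotientMap_coe.isOpen_preimage.1 (h.comp c).2
  exact finite_of_compact_of_discrete
theorem main {m : ℕ} {A : Set X} (hp : Pair (m + 1) X A) (hA : Good A) (hB : Pair m A ∅) :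
    SimVol (m + 1) A ∅ ≤ SimVol (m + 2) X A := by
  classical
  have := hp.t2
  have := hp.cpt
  have := hB.cpt
  have := hp.lc.fin
  have := hB.lc.fin
  have := Fintype.ofFinite (ConnectedComponents X)
  have := Fintype.ofFinite (ConnectedComponents A)
  have hg : Continuous (Subtype.val : A → X) := continuous_subtype_val
  let g : ConnectedComponents A → ConnectedComponents X := hg.connectedComponentsMap
  rw [SimVol, SimVol, finsum_eq_sum_of_fintype, finsum_eq_sum_of_fintype, ← Finset.sum_fiberwise _ g]
  refine Finset.sum_le_sum fun c _ => ?_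
  rw [Finset.sum_subtype _ (p := fun d => g d = c) (by simp)]
  have := comp_conn c
  have hcl := hp.lc.comp c
  let j : ∀ d : {d // g d = c}, C(↥{x : A | ConnectedComponents.mk x = d.1}, ↥{x : X | ConnectedComponents.mk x = c}) :=
    fun d =>
      have h1 : ∀ x : ↥{x : A | ConnectedComponents.mk x = d.1}, x.1.1 ∈ {x : X | ConnectedComponents.mk x = c} :=
        fun x => (congrArg g x.2 : g (ConnectedComponents.mk x.1) = g d.1).trans d.2
      ⟨fun x => ⟨x.1.1, h1 x⟩, (continuous_subtype_val.comp continuous_subtype_val).subtype_mk h1⟩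
  have hj : ∀ d, Pc (j d) (vl {x : X | ConnectedComponents.mk x = c} ⁻¹' A) := fun d => by
    have he : Topology.IsEmbedding (Subtype.val ∘ j d) :=
      (Topology.IsEmbedding.subtypeVal (p := (· ∈ A))).comp Topology.IsEmbedding.subtypeVal
    refine ⟨.of_comp (j d).continuous continuous_subtype_val he, fun b => b.1.2, fun n σ hσ => ?_⟩
    let τ : SingSimplex n A := ⟨fun x => ⟨(σ x).1, hσ x⟩, (continuous_subtype_val.comp σ.continuous).subtype_mk hσ⟩
    refine (sep_clopen (hB.lc.comp d.1) τ).imp (fun h x => ⟨⟨τ x, h x⟩, rfl⟩) fun h x hx => ?_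
    obtain ⟨b, hb⟩ := hx
    refine h x ?_
    have : τ x = b.1 := Subtype.ext (congrArg Subtype.val hb).symm
    rw [this]; exact b.2
  have := fun d : {d // g d = c} => comp_conn d.1
  have key := per_comp (hp.clopen hcl) (hA.cover (cov_incl hcl)) Finset.univ j hj (fun d d' x x' e => by
    have : x.1 = x'.1 := Subtype.ext (congrArg (fun y => y.1) e)
    exact Subtype.ext (x.2.symm.trans ((congrArg ConnectedComponents.mk this).trans x'.2))) (fun d => by
      have := hB.clopen (hB.lc.comp d.1)
      rwa [Set.preimage_empty] at this)
  exact key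
end SV

/-- **Statement 15.**  Every compact boundary irreducible aspherical `n`-manifold, `n ≥ 2`,
with aspherical boundary satisfies `‖M, ∂M‖ ≥ ‖∂M‖`. -/
theorem simvol_aspherical_boundary_bound (n : ℕ) (hn : 2 ≤ n) (M : Type)
    [TopologicalSpace M] [CompactSpace M] (hM : IsManifoldWithBoundary n M)
    (h1 : Aspherical M) (h2 : BoundaryIrreducible n M)
    (h3 : Aspherical ↥(intBoundary n M)) :
    SimVol (n - 1) ↥(intBoundary n M) (∅ : Set ↥(intBoundary n M)) ≤
      SimVol n M (intBoundary n M) := by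
  have _ := h1
  obtain ⟨m, rfl⟩ : ∃ m, n = m + 2 := ⟨n - 2, by omega⟩
  have := hM.1
  exact SV.main ⟨hM.1, inferInstance, SV.mf_le hM⟩ (SV.Good.of h2 h3)
    ⟨inferInstance, isCompact_iff_compactSpace.1 (SV.bd_closed _).isCompact,
      (SV.mf_bd hM).pull SV.wr_emb.isLocalHomeomorph⟩

end
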